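/- arXiv:2101.09881 — 5 statements merged into one kernel-verified Lean document; each statement's English description precedes it below -/
import Mathlib

section
/- Let 𝒫 be a class of unital C*-algebras that is closed under tensoring with matrix algebras and under passing to unital hereditary C*-subalgebras. Then the class ATA𝒫 of simple unital C*-algebras asymptotically tracially in 𝒫 is closed under tensoring with matrix algebras and under passing to unital hereditary C*-subalgebras; that is, if A ∈ ATA𝒫 then M_m(A) ∈ ATA𝒫 for every integer m ≥ 1, and pAp ∈ ATA𝒫 for every nonzero projection p ∈ A. -/
open Filter Topology Matrix

/-- Cuntz subequivalence for matrices over a topological *-ring. -/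
def MatCuntzLE {R : Type} [NonUnitalRing R] [StarRing R] [TopologicalSpace R]
    {ι κ : Type} [Fintype ι] [Fintype κ] (a : Matrix ι ι R) (b : Matrix κ κ R) : Prop :=
  ∃ v : ℕ → Matrix ι κ R,
    Filter.Tendsto (fun k => v k * b * (v k)ᴴ) Filter.atTop (nhds a)

/-- Positivity of a matrix over a C*-algebra: `a = cᴴ * c` for some `c`. -/
def MatPos {R : Type} [NonUnitalRing R] [StarRing R] {ι : Type} [Fintype ι]
    (a : Matrix ι ι R) : Prop :=
  ∃ c : Matrix ι ι R, a = cᴴ * c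

/-- The `k`-fold direct sum `a ⊕ ⋯ ⊕ a`, representing `k⟨a⟩` in the Cuntz semigroup. -/
def matRep {R : Type} [NonUnitalRing R] {ι : Type} (k : ℕ) (a : Matrix ι ι R) :
    Matrix (ι × Fin k) (ι × Fin k) R :=
  Matrix.blockDiagonal fun _ : Fin k => a

/-- `β`-comparison in the sense of Kirchberg–Rørdam. -/
def BetaComparison (R : Type) [NonUnitalRing R] [StarRing R] [TopologicalSpace R] (β : ℝ) : Prop :=
  ∀ (n m k l : ℕ), 1 ≤ k → 1 ≤ l → β * (l : ℝ) < (k : ℝ) →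
    ∀ (a : Matrix (Fin n) (Fin n) R) (b : Matrix (Fin m) (Fin m) R),
      MatPos a → MatPos b → MatCuntzLE (matRep k a) (matRep l b) → MatCuntzLE a b

/-- `n`-comparison in the sense of Winter. -/
def NComparison (R : Type) [NonUnitalRing R] [StarRing R] [TopologicalSpace R] (N : ℕ) : Prop :=
  ∀ (na : ℕ) (mb : Fin (N + 1) → ℕ)
    (a : Matrix (Fin na) (Fin na) R) (b : ∀ j, Matrix (Fin (mb j)) (Fin (mb j)) R),
    MatPos a → (∀ j, MatPos (b j)) →
    (∀ j, ∃ k : ℕ, 1 ≤ k ∧ MatCuntzLE (matRep (k + 1) a) (matRep k (b j))) →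
    MatCuntzLE a (Matrix.blockDiagonal' b)

/-- Almost unperforation of the Cuntz semigroup `W(R)`. -/
def AlmostUnperforatedW (R : Type) [NonUnitalRing R] [StarRing R] [TopologicalSpace R] : Prop :=
  ∀ (n m : ℕ) (a : Matrix (Fin n) (Fin n) R) (b : Matrix (Fin m) (Fin m) R),
    MatPos a → MatPos b →
    ∀ k : ℕ, 1 ≤ k → MatCuntzLE (matRep (k + 1) a) (matRep k b) → MatCuntzLE a b

/-- Stable finiteness: every isometry in every matrix algebra is a unitary. -/
def StablyFinite (R : Type) [Ring R] [StarRing R] : Prop :=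
  ∀ (n : ℕ) (v : Matrix (Fin n) (Fin n) R), vᴴ * v = 1 → v * vᴴ = 1



/-- Cuntz subequivalence for elements of a C*-algebra. -/
def CuntzLE {A : Type} [Mul A] [Star A] [TopologicalSpace A] (a b : A) : Prop :=
  ∃ v : ℕ → A, Filter.Tendsto (fun k => v k * b * star (v k)) Filter.atTop (nhds a)

/-- A completely positive contractive linear map between C*-algebras. -/
def IsCPC {A B : Type} [NonUnitalCStarAlgebra A] [NonUnitalCStarAlgebra B]
    [NormedSpace ℂ A] [NormedSpace ℂ B] [StarModule ℂ A] [StarModule ℂ B]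
    (φ : A →ₗ[ℂ] B) : Prop :=
  (∀ x, ‖φ x‖ ≤ ‖x‖) ∧
    ∀ (n : ℕ) (a : Matrix (Fin n) (Fin n) A), MatPos a → MatPos (a.map φ)

/-- A bundled unital C*-algebra. -/
structure BundledCStarAlgebra : Type 1 where
  carrier : Type
  [str : CStarAlgebra carrier]

attribute [instance] BundledCStarAlgebra.str

/-- A unital C*-algebra is (topologically) simple if its only closed two-sided ideals
are trivial. -/
def IsSimpleCStarAlgebra (A : Type) [CStarAlgebra A] : Prop :=
  ∀ I : TwoSidedIdeal A, IsClosed (I : Set A) → I = ⊥ ∨ I = ⊤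


/-- Definition (Fu–Lin): `A` is asymptotically tracially in the class `P`. -/
def AsympTraciallyIn (P : BundledCStarAlgebra → Prop) (A : Type) [CStarAlgebra A] : Prop :=
  ∀ (ε : ℝ), 0 < ε → ∀ (F : Finset A) (c : A), (∃ d : A, c = star d * d) → c ≠ 0 →
    ∃ B : BundledCStarAlgebra, P B ∧
      ∃ (α : A →ₗ[ℂ] B.carrier) (βn : ℕ → (B.carrier →ₗ[ℂ] A)) (γn : ℕ → (A →ₗ[ℂ] A)),
        IsCPC α ∧ (∀ n, IsCPC (βn n)) ∧ (∀ n, IsCPC (γn n)) ∧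
        -- each `γn` maps into `A ∩ βn(B)^⊥`
        (∀ (n : ℕ) (x : A) (b : B.carrier),
          γn n x * βn n b = 0 ∧ βn n b * γn n x = 0) ∧
        -- (1)
        α 1 = 1 ∧
        (∀ n : ℕ, IsIdempotentElem (βn n 1) ∧ IsSelfAdjoint (βn n 1) ∧
          IsIdempotentElem (γn n 1) ∧ IsSelfAdjoint (γn n 1) ∧
          βn n 1 + γn n 1 = 1) ∧
        -- (2)
        (∀ x ∈ F, ∀ n : ℕ, ‖x - γn n x - βn n (α x)‖ < ε) ∧
        -- (3) `α` is an `F`-`ε` approximate embedding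
        (∀ x ∈ F, ∀ y ∈ F, ‖α x * α y - α (x * y)‖ < ε) ∧
        (∀ x ∈ F, ‖x‖ - ε ≤ ‖α x‖) ∧
        -- (4)
        (∀ x y : B.carrier,
          Filter.Tendsto (fun n => ‖βn n (x * y) - βn n x * βn n y‖) Filter.atTop (nhds 0) ∧
          Filter.Tendsto (fun n => ‖βn n x‖) Filter.atTop (nhds ‖x‖)) ∧
        -- (5)
        (∀ n : ℕ, CuntzLE (γn n 1) c)


/-- The hereditary corner `pAp` of a C*-algebra, as a non-unital star subalgebra. -/
def cstarCorner {A : Type} [CStarAlgebra A] (p : A)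
    (hp : IsIdempotentElem p) (hps : IsSelfAdjoint p) : NonUnitalStarSubalgebra ℂ A where
  carrier := {x | p * x * p = x}
  add_mem' := by
    intro x y hx hy
    simp only [Set.mem_setOf_eq] at *
    rw [mul_add, add_mul, hx, hy]
  zero_mem' := by simp
  mul_mem' := by
    intro x y hx hy
    simp only [Set.mem_setOf_eq] at *
    have hpx : p * x = x := by
      conv_lhs => rw [← hx]
      rw [← mul_assoc, ← mul_assoc, hp.eq]
      exact hx
    have hyp : y * p = y := by
      conv_lhs => rw [← hy]
      rw [mul_assoc, hp.eq]
      exact hy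
    calc p * (x * y) * p = (p * x) * (y * p) := by rw [mul_assoc, mul_assoc, mul_assoc]
    _ = x * y := by rw [hpx, hyp]
  smul_mem' := by
    intro c x hx
    simp only [Set.mem_setOf_eq] at *
    rw [mul_smul_comm, smul_mul_assoc, hx]
  star_mem' := by
    intro x hx
    simp only [Set.mem_setOf_eq] at *
    conv_rhs => rw [← hx]
    simp [StarMul.star_mul, hps.star_eq, mul_assoc]

/-- Membership in the class `ATA P`: a simple unital C*-algebra asymptotically
tracially in `P`. -/
def MemATA (P : BundledCStarAlgebra → Prop) (A : Type) [CStarAlgebra A] : Prop :=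
  IsSimpleCStarAlgebra A ∧ AsympTraciallyIn P A

/-- Entrywise positivity preservation on all matrix sizes. -/
def MatPosPres {A B : Type} [CStarAlgebra A] [CStarAlgebra B] (φ : A →ₗ[ℂ] B) : Prop :=
  ∀ (n : ℕ) (a : Matrix (Fin n) (Fin n) A), MatPos a → MatPos (a.map φ)

lemma IsCPC.pos {A B : Type} [CStarAlgebra A] [CStarAlgebra B] {φ : A →ₗ[ℂ] B}
    (h : IsCPC φ) : MatPosPres φ := h.2

lemma MatPosPres.exists_star {A B : Type} [CStarAlgebra A] [CStarAlgebra B] {φ : A →ₗ[ℂ] B}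
    (h : MatPosPres φ) (d : A) : ∃ e : B, φ (star d * d) = star e * e := by
  obtain ⟨c, hc⟩ := h 1 (Matrix.of fun _ _ => star d * d) ⟨Matrix.of fun _ _ => d, by
    ext i j; simp [Matrix.mul_apply, Matrix.conjTranspose_apply]⟩
  refine ⟨c 0 0, ?_⟩
  have := congrFun (congrFun hc 0) 0
  simpa [Matrix.mul_apply, Matrix.conjTranspose_apply] using this

/-- The Kadison `2 × 2` trick. -/
lemma MatPosPres.two {A B : Type} [CStarAlgebra A] [CStarAlgebra B] {φ : A →ₗ[ℂ] B}
    (h : MatPosPres φ) (x : A) : ∃ c : Matrix (Fin 2) (Fin 2) B,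
      φ (x * star x) = star (c 0 0) * c 0 0 + star (c 1 0) * c 1 0 ∧
      φ x = star (c 0 0) * c 0 1 + star (c 1 0) * c 1 1 ∧
      φ (star x) = star (c 0 1) * c 0 0 + star (c 1 1) * c 1 0 ∧
      φ 1 = star (c 0 1) * c 0 1 + star (c 1 1) * c 1 1 := by
  obtain ⟨c, hc⟩ := h 2 !![x * star x, x; star x, 1] ⟨!![star x, 1; 0, 0], by
    ext i j; fin_cases i <;> fin_cases j <;>
      simp [Matrix.mul_apply, Matrix.conjTranspose_apply]⟩
  refine ⟨c, ?_, ?_, ?_, ?_⟩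
  · simpa [Matrix.mul_apply, Matrix.conjTranspose_apply] using congrFun (congrFun hc 0) 0
  · simpa [Matrix.mul_apply, Matrix.conjTranspose_apply] using congrFun (congrFun hc 0) 1
  · simpa [Matrix.mul_apply, Matrix.conjTranspose_apply] using congrFun (congrFun hc 1) 0
  · simpa [Matrix.mul_apply, Matrix.conjTranspose_apply] using congrFun (congrFun hc 1) 1

lemma MatPosPres.map_star {A B : Type} [CStarAlgebra A] [CStarAlgebra B] {φ : A →ₗ[ℂ] B}
    (h : MatPosPres φ) (x : A) : φ (star x) = star (φ x) := by
  obtain ⟨c, -, h1, h2, -⟩ := h.two x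
  rw [h1, h2]; simp

lemma MatPosPres.isCPC {A B : Type} [CStarAlgebra A] [CStarAlgebra B] {φ : A →ₗ[ℂ] B}
    (h : MatPosPres φ) (h1 : ‖φ 1‖ ≤ 1) : IsCPC φ := by
  let _ := CStarAlgebra.spectralOrder A
  let _ := CStarAlgebra.spectralOrderedRing A
  let _ := CStarAlgebra.spectralOrder B
  let _ := CStarAlgebra.spectralOrderedRing B
  have hnn : ∀ a : A, 0 ≤ a → 0 ≤ φ a := by
    intro a ha
    obtain ⟨d, rfl⟩ := CStarAlgebra.nonneg_iff_eq_star_mul_self.mp ha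
    obtain ⟨e, he⟩ := h.exists_star d
    rw [he]; exact star_mul_self_nonneg e
  refine ⟨fun x => ?_, h⟩
  rcases eq_or_ne x 0 with rfl | hx
  · simp
  have hx0 : 0 < ‖x‖ ^ 2 := by positivity
  set s : ℝ := ‖x‖ ^ 2 with hs
  obtain ⟨c, hA, hX, -, hD⟩ := h.two x
  have hAs : φ (x * star x) ≤ s • φ 1 := by
    have := hnn (algebraMap ℝ A s - x * star x)
      (sub_nonneg.mpr CStarAlgebra.mul_star_le_algebraMap_norm_sq)
    rw [map_sub, sub_nonneg, Algebra.algebraMap_eq_smul_one] at this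
    refine this.trans_eq ?_
    exact LinearMap.map_smul_of_tower φ s 1
  have hA0 : 0 ≤ φ (x * star x) := hnn _ (mul_star_self_nonneg x)
  have hAn : ‖φ (x * star x)‖ ≤ s := by
    refine (CStarAlgebra.norm_le_norm_of_nonneg_of_le hA0 hAs).trans ?_
    rw [norm_smul, Real.norm_of_nonneg hx0.le]
    nlinarith
  set X := φ x
  have key : 0 ≤ star X * φ (x * star x) * X - s • (star X * X) - s • (star X * X)
      + (s * s) • φ 1 := by
    have e : star X * φ (x * star x) * X - s • (star X * X) - s • (star X * X)
      + (s * s) • φ 1 = star (c 0 0 * X - s • c 0 1) * (c 0 0 * X - s • c 0 1)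
        + star (c 1 0 * X - s • c 1 1) * (c 1 0 * X - s • c 1 1) := by
      have hX' : star X = star (c 0 1) * c 0 0 + star (c 1 1) * c 1 0 := by
        rw [hX]; simp
      have e1 : s • (star X * X) = star X * (s • (star (c 0 0) * c 0 1 + star (c 1 0) * c 1 1)) := by
        rw [mul_smul_comm, ← hX]
      have e2 : s • (star X * X) = (s • (star (c 0 1) * c 0 0 + star (c 1 1) * c 1 0)) * X := by
        rw [smul_mul_assoc, ← hX']
      nth_rewrite 1 [e1]
      rw [e2, hA, hD]
      simp only [star_sub, star_mul, star_smul, star_trivial, mul_sub, sub_mul, mul_add, add_mul,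
        smul_add, smul_sub, mul_smul_comm, smul_mul_assoc, smul_smul, mul_assoc]
      abel
    rw [e]
    exact add_nonneg (star_mul_self_nonneg _) (star_mul_self_nonneg _)
  have h2 : star X * φ (x * star x) * X ≤ s • (star X * X) := by
    refine (CStarAlgebra.star_left_conjugate_le_norm_smul (a := X)
      (b := φ (x * star x)) (IsSelfAdjoint.of_nonneg hA0)).trans ?_
    exact smul_le_smul_of_nonneg_right hAn (star_mul_self_nonneg X)
  have h3 : s • (star X * X) ≤ s • (s • φ 1) := by
    rw [smul_smul]
    have h4 : 0 ≤ (s • (star X * X)) - s • (star X * X) - s • (star X * X) + (s * s) • φ 1 :=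
      key.trans (by gcongr)
    rw [sub_self, zero_sub, neg_add_eq_sub, sub_nonneg] at h4
    exact h4
  have h5 : ‖s • (star X * X)‖ ≤ ‖s • (s • φ 1)‖ :=
    CStarAlgebra.norm_le_norm_of_nonneg_of_le
      (smul_nonneg hx0.le (star_mul_self_nonneg X)) h3
  rw [norm_smul, norm_smul, norm_smul, Real.norm_of_nonneg hx0.le,
    CStarRing.norm_star_mul_self] at h5
  have h6 : ‖X‖ * ‖X‖ ≤ s := by
    have := le_of_mul_le_mul_left h5 hx0
    nlinarith
  rw [hs] at h6
  nlinarith [norm_nonneg X, norm_nonneg x]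

lemma MatPos.conj {A : Type} [CStarAlgebra A] {ι : Type} [Fintype ι] [DecidableEq ι]
    {a : Matrix ι ι A} (h : MatPos a) (z : A) : MatPos (a.map fun x => z * x * star z) := by
  obtain ⟨c, rfl⟩ := h
  refine ⟨c.map (fun x => x * star z), ?_⟩
  ext i j
  simp [Matrix.mul_apply, Matrix.conjTranspose_apply, Finset.mul_sum, Finset.sum_mul, mul_assoc]

lemma MatPosPres.comp {A B C : Type} [CStarAlgebra A] [CStarAlgebra B] [CStarAlgebra C]
    {φ : A →ₗ[ℂ] B} {ψ : B →ₗ[ℂ] C}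
    (hψ : MatPosPres ψ) (h : MatPosPres φ) : MatPosPres (ψ ∘ₗ φ) := by
  intro n a ha
  have := hψ n _ (h n a ha)
  rwa [Matrix.map_map] at this

lemma IsCPC.compr {A B C : Type} [CStarAlgebra A] [CStarAlgebra B] [CStarAlgebra C]
    {φ : A →ₗ[ℂ] B} {ψ : B →ₗ[ℂ] C}
    (hψ : IsCPC ψ) (h : IsCPC φ) : IsCPC (ψ ∘ₗ φ) :=
  ⟨fun x => (hψ.1 _).trans (h.1 x), MatPosPres.comp hψ.pos h.pos⟩

/-- Star homomorphisms preserve matrix positivity. -/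
lemma matPosPres_of_hom {A B : Type} [CStarAlgebra A] [CStarAlgebra B] (φ : A →ₗ[ℂ] B)
    (hm : ∀ x y, φ (x * y) = φ x * φ y) (hs : ∀ x, φ (star x) = star (φ x)) :
    MatPosPres φ := by
  rintro n _ ⟨c, rfl⟩
  refine ⟨c.map φ, ?_⟩
  ext i j
  simp [Matrix.mul_apply, Matrix.conjTranspose_apply, hm, hs]

lemma MatPos.reindex {R : Type} [NonUnitalRing R] [StarRing R] {ι κ : Type} [Fintype ι]
    [Fintype κ] {a : Matrix ι ι R} (h : MatPos a) (e : κ ≃ ι) : MatPos (a.submatrix e e) := by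
  obtain ⟨c, rfl⟩ := h
  exact ⟨c.submatrix e e, by
    rw [Matrix.conjTranspose_submatrix, Matrix.submatrix_mul_equiv]⟩

lemma MatPosPres.fintype {A B : Type} [CStarAlgebra A] [CStarAlgebra B] {φ : A →ₗ[ℂ] B}
    (h : MatPosPres φ) {ι : Type} [Fintype ι] {a : Matrix ι ι A} (ha : MatPos a) :
    MatPos (a.map φ) := by
  have e := Fintype.equivFin ι
  have := (h _ _ (ha.reindex e.symm)).reindex e
  convert this using 1
  ext i j; simp

/-- Every nonzero element algebraically generates the whole ring as a two-sided ideal. -/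
def AlgSimple (R : Type) [Ring R] : Prop :=
  ∀ e : R, e ≠ 0 → ∃ (n : ℕ) (x y : Fin n → R), ∑ i, x i * e * y i = 1

lemma mem_span_exists {R : Type} [Ring R] {e z : R} (hz : z ∈ TwoSidedIdeal.span {e}) :
    ∃ (n : ℕ) (x y : Fin n → R), ∑ i, x i * e * y i = z := by
  induction hz using TwoSidedIdeal.span_induction with
  | mem x h => exact ⟨1, fun _ => 1, fun _ => 1, by simp at h; simp [h]⟩
  | zero => exact ⟨0, Fin.elim0, Fin.elim0, by simp⟩
  | add a b _ _ ha hb =>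
    obtain ⟨n, x, y, rfl⟩ := ha
    obtain ⟨m, x', y', rfl⟩ := hb
    exact ⟨n + m, Fin.append x x', Fin.append y y', by simp [Fin.sum_univ_add]⟩
  | neg a _ ha =>
    obtain ⟨n, x, y, rfl⟩ := ha
    exact ⟨n, fun i => - x i, y, by simp⟩
  | left_absorb b a _ ha =>
    obtain ⟨n, x, y, rfl⟩ := ha
    exact ⟨n, fun i => b * x i, y, by simp [Finset.mul_sum, mul_assoc]⟩
  | right_absorb b a _ ha =>
    obtain ⟨n, x, y, rfl⟩ := ha
    exact ⟨n, x, fun i => y i * b, by simp [Finset.sum_mul, mul_assoc]⟩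

lemma IsSimpleCStarAlgebra.algSimple {A : Type} [CStarAlgebra A] (h : IsSimpleCStarAlgebra A) :
    AlgSimple A := by
  intro e he
  let S : Set A := (TwoSidedIdeal.span {e} : TwoSidedIdeal A)
  let I : TwoSidedIdeal A := TwoSidedIdeal.mk' (closure S)
    (subset_closure (TwoSidedIdeal.zero_mem _))
    (fun {x y} hx hy => map_mem_closure₂ continuous_add hx hy
      (fun a ha b hb => TwoSidedIdeal.add_mem _ ha hb))
    (fun {x} hx => map_mem_closure continuous_neg hx
      (fun a ha => TwoSidedIdeal.neg_mem _ ha))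
    (fun {x y} hy => map_mem_closure (continuous_const_mul x) hy
      (fun a ha => TwoSidedIdeal.mul_mem_left _ _ _ ha))
    (fun {x y} hy => map_mem_closure (f := fun z => z * y) (continuous_mul_const y) hy
      (fun a ha => TwoSidedIdeal.mul_mem_right _ _ _ ha))
  have hI : (I : Set A) = closure S := by
    ext z; simp [I]
  have heS : e ∈ S := TwoSidedIdeal.subset_span rfl
  have heI : e ∈ (I : Set A) := by rw [hI]; exact subset_closure heS
  rcases h I (by rw [hI]; exact isClosed_closure) with h0 | h0
  · rw [h0] at heI
    exact absurd ((TwoSidedIdeal.mem_bot A).1 heI) he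
  · have h1 : (1 : A) ∈ closure S := by rw [← hI, h0]; trivial
    obtain ⟨b, hb, hd⟩ := Metric.mem_closure_iff.1 h1 1 one_pos
    rw [dist_eq_norm] at hd
    have hu := (Units.oneSub (1 - b) hd).isUnit
    simp only [Units.val_oneSub, sub_sub_cancel] at hu
    obtain ⟨u, hu⟩ := hu
    apply mem_span_exists
    have := TwoSidedIdeal.mul_mem_left (TwoSidedIdeal.span {e}) (↑u⁻¹ : A) b hb
    rwa [← hu, Units.inv_mul] at this

lemma AlgSimple.isSimple {A : Type} [CStarAlgebra A] (h : AlgSimple A) :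
    IsSimpleCStarAlgebra A := by
  intro I _
  by_cases hI : I = ⊥
  · exact Or.inl hI
  right
  have : ∃ e ∈ I, e ≠ 0 := by
    by_contra hc
    push Not at hc
    apply hI
    rw [eq_bot_iff]
    intro x hx
    rw [hc x hx]; exact TwoSidedIdeal.zero_mem _
  obtain ⟨e, heI, he⟩ := this
  obtain ⟨n, x, y, hxy⟩ := h e he
  rw [eq_top_iff]
  intro z _
  have h1 : (1 : A) ∈ I := by
    rw [← hxy]
    exact sum_mem fun i _ => TwoSidedIdeal.mul_mem_right _ _ _
      (TwoSidedIdeal.mul_mem_left _ _ _ heI)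
  simpa using TwoSidedIdeal.mul_mem_left I z 1 h1

lemma AlgSimple.matrix {R : Type} [Ring R] (h : AlgSimple R) (m : ℕ) :
    AlgSimple (Matrix (Fin m) (Fin m) R) := by
  intro M hM
  have : ∃ i j, M i j ≠ 0 := by
    by_contra hc
    push Not at hc
    exact hM (by ext i j; simp [hc i j])
  obtain ⟨i, j, hij⟩ := this
  obtain ⟨n, x, y, hxy⟩ := h _ hij
  let E := (finProdFinEquiv : Fin m × Fin n ≃ _)
  refine ⟨m * n, fun k => Matrix.single (E.symm k).1 i (x (E.symm k).2),
    fun k => Matrix.single j (E.symm k).1 (y (E.symm k).2), ?_⟩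
  rw [Fintype.sum_equiv E.symm _ (fun k : Fin m × Fin n => Matrix.single k.1 i (x k.2) * M *
    Matrix.single j k.1 (y k.2)) (fun _ => rfl), Fintype.sum_prod_type]
  have : ∀ (l : Fin m) (k : Fin n), Matrix.single l i (x k) * M * Matrix.single j l (y k)
      = Matrix.single l l (x k * M i j * y k) := by
    intro l k
    rw [Matrix.single_mul_mul_single]
  simp only [this]
  have h2 : ∀ l : Fin m, ∑ k, Matrix.single l l (x k * M i j * y k) = Matrix.single l l (1 : R) := by
    intro l
    rw [← hxy]
    ext a b
    simp [Matrix.sum_apply, Matrix.single_apply]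
  simp only [h2]
  ext a b
  simp [Matrix.sum_apply, Matrix.single_apply, Matrix.one_apply, ite_and]

lemma AlgSimple.ofEquiv {R S : Type} [Ring R] [Ring S] (h : AlgSimple R) (f : R → S)
    (g : S → R) (hgf : ∀ x, f (g x) = x)
    (hm : ∀ x y, f (x * y) = f x * f y) (ha : ∀ x y, f (x + y) = f x + f y)
    (h1 : f 1 = 1) : AlgSimple S := by
  intro e he
  have h0 : f 0 = 0 := by simpa using ha 0 0
  have hne : g e ≠ 0 := by
    intro h; apply he; rw [← hgf e, h, h0]
  obtain ⟨n, x, y, hxy⟩ := h _ hne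
  refine ⟨n, fun i => f (x i), fun i => f (y i), ?_⟩
  let F : R →+ S := ⟨⟨f, h0⟩, ha⟩
  have := congrArg F hxy
  rw [map_sum] at this
  have h2 : ∀ x, F x = f x := fun _ => rfl
  simpa [h2, hm, hgf, h1] using this

lemma AlgSimple.exists_mul_ne {R : Type} [Ring R] (h : AlgSimple R) {t y : R} (ht : t ≠ 0)
    (hy : y ≠ 0) : ∃ a, t * a * y ≠ 0 := by
  by_contra hc
  push Not at hc
  obtain ⟨n, x, z, hxz⟩ := h y hy
  apply ht
  rw [← mul_one t, ← hxz, Finset.mul_sum]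
  apply Finset.sum_eq_zero
  intro i _
  rw [← mul_assoc, ← mul_assoc, hc, zero_mul]

/-- Almost projections are close to projections. -/
lemma almost_projection {A : Type} [CStarAlgebra A] {a : A} (ha : IsSelfAdjoint a) {δ : ℝ}
    (hδ : δ ≤ 1 / 8) (h : ‖a * a - a‖ ≤ δ) :
    ∃ y q : A, IsSelfAdjoint y ∧ q = y * a * y ∧ IsIdempotentElem q ∧ IsSelfAdjoint q ∧
      y * q = y ∧ q * y = y ∧ (∃ w, y = a * w ∧ y = w * a) ∧ ‖y - a‖ ≤ 4 * δ ∧ ‖q - a‖ ≤ 4 * δ ∧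
      ‖y‖ ≤ 2 := by
  have hδ0 : 0 ≤ δ := (norm_nonneg _).trans h
  have hsp : ∀ t ∈ spectrum ℝ a, |t * t - t| ≤ δ := by
    intro t ht
    have h1 := norm_apply_le_norm_cfc (fun t : ℝ => t * t - t) a ht
    rw [cfc_sub (fun t : ℝ => t * t) (fun t => t) a, cfc_mul (fun t : ℝ => t) (fun t => t) a,
      cfc_id' ℝ a] at h1
    exact h1.trans h
  -- the two alternatives on the spectrum
  obtain ⟨f, hf, hcase⟩ : ∃ f : ℝ → ℝ, Continuous f ∧ ∀ t ∈ spectrum ℝ a, (f t = 0 ∧ |t| ≤ 2 * δ) ∨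
      (0 < f t ∧ f t * t * f t = 1 ∧ |1 - t| ≤ 2 * δ ∧ |f t - 1| ≤ 2 * δ ∧ f t ≤ 2) := by
    let f : ℝ → ℝ := fun t => max 0 (min 1 (4 * t - 3 / 2)) * (√(max t (1 / 2)))⁻¹
    have hf : Continuous f := by
      apply Continuous.mul (by fun_prop)
      apply Continuous.inv₀ (by fun_prop)
      intro t
      have : (0 : ℝ) < max t (1 / 2) := lt_max_of_lt_right (by norm_num)
      exact (Real.sqrt_pos.2 this).ne'
    have hcase : ∀ t ∈ spectrum ℝ a, (f t = 0 ∧ |t| ≤ 2 * δ) ∨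
        (0 < f t ∧ f t * t * f t = 1 ∧ |1 - t| ≤ 2 * δ ∧ |f t - 1| ≤ 2 * δ ∧ f t ≤ 2) := by
      intro t ht
      have h1 := abs_le.1 (hsp t ht)
      have h2 : t ≤ 3 / 8 ∨ 5 / 8 ≤ t := by
        by_contra hc
        push Not at hc
        nlinarith
      rcases h2 with h2 | h2
      · left
        constructor
        · have : max 0 (min 1 (4 * t - 3 / 2)) = 0 := by
            apply max_eq_left
            exact (min_le_right _ _).trans (by linarith)
          simp [f, this]
        · rw [abs_le]; constructor <;> nlinarith
      · right
        have e1 : max 0 (min 1 (4 * t - 3 / 2)) = 1 := by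
          rw [min_eq_left (by linarith)]; simp
        have e2 : max t (1 / 2) = t := max_eq_left (by linarith)
        have e3 : f t = (√t)⁻¹ := by simp only [f, e1, e2, one_mul]
        have hr : √t * √t = t := Real.mul_self_sqrt (by linarith)
        have hr0 : 0 < √t := Real.sqrt_pos.2 (by linarith)
        set r := √t
        have hr1 : 3 / 4 ≤ r := by nlinarith
        have e4 : |1 - t| ≤ 8 / 5 * δ := by
          rw [abs_le]; constructor <;> nlinarith
        rw [e3]
        refine ⟨by positivity, ?_, ?_, ?_, ?_⟩
        · rw [← hr]; field_simp
        · linarith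
        · have : r⁻¹ - 1 = (1 - t) * (r * (1 + r))⁻¹ := by
            rw [← hr]; field_simp; ring
          rw [this, abs_mul]
          have : |(r * (1 + r))⁻¹| ≤ 1 := by
            rw [abs_of_nonneg (by positivity)]
            apply inv_le_one_of_one_le₀; nlinarith
          nlinarith [abs_nonneg (1 - t)]
        · rw [inv_le_comm₀ hr0 (by norm_num)]; linarith
    exact ⟨f, hf, hcase⟩
  let y := cfc f a
  have hy : y = cfc f a := rfl
  have hya : y * a = cfc (fun t => f t * t) a := by
    rw [cfc_mul f (fun t => t) a hf.continuousOn continuousOn_id, cfc_id' ℝ a]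
  have hq : y * a * y = cfc (fun t => f t * t * f t) a := by
    rw [hya, cfc_mul (fun t => f t * t) f a (hf.mul continuous_id).continuousOn hf.continuousOn]
  have hyq : y * (y * a * y) = y := by
    rw [hq, hy, ← cfc_mul f (fun t => f t * t * f t) a hf.continuousOn ((hf.mul continuous_id).mul hf).continuousOn]
    apply cfc_congr
    intro t ht
    rcases hcase t ht with ⟨h1, -⟩ | ⟨h0, h1, -⟩
    · simp [h1]
    · simp [h1]
  have hqy : (y * a * y) * y = y := by
    rw [hq, hy, ← cfc_mul (fun t => f t * t * f t) f a ((hf.mul continuous_id).mul hf).continuousOn hf.continuousOn]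
    apply cfc_congr
    intro t ht
    rcases hcase t ht with ⟨h1, -⟩ | ⟨h0, h1, -⟩
    · simp [h1]
    · simp [h1]
  refine ⟨y, y * a * y, cfc_predicate f a, rfl, ?_, ?_, hyq, hqy, ⟨y * y * y, ?_, ?_⟩, ?_, ?_, ?_⟩
  · unfold IsIdempotentElem
    calc y * a * y * (y * a * y) = (y * a * y * y) * a * y := by simp only [mul_assoc]
      _ = y * a * y := by rw [hqy]
  · rw [hq]; exact cfc_predicate _ a
  · have : Commute a y := (IsSelfAdjoint.commute_cfc ha (Commute.refl a) f).symm
    calc y = y * (y * a * y) := hyq.symm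
      _ = y * (a * y) * y := by rw [this.eq]; simp only [mul_assoc]
      _ = a * (y * y * y) := by rw [← mul_assoc, ← this.eq]; simp only [mul_assoc]
  · have : Commute a y := (IsSelfAdjoint.commute_cfc ha (Commute.refl a) f).symm
    rw [mul_assoc (y * y), ← this.eq, mul_assoc y, ← mul_assoc y a y]
    exact hyq.symm
  · rw [hy]
    nth_rewrite 2 [← cfc_id' ℝ a]
    rw [← cfc_sub f (fun t => t) a hf.continuousOn continuousOn_id]
    apply norm_cfc_le (by positivity)
    intro t ht
    rw [Real.norm_eq_abs]
    rcases hcase t ht with ⟨h1, h2⟩ | ⟨h0, h1, h2, h3, -⟩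
    · rw [h1, zero_sub, abs_neg]; linarith
    · have := abs_le.1 h2
      have := abs_le.1 h3
      rw [abs_le]; constructor <;> linarith
  · rw [hq]
    nth_rewrite 2 [← cfc_id' ℝ a]
    rw [← cfc_sub (fun t => f t * t * f t) (fun t => t) a ((hf.mul continuous_id).mul hf).continuousOn continuousOn_id]
    apply norm_cfc_le (by positivity)
    intro t ht
    rw [Real.norm_eq_abs]
    rcases hcase t ht with ⟨h1, h2⟩ | ⟨h0, h1, h2, h3, -⟩
    · rw [h1]; simp; linarith
    · rw [h1]; linarith
  · apply norm_cfc_le (by norm_num)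
    intro t ht
    rw [Real.norm_eq_abs]
    rcases hcase t ht with ⟨h1, h2⟩ | ⟨h0, h1, h2, h3, h4⟩
    · rw [h1]; simp
    · rwa [abs_of_pos h0]

/-- Cuntz-type absorption: a projection near `r g r` is of the form `z g z*`. -/
lemma exists_conj_eq {A : Type} [CStarAlgebra A] {r g : A} (hr : IsIdempotentElem r)
    (hrs : IsSelfAdjoint r) (hg : IsSelfAdjoint g) (h : ‖r - r * g * r‖ < 1) :
    ∃ z, z * g * star z = r := by
  let k : A := r * g * r + (1 - r)
  have hks : IsSelfAdjoint k := by
    have h1 : IsSelfAdjoint (r * g * r) := by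
      simp [IsSelfAdjoint, hrs.star_eq, hg.star_eq, mul_assoc]
    exact h1.add ((IsSelfAdjoint.one A).sub hrs)
  have hk1 : ‖1 - k‖ < 1 := by
    have : 1 - k = r - r * g * r := by simp only [k]; abel
    rwa [this]
  have hpos : ∀ t ∈ spectrum ℝ k, 0 < t := by
    intro t ht
    have h1 := norm_apply_le_norm_cfc (fun t : ℝ => 1 - t) k ht
    rw [cfc_sub (fun _ : ℝ => 1) (fun t => t) k, cfc_id' ℝ k, cfc_const_one ℝ k,
      Real.norm_eq_abs] at h1
    have := (abs_lt.1 (h1.trans_lt hk1)).2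
    linarith
  have hcont : ContinuousOn (fun t : ℝ => (√t)⁻¹) (spectrum ℝ k) := by
    apply ContinuousOn.inv₀ (by fun_prop)
    intro t ht
    exact (Real.sqrt_pos.2 (hpos t ht)).ne'
  let z := cfc (fun t : ℝ => (√t)⁻¹) k
  have hzs : IsSelfAdjoint z := cfc_predicate _ k
  have hzkz : z * k * z = 1 := by
    have e1 : z * k = cfc (fun t : ℝ => (√t)⁻¹ * t) k := by
      rw [cfc_mul (fun t : ℝ => (√t)⁻¹) (fun t => t) k hcont continuousOn_id, cfc_id' ℝ k]
    rw [e1, ← cfc_mul (fun t : ℝ => (√t)⁻¹ * t) (fun t : ℝ => (√t)⁻¹) k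
      (hcont.mul continuousOn_id) hcont, ← cfc_const_one ℝ k]
    apply cfc_congr
    intro t ht
    have h0 := Real.sqrt_pos.2 (hpos t ht)
    have hr : √t * √t = t := Real.mul_self_sqrt (hpos t ht).le
    simp only
    nth_rewrite 2 [← hr]
    field_simp
  have hrk : k * r = r * g * r := by
    simp only [k, add_mul, sub_mul, one_mul, hr.eq, sub_self, add_zero, mul_assoc]
  have hkr : r * k = r * g * r := by
    simp only [k, mul_add, mul_sub, mul_one, hr.eq, sub_self, add_zero, ← mul_assoc]
  have hc : Commute r z := by
    have : Commute k r := by unfold Commute SemiconjBy; rw [hrk, hkr]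
    exact (IsSelfAdjoint.commute_cfc hks this _).symm
  refine ⟨z * r, ?_⟩
  rw [star_mul, hrs.star_eq, hzs.star_eq]
  calc z * r * g * (r * z) = z * (r * g * r) * z := by simp only [mul_assoc]
    _ = z * (k * r) * z := by rw [hrk]
    _ = z * k * (r * z) := by simp only [mul_assoc]
    _ = z * k * z * r := by rw [hc.eq]; simp only [mul_assoc]
    _ = r := by rw [hzkz, one_mul]

lemma split_selfAdjoint {A : Type} [CStarAlgebra A] {k : A} (hk : IsSelfAdjoint k) :
    (∃ t : ℝ, k * k = t • k) ∨
      ∃ u v, k * u ≠ 0 ∧ k * v ≠ 0 ∧ star (k * u) * (k * v) = 0 := by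
  by_cases hc : ∃ s ∈ spectrum ℝ k, ∃ t ∈ spectrum ℝ k, s ≠ 0 ∧ t ≠ 0 ∧ s ≠ t
  · right
    obtain ⟨s, hs, t, ht, hs0, ht0, hst⟩ := hc
    let δ := |s - t| / 2
    have hδ : 0 < δ := by have := abs_pos.2 (sub_ne_zero.2 hst); simp only [δ]; linarith
    let f : ℝ → ℝ → ℝ := fun s x => max 0 (δ - |x - s|)
    have hf : ∀ s, Continuous (f s) := fun s => by simp only [f]; fun_prop
    have hmul : ∀ s, k * cfc (f s) k = cfc (fun x => x * f s x) k := by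
      intro s
      rw [cfc_mul (fun x => x) (f s) k (by fun_prop) (hf s).continuousOn, cfc_id' ℝ k]
    have hcon : ∀ s, ContinuousOn (fun x => x * f s x) (spectrum ℝ k) := fun s =>
      (continuous_id.mul (hf s)).continuousOn
    have hne : ∀ s ∈ spectrum ℝ k, s ≠ 0 → k * cfc (f s) k ≠ 0 := by
      intro s hs hs0 h0
      rw [hmul] at h0
      have h1 := norm_apply_le_norm_cfc (fun x => x * f s x) k hs (hcon s)
      rw [h0, norm_zero] at h1
      have h2 := norm_le_zero_iff.1 h1
      simp only [f, sub_self, abs_zero, sub_zero, max_eq_right hδ.le] at h2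
      exact (mul_ne_zero hs0 hδ.ne') h2
    refine ⟨cfc (f s) k, cfc (f t) k, hne s hs hs0, hne t ht ht0, ?_⟩
    rw [hmul, hmul, (cfc_predicate (fun x => x * f s x) k : IsSelfAdjoint _).star_eq,
      ← cfc_mul _ _ k (hcon s) (hcon t)]
    have : (fun x => x * f s x * (x * f t x)) = fun _ => 0 := by
      ext x
      have : f s x = 0 ∨ f t x = 0 := by
        simp only [f]
        by_contra hc
        push Not at hc
        have h1 : |x - s| < δ := by
          by_contra h; exact hc.1 (max_eq_left (by linarith))
        have h2 : |x - t| < δ := by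
          by_contra h; exact hc.2 (max_eq_left (by linarith))
        have h3 : |s - t| ≤ |x - s| + |x - t| := by
          have : s - t = (x - t) - (x - s) := by ring
          rw [this, add_comm]; exact abs_sub _ _
        simp only [δ] at h1 h2
        linarith
      rcases this with h | h <;> simp [h]
    rw [this, cfc_const_zero]
  · left
    push Not at hc
    have : ∃ t : ℝ, ∀ s ∈ spectrum ℝ k, s ≠ 0 → s = t := by
      by_cases h : ∃ t ∈ spectrum ℝ k, t ≠ 0
      · obtain ⟨t, ht, ht0⟩ := h
        exact ⟨t, fun s hs hs0 => hc s hs t ht hs0 ht0⟩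
      · push Not at h
        exact ⟨0, fun s hs _ => h s hs⟩
    obtain ⟨t, ht⟩ := this
    refine ⟨t, ?_⟩
    have e : k * k = cfc (fun x : ℝ => x * x) k := by
      rw [cfc_mul (fun x : ℝ => x) (fun x => x) k, cfc_id' ℝ k]
    have e2 : t • k = cfc (fun x : ℝ => t * x) k := by
      rw [cfc_const_mul t (fun x : ℝ => x) k, cfc_id' ℝ k]
    rw [e, e2]
    apply cfc_congr
    intro s hs
    by_cases h0 : s = 0
    · simp [h0]
    · simp [← ht s hs h0]

/-- Minimal projections. -/
def HasMinProj (A : Type) [CStarAlgebra A] : Prop :=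
  ∃ e : A, e ≠ 0 ∧ IsIdempotentElem e ∧ IsSelfAdjoint e ∧ ∀ a, ∃ l : ℂ, e * a * e = l • e

lemma split_or_min {A : Type} [CStarAlgebra A] {s : A} (hs : s ≠ 0) :
    (∃ u v, s * u ≠ 0 ∧ s * v ≠ 0 ∧ star (s * u) * (s * v) = 0) ∨ HasMinProj A := by
  by_cases h : ∃ x : A, IsSelfAdjoint x ∧
      ¬ ∃ t : ℝ, (s * x * star s) * (s * x * star s) = t • (s * x * star s)
  · left
    obtain ⟨x, hx, ht⟩ := h
    have hk : IsSelfAdjoint (s * x * star s) := by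
      simp [IsSelfAdjoint, hx.star_eq, mul_assoc]
    rcases split_selfAdjoint hk with h | ⟨u, v, hu, hv, huv⟩
    · exact absurd h ht
    · refine ⟨x * star s * u, x * star s * v, ?_, ?_, ?_⟩
      · simpa only [mul_assoc] using hu
      · simpa only [mul_assoc] using hv
      · simpa only [mul_assoc] using huv
  right
  push Not at h
  have hk0 : s * star s ≠ 0 := by
    rwa [Ne, CStarRing.mul_star_self_eq_zero_iff]
  obtain ⟨t, ht⟩ := h 1 (IsSelfAdjoint.one A)
  rw [mul_one] at ht
  have ht0 : t ≠ 0 := by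
    rintro rfl
    rw [zero_smul] at ht
    have h2 : star (s * star s) = s * star s := by simp
    nth_rewrite 1 [← h2] at ht
    rw [CStarRing.star_mul_self_eq_zero_iff] at ht
    exact hk0 ht
  let e : A := t⁻¹ • (s * star s)
  have he0 : e ≠ 0 := smul_ne_zero (inv_ne_zero ht0) hk0
  have hee : e * e = e := by
    simp only [e, smul_mul_smul_comm, ht, smul_smul]
    congr 1; field_simp
  have hes : IsSelfAdjoint e := by
    simp [e, IsSelfAdjoint]
  have H : ∀ a : A, IsSelfAdjoint a → ∃ r : ℝ, (e * a * e) * (e * a * e) = r • (e * a * e) := by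
    intro a ha
    have : e * a * e = s * ((t⁻¹ * t⁻¹) • (star s * a * s)) * star s := by
      simp only [e, smul_mul_assoc, mul_smul_comm, smul_smul, mul_assoc]
    rw [this]
    apply h
    simp [IsSelfAdjoint, ha.star_eq, mul_assoc]
  have H2 : ∀ a : A, IsSelfAdjoint a → ∃ r : ℝ, e * a * e = r • e := by
    intro a ha
    obtain ⟨r, hr⟩ := H a ha
    have hbs : star (e * a * e) = e * a * e := by simp [ha.star_eq, hes.star_eq, mul_assoc]
    by_cases hr0 : r = 0
    · refine ⟨0, ?_⟩
      rw [hr0, zero_smul] at hr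
      nth_rewrite 1 [← hbs] at hr
      rw [CStarRing.star_mul_self_eq_zero_iff] at hr
      rw [hr, zero_smul]
    let p := r⁻¹ • (e * a * e)
    have hpb : e * a * e = r • p := by simp [p, smul_smul, hr0]
    have hpp : p * p = p := by
      simp only [p, smul_mul_smul_comm, hr, smul_smul]
      congr 1; field_simp
    have hep : e * p = p := by
      simp only [p, mul_smul_comm, ← mul_assoc, hee]
    have hpe : p * e = p := by
      simp only [p, smul_mul_assoc, mul_assoc, hee]
    by_cases hp0 : p = 0
    · exact ⟨0, by rw [hpb, hp0]; simp⟩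
    obtain ⟨t', ht'⟩ := H (1 + r⁻¹ • a) ((IsSelfAdjoint.one A).add (by simp [IsSelfAdjoint, ha.star_eq]))
    have e1 : e * (1 + r⁻¹ • a) * e = e + p := by
      simp only [mul_add, add_mul, mul_one, hee, p, mul_smul_comm, smul_mul_assoc]
    rw [e1] at ht'
    have e2 : (e + p) * (e + p) = e + (3 : ℝ) • p := by
      have : (3 : ℝ) • p = p + p + p := by
        rw [show (3 : ℝ) = 1 + 1 + 1 by norm_num, add_smul, add_smul, one_smul]
      rw [this]
      simp only [mul_add, add_mul, hee, hep, hpe, hpp]; abel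
    rw [e2] at ht'
    have e3 : (4 : ℝ) • p = (2 * t') • p := by
      have := congrArg (fun z => z * p) ht'
      simp only [add_mul, smul_mul_assoc, hep, hpp] at this
      have h4 : (4 : ℝ) • p = p + (3 : ℝ) • p := by
        rw [show (4 : ℝ) = 1 + 3 by norm_num, add_smul, one_smul]
      rw [h4, this, ← two_smul ℝ p, smul_smul, mul_comm]
    have e4 : t' = 2 := by
      have := smul_left_injective ℝ hp0 e3
      linarith
    rw [e4] at ht'
    have e5 : p = e := by
      have h3 : (3 : ℝ) • p = (2 : ℝ) • p + p := by
        rw [show (3 : ℝ) = 2 + 1 by norm_num, add_smul, one_smul]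
      rw [smul_add, two_smul ℝ e, h3] at ht'
      have : e + ((2 : ℝ) • p + p) - e - (2 : ℝ) • p = e + e + (2 : ℝ) • p - e - (2 : ℝ) • p := by
        rw [ht']
      have l : e + ((2 : ℝ) • p + p) - e - (2 : ℝ) • p = p := by abel
      have l2 : e + e + (2 : ℝ) • p - e - (2 : ℝ) • p = e := by abel
      rw [← l, this, l2]
    exact ⟨r, by rw [hpb, e5]⟩
  clear_value e
  refine ⟨e, he0, hee, hes, fun a => ?_⟩
  obtain ⟨r1, h1⟩ := H2 (realPart a : A) (realPart a).2
  obtain ⟨r2, h2⟩ := H2 (imaginaryPart a : A) (imaginaryPart a).2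
  refine ⟨(r1 : ℂ) + Complex.I * r2, ?_⟩
  nth_rewrite 1 [← realPart_add_I_smul_imaginaryPart a]
  rw [mul_add, add_mul, h1, mul_smul_comm, smul_mul_assoc, h2, add_smul, mul_smul]
  simp

/-- Without minimal projections one finds arbitrarily many equivalent orthogonal elements. -/
lemma exists_orthogonal {A : Type} [CStarAlgebra A] (hA : AlgSimple A) (hmin : ¬ HasMinProj A) :
    ∀ (m : ℕ) (s : A), s ≠ 0 → ∃ (r : Fin (m + 1) → A) (d : A), star d * d ≠ 0 ∧
      ∀ i j, star (s * r i) * (s * r j) = if i = j then star d * d else 0 := by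
  intro m
  induction m with
  | zero =>
    intro s hs
    refine ⟨fun _ => 1, s, ?_, ?_⟩
    · rwa [Ne, CStarRing.star_mul_self_eq_zero_iff]
    · intro i j
      have : i = j := by omega
      simp [this]
  | succ m ih =>
    intro s hs
    obtain ⟨u, v, hu, hv, huv⟩ := (split_or_min hs).resolve_right hmin
    obtain ⟨r, d, hd, hr⟩ := ih (s * u) hu
    have hd0 : d ≠ 0 := by rintro rfl; simp at hd
    have hv' : star (s * v) ≠ 0 := by rwa [Ne, star_eq_zero]
    obtain ⟨a, ha⟩ := hA.exists_mul_ne hd0 hv'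
    let _ := CStarAlgebra.spectralOrder A
    let _ := CStarAlgebra.spectralOrderedRing A
    let g : A := d * a * star (s * v)
    let h : A := star g * g
    have hh0 : 0 ≤ h := star_mul_self_nonneg g
    have hhs : star h = h := by simp [h]
    have hne : h ≠ 0 := by rwa [Ne, CStarRing.star_mul_self_eq_zero_iff]
    let k : A := CFC.sqrt h
    have hkk : k * k = h := CFC.sqrt_mul_sqrt_self h hh0
    have hks : star k = k := (IsSelfAdjoint.of_nonneg (CFC.sqrt_nonneg h)).star_eq
    have hdiv : h = s * (v * (star a * star d * g)) := by
      simp only [h, g, star_mul, star_star, mul_assoc]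
    have hcomm : k * h * k = h * h := by
      rw [← hkk]; simp only [mul_assoc]
    have key : ∀ i j, star (s * (u * r i * a * star (s * v) * k)) *
        (s * (u * r j * a * star (s * v) * k)) = if i = j then h * h else 0 := by
      intro i j
      have e1 : star (s * (u * r i * a * star (s * v) * k)) *
        (s * (u * r j * a * star (s * v) * k)) =
          k * ((s * v) * star a * (star (s * u * r i) * (s * u * r j)) * a * star (s * v)) * k := by
        simp only [star_mul, star_star, mul_assoc, hks]
      rw [e1, hr i j]
      split_ifs with hij
      · rw [← hcomm]
        simp only [h, g, star_mul, star_star, mul_assoc]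
      · simp
    have key2 : ∀ i, star (s * (u * r i * a * star (s * v) * k)) * h = 0 := by
      intro i
      have : star (s * (u * r i * a * star (s * v) * k)) * h =
          star (r i * a * star (s * v) * k) * (star (s * u) * (s * v)) * (star a * star d * g) := by
        nth_rewrite 1 [hdiv]
        simp only [star_mul, star_star, mul_assoc]
      rw [this, huv]; simp
    refine ⟨Fin.snoc (fun i => u * r i * a * star (s * v) * k) (v * (star a * star d * g)), h,
      by rwa [Ne, CStarRing.star_mul_self_eq_zero_iff], ?_⟩
    intro i j
    rw [hhs]
    induction i using Fin.lastCases with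
    | last =>
      induction j using Fin.lastCases with
      | last => simp only [Fin.snoc_last, if_true, ← hdiv, hhs]
      | cast j =>
        simp only [Fin.snoc_last, Fin.snoc_castSucc, ← hdiv, hhs]
        have := congrArg star (key2 j)
        rw [star_mul, star_star, hhs, star_zero] at this
        rw [this, if_neg (Fin.castSucc_lt_last j).ne']
    | cast i =>
      induction j using Fin.lastCases with
      | last =>
        simp only [Fin.snoc_last, Fin.snoc_castSucc, ← hdiv]
        rw [key2, if_neg (Fin.castSucc_lt_last i).ne]
      | cast j =>
        simp only [Fin.snoc_castSucc, key, Fin.castSucc_inj]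

lemma exists_diag_below {A : Type} [CStarAlgebra A] (hA : AlgSimple A) (hmin : ¬ HasMinProj A)
    {m : ℕ} (D : Matrix (Fin m) (Fin m) A) (hD : D ≠ 0) :
    ∃ d : A, star d * d ≠ 0 ∧ ∃ V : Matrix (Fin m) (Fin m) A,
      Vᴴ * (Dᴴ * D) * V = Matrix.diagonal (fun _ => star d * d) := by
  have : ∃ i j, D i j ≠ 0 := by
    by_contra hc
    push Not at hc
    exact hD (by ext i j; simp [hc i j])
  obtain ⟨l, i, hli⟩ := this
  obtain ⟨m, rfl⟩ : ∃ k, m = k + 1 := ⟨m - 1, by have := i.2; omega⟩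
  let _ := CStarAlgebra.spectralOrder A
  let _ := CStarAlgebra.spectralOrderedRing A
  let h : A := ∑ j, star (D j i) * D j i
  have hpos : ∀ j, 0 ≤ star (D j i) * D j i := fun j => star_mul_self_nonneg _
  have hh0 : 0 ≤ h := Finset.sum_nonneg fun j _ => hpos j
  have hne : h ≠ 0 := by
    intro h0
    have := (Finset.sum_eq_zero_iff_of_nonneg (fun j _ => hpos j)).1 h0 l (Finset.mem_univ _)
    exact hli ((CStarRing.star_mul_self_eq_zero_iff _).1 this)
  let s : A := CFC.sqrt h
  have hss : s * s = h := CFC.sqrt_mul_sqrt_self h hh0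
  have hst : star s = s := (IsSelfAdjoint.of_nonneg (CFC.sqrt_nonneg h)).star_eq
  have hs0 : s ≠ 0 := by intro h0; rw [h0] at hss; exact hne (by rw [← hss]; simp)
  obtain ⟨r, d, hd, hr⟩ := exists_orthogonal hA hmin m s hs0
  refine ⟨d, hd, Matrix.of fun a b => if a = i then r b else 0, ?_⟩
  ext a b
  have e1 : (Dᴴ * D) i i = h := by simp [Matrix.mul_apply, Matrix.conjTranspose_apply, h]
  have e2 := hr a b
  have e3 : star (s * r a) * (s * r b) = star (r a) * h * r b := by
    rw [← hss, star_mul, hst]; simp only [mul_assoc]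
  rw [e3] at e2
  rw [Matrix.diagonal_apply, ← e2, ← e1]
  rw [Matrix.mul_apply, Finset.sum_eq_single i]
  · rw [Matrix.mul_apply, Finset.sum_eq_single i]
    · simp
    · intro b _ hb; simp [hb]
    · simp
  · intro b _ hb; simp [hb]
  · simp

lemma HasMinProj.trivial_projections {A : Type} [CStarAlgebra A] (hA : AlgSimple A)
    (hmin : HasMinProj A) : ∃ (F : Finset A) (ε : ℝ), 0 < ε ∧ ∀ g : A, IsIdempotentElem g →
      IsSelfAdjoint g → (∀ x ∈ F, ‖g * x - x * g‖ ≤ ε) → g = 0 ∨ g = 1 := by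
  classical
  obtain ⟨e, he0, hee, hes, hl⟩ := hmin
  obtain ⟨n, x, y, hxy⟩ := hA e he0
  let C : ℝ := ∑ i, ‖x i * e‖
  have hC : 0 ≤ C := Finset.sum_nonneg fun i _ => norm_nonneg _
  refine ⟨Finset.univ.image (fun i => e * y i), (1 / 2) / (C + 1), by positivity, ?_⟩
  intro g hg hgs hF
  obtain ⟨l, hl⟩ := hl g
  have hlt : ‖g - l • (1 : A)‖ < 1 / 2 := by
    have e1 : g = ∑ i, x i * e * (e * y i * g) := by
      have : ∀ i, x i * e * (e * y i * g) = (x i * e * y i) * g := by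
        intro i
        calc x i * e * (e * y i * g) = x i * (e * e) * y i * g := by simp only [mul_assoc]
          _ = _ := by rw [hee.eq]
      simp only [this]
      rw [← Finset.sum_mul, hxy, one_mul]
    have e2 : l • (1 : A) = ∑ i, x i * e * (g * (e * y i)) := by
      rw [← hxy, Finset.smul_sum]
      apply Finset.sum_congr rfl
      intro i _
      have : x i * e * (g * (e * y i)) = x i * (e * g * e) * y i := by simp only [mul_assoc]
      rw [this, hl]
      simp
    have e3 : g - l • (1 : A) = ∑ i, x i * e * (e * y i * g - g * (e * y i)) := by
      nth_rewrite 1 [e1]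
      rw [e2, ← Finset.sum_sub_distrib]
      simp only [mul_sub]
    rw [e3]
    have : ‖∑ i, x i * e * (e * y i * g - g * (e * y i))‖ ≤ ∑ i, ‖x i * e‖ * ((1 / 2) / (C + 1)) := by
      apply norm_sum_le_of_le
      intro i _
      apply (norm_mul_le _ _).trans
      apply mul_le_mul_of_nonneg_left _ (norm_nonneg _)
      rw [norm_sub_rev]
      exact hF _ (Finset.mem_image_of_mem _ (Finset.mem_univ i))
    apply this.trans_lt
    rw [← Finset.sum_mul]
    change C * _ < _
    rw [mul_div_assoc', div_lt_iff₀ (by positivity)]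
    linarith
  have hproj : ∀ q : A, IsIdempotentElem q → IsSelfAdjoint q → q ≠ 0 → ‖q‖ = 1 := by
    intro q h1 h2 h3
    have := CStarRing.norm_star_mul_self (x := q)
    rw [h2.star_eq, h1.eq] at this
    have h4 : ‖q‖ ≠ 0 := norm_ne_zero_iff.2 h3
    field_simp at this
    linarith
  by_contra hc
  push Not at hc
  have n1 := hproj g hg hgs hc.1
  have n2 := hproj (1 - g) hg.one_sub ((IsSelfAdjoint.one A).sub hgs)
    (sub_ne_zero.2 (Ne.symm hc.2))
  have m1 : ‖(1 - l) • g‖ < 1 / 2 := by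
    have : (1 - l) • g = g * (g - l • (1 : A)) := by
      rw [mul_sub, hg.eq, sub_smul, one_smul]; simp
    rw [this]
    apply (norm_mul_le _ _).trans_lt
    rw [n1, one_mul]; exact hlt
  have m2 : ‖l • (1 - g)‖ < 1 / 2 := by
    have : l • (1 - g) = - ((1 - g) * (g - l • (1 : A))) := by
      rw [mul_sub, sub_mul, hg.eq]; simp
    rw [this, norm_neg]
    apply (norm_mul_le _ _).trans_lt
    rw [n2, one_mul]; exact hlt
  rw [norm_smul, n1, mul_one] at m1
  rw [norm_smul, n2, mul_one] at m2
  have := norm_add_le (1 - l) l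
  simp at this
  linarith

/-- The C*-algebra of matrices over a C*-algebra. -/
def MM (m : ℕ) (A : Type) : Type := CStarMatrix (Fin m) (Fin m) A

noncomputable instance MM.instCStar (m : ℕ) (A : Type) [CStarAlgebra A] : CStarAlgebra (MM m A) :=
  @CStarMatrix.instCStarAlgebra A _ (CStarAlgebra.spectralOrder A)
    (CStarAlgebra.spectralOrderedRing A) (Fin m) _ _

namespace MM
variable {m : ℕ} {A B : Type} [CStarAlgebra A] [CStarAlgebra B]

/-- Entries. -/
def ent (x : MM m A) (i j : Fin m) : A := x i j

/-- Build from entries. -/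
def mk (f : Fin m → Fin m → A) : MM m A := Matrix.of f

@[simp] lemma ent_mk (f : Fin m → Fin m → A) (i j) : (mk f).ent i j = f i j := rfl

lemma ext {x y : MM m A} (h : ∀ i j, x.ent i j = y.ent i j) : x = y := by
  funext i j; exact h i j

@[simp] lemma ent_add (x y : MM m A) (i j) : (x + y).ent i j = x.ent i j + y.ent i j := rfl
@[simp] lemma ent_sub (x y : MM m A) (i j) : (x - y).ent i j = x.ent i j - y.ent i j := rfl
@[simp] lemma ent_zero (i j) : (0 : MM m A).ent i j = 0 := rfl
@[simp] lemma ent_smul (c : ℂ) (x : MM m A) (i j) : (c • x).ent i j = c • x.ent i j := rfl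
lemma ent_mul (x y : MM m A) (i j) : (x * y).ent i j = ∑ k, x.ent i k * y.ent k j := rfl
@[simp] lemma ent_star (x : MM m A) (i j) : (star x).ent i j = star (x.ent j i) := rfl
lemma ent_one (i j) : (1 : MM m A).ent i j = if i = j then 1 else 0 := rfl

lemma norm_ent_le (x : MM m A) (i j) : ‖x.ent i j‖ ≤ ‖x‖ :=
  @CStarMatrix.norm_entry_le_norm _ _ A _ _ (CStarAlgebra.spectralOrder A)
    (CStarAlgebra.spectralOrderedRing A) _ x i j

/-- The identification with Mathlib's matrices. -/
def toMat : MM m A ≃⋆ₐ[ℂ] Matrix (Fin m) (Fin m) A where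
  toFun x := Matrix.of fun i j => x.ent i j
  invFun x := mk fun i j => x i j
  left_inv _ := rfl
  right_inv _ := rfl
  map_mul' _ _ := rfl
  map_add' _ _ := rfl
  map_smul' _ _ := rfl
  map_star' _ := rfl

/-- Entries as additive maps. -/
def entHom (i j : Fin m) : MM m A →+ A where
  toFun x := x.ent i j
  map_zero' := rfl
  map_add' _ _ := rfl

@[simp] lemma ent_sum {ι : Type} (s : Finset ι) (f : ι → MM m A) (i j) :
    (∑ k ∈ s, f k).ent i j = ∑ k ∈ s, (f k).ent i j :=
  map_sum (entHom (A := A) i j) f s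

/-- Matrix units times an element. -/
def sgl (i j : Fin m) (a : A) : MM m A := mk fun k l => if k = i ∧ l = j then a else 0

/-- Diagonal corner embedding. -/
def sglHom (i : Fin m) : A →⋆ₙₐ[ℂ] MM m A where
  toFun a := sgl i i a
  map_smul' c a := by apply ext; intro k l; simp [sgl]
  map_zero' := by apply ext; intro k l; simp [sgl]
  map_add' a b := by
    apply ext; intro k l; simp only [sgl, ent_mk, ent_add]; split_ifs <;> simp
  map_mul' a b := by
    apply ext; intro k l
    simp only [sgl, ent_mul, ent_mk]
    rw [Finset.sum_eq_single i]
    · by_cases h1 : k = i <;> by_cases h2 : l = i <;> simp [h1, h2]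
    · intro b _ hb; simp [hb]
    · simp
  map_star' a := by
    apply ext; intro k l
    simp only [sgl, ent_mk, ent_star]
    by_cases h1 : k = i <;> by_cases h2 : l = i <;> simp [h1, h2]

lemma norm_sgl_le (i j : Fin m) (a : A) : ‖sgl i j a‖ ≤ ‖a‖ := by
  have h1 : star (sgl i j a) * sgl i j a = sglHom j (star a * a) := by
    apply ext; intro k l
    simp only [sglHom, NonUnitalStarAlgHom.coe_mk', NonUnitalAlgHom.coe_mk, sgl, ent_mul, ent_mk,
      ent_star]
    change _ = (sgl j j (star a * a)).ent k l
    simp only [sgl, ent_mk]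
    rw [Finset.sum_eq_single i]
    · by_cases h1 : k = j <;> by_cases h2 : l = j <;> simp [h1, h2]
    · intro b _ hb; simp [hb]
    · simp
  have h2 := NonUnitalStarAlgHom.norm_apply_le (sglHom (m := m) j) (star a * a)
  rw [← h1, CStarRing.norm_star_mul_self, CStarRing.norm_star_mul_self] at h2
  nlinarith [norm_nonneg a, norm_nonneg (sgl i j a)]

end MM
namespace MM
variable {m : ℕ} {A B : Type} [CStarAlgebra A] [CStarAlgebra B]

lemma norm_le_sum (x : MM m A) : ‖x‖ ≤ ∑ i, ∑ j, ‖x.ent i j‖ := by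
  have : x = ∑ i, ∑ j, sgl i j (x.ent i j) := by
    apply ext; intro k l
    simp only [ent_sum, sgl, ent_mk]
    rw [Finset.sum_eq_single k, Finset.sum_eq_single l]
    · simp
    · intro b _ hb; simp [Ne.symm hb]
    · simp
    · intro b _ hb; apply Finset.sum_eq_zero; intro j _; simp [Ne.symm hb]
    · simp
  nth_rewrite 1 [this]
  apply norm_sum_le_of_le
  intro i _
  apply norm_sum_le_of_le
  intro j _
  exact norm_sgl_le _ _ _

lemma norm_le_of_ent {x : MM m A} {δ : ℝ} (h : ∀ i j, ‖x.ent i j‖ ≤ δ) : ‖x‖ ≤ (m : ℝ) ^ 2 * δ := by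
  apply (norm_le_sum x).trans
  calc ∑ i, ∑ j, ‖x.ent i j‖ ≤ ∑ i : Fin m, ∑ j : Fin m, δ :=
        Finset.sum_le_sum fun i _ => Finset.sum_le_sum fun j _ => h i j
    _ = _ := by simp; ring

/-- Amplification. -/
noncomputable def amp (m : ℕ) (φ : A →ₗ[ℂ] B) : MM m A →ₗ[ℂ] MM m B where
  toFun x := mk fun i j => φ (x.ent i j)
  map_add' x y := by apply ext; intro i j; simp
  map_smul' x y := by apply ext; intro i j; simp

@[simp] lemma ent_amp (φ : A →ₗ[ℂ] B) (x : MM m A) (i j) :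
    (amp m φ x).ent i j = φ (x.ent i j) := rfl

/-- Diagonal. -/
def dg (a : A) : MM m A := mk fun i j => if i = j then a else 0

lemma dg_mul (a b : A) : (dg a * dg b : MM m A) = dg (a * b) := by
  apply ext; intro i j
  simp only [ent_mul, dg, ent_mk]
  rw [Finset.sum_eq_single i]
  · by_cases h : i = j <;> simp [h]
  · intro k _ hk; simp [Ne.symm hk]
  · simp

lemma dg_add (a b : A) : (dg a + dg b : MM m A) = dg (a + b) := by
  apply ext; intro i j
  simp only [ent_add, dg, ent_mk]
  by_cases h : i = j <;> simp [h]

lemma dg_star (a : A) : (star (dg a) : MM m A) = dg (star a) := by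
  apply ext; intro i j
  simp only [ent_star, dg, ent_mk]
  by_cases h : i = j
  · simp [h]
  · simp [h, Ne.symm h]

lemma dg_one : (dg 1 : MM m A) = 1 := rfl

lemma dg_zero : (dg 0 : MM m A) = 0 := by
  apply ext; intro i j; simp [dg]

lemma amp_one (φ : A →ₗ[ℂ] B) : amp m φ 1 = dg (φ 1) := by
  apply ext; intro i j
  simp only [ent_amp, ent_one, dg, ent_mk]
  by_cases h : i = j <;> simp [h]

lemma amp_star {φ : A →ₗ[ℂ] B} (h : MatPosPres φ) (x : MM m A) :
    amp m φ (star x) = star (amp m φ x) := by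
  apply ext; intro i j
  simp [h.map_star]

lemma amp_mul_le (φ : A →ₗ[ℂ] B) (x y : MM m A) :
    ‖amp m φ (x * y) - amp m φ x * amp m φ y‖ ≤
      ∑ i, ∑ j, ∑ k, ‖φ (x.ent i k * y.ent k j) - φ (x.ent i k) * φ (y.ent k j)‖ := by
  apply (norm_le_sum _).trans
  apply Finset.sum_le_sum; intro i _
  apply Finset.sum_le_sum; intro j _
  simp only [ent_sub, ent_amp, ent_mul, map_sum]
  rw [← Finset.sum_sub_distrib]
  exact norm_sum_le _ _

lemma amp_pos {φ : A →ₗ[ℂ] B} (h : MatPosPres φ) : MatPosPres (amp m φ) := by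
  rintro n a ⟨c, rfl⟩
  have h1 : MatPos (Matrix.of fun p q : Fin n × Fin m => ((cᴴ * c) p.1 q.1).ent p.2 q.2) := by
    refine ⟨Matrix.of fun p q : Fin n × Fin m => (c p.1 q.1).ent p.2 q.2, ?_⟩
    ext p q
    simp only [Matrix.of_apply, Matrix.mul_apply, Matrix.conjTranspose_apply, ent_sum, ent_mul,
      ent_star]
    rw [Fintype.sum_prod_type]
  obtain ⟨d, hd⟩ := h.fintype h1
  refine ⟨Matrix.of fun i j => mk fun k l => d (i, k) (j, l), ?_⟩
  ext i j
  apply ext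
  intro k l
  have := congrFun (congrFun hd (i, k)) (j, l)
  simp only [Matrix.map_apply, Matrix.of_apply] at this
  simp only [Matrix.map_apply, ent_amp]
  refine Eq.trans this ?_
  simp only [Matrix.mul_apply, Matrix.conjTranspose_apply]
  rw [Fintype.sum_prod_type]
  exact (ent_sum Finset.univ (fun x : Fin n =>
    star (mk fun k l => d (x, k) (i, l)) * mk fun k l => d (x, k) (j, l)) k l).symm

end MM

lemma norm_proj_le {A : Type} [CStarAlgebra A] {q : A} (h1 : IsIdempotentElem q)
    (h2 : IsSelfAdjoint q) : ‖q‖ ≤ 1 := by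
  have := CStarRing.norm_star_mul_self (x := q)
  rw [h2.star_eq, h1.eq] at this
  by_contra hc
  push Not at hc
  nlinarith

lemma MM.amp_cpc {m : ℕ} {A B : Type} [CStarAlgebra A] [CStarAlgebra B] {φ : A →ₗ[ℂ] B}
    (h : IsCPC φ) (h1 : IsIdempotentElem (φ 1)) (h2 : IsSelfAdjoint (φ 1)) :
    IsCPC (MM.amp m φ) := by
  apply (MM.amp_pos h.pos).isCPC
  rw [MM.amp_one]
  apply norm_proj_le
  · unfold IsIdempotentElem; rw [MM.dg_mul, h1.eq]
  · unfold IsSelfAdjoint; rw [MM.dg_star, h2.star_eq]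

/-- Approximate isometric star homomorphisms. -/
def AppIso {A B : Type} [CStarAlgebra A] [CStarAlgebra B] (E : Finset A) (δ : ℝ)
    (φ : A →ₗ[ℂ] B) : Prop :=
  MatPosPres φ ∧ (∀ x ∈ E, ∀ y ∈ E, ‖φ x * φ y - φ (x * y)‖ ≤ δ) ∧ ∀ x ∈ E, ‖x‖ - δ ≤ ‖φ x‖

lemma AppIso.mono {A B : Type} [CStarAlgebra A] [CStarAlgebra B] {E E' : Finset A} {δ δ' : ℝ}
    {φ : A →ₗ[ℂ] B} (h : AppIso E δ φ) (hE : E' ⊆ E) (hδ : δ ≤ δ') : AppIso E' δ' φ :=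
  ⟨h.1, fun x hx y hy => (h.2.1 x (hE hx) y (hE hy)).trans hδ,
    fun x hx => by have := h.2.2 x (hE hx); linarith⟩

/-- All entries of a matrix. -/
noncomputable def entries {A : Type} {m : ℕ} (x : MM m A) : Finset A :=
  (Set.finite_range (fun p : Fin m × Fin m => x.ent p.1 p.2)).toFinset

lemma mem_entries {A : Type} {m : ℕ} (x : MM m A) (i j : Fin m) :
    x.ent i j ∈ entries x := by
  simp only [entries, Set.Finite.mem_toFinset]
  exact ⟨(i, j), rfl⟩

/-- Approximate lower bound with constant `c` for amplifications. -/
def LowerBd (A : Type) [CStarAlgebra A] (m : ℕ) (c : ℝ) : Prop :=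
  ∀ (X : MM m A) (ε : ℝ), 0 < ε → ∃ (E : Finset A) (δ : ℝ), 0 < δ ∧
    ∀ (B : Type) [CStarAlgebra B] (φ : A →ₗ[ℂ] B), AppIso E δ φ → c * ‖X‖ - ε ≤ ‖MM.amp m φ X‖

lemma lowerBd_base (A : Type) [CStarAlgebra A] {m : ℕ} (hm : 1 ≤ m) :
    LowerBd A m (1 / (m : ℝ) ^ 2) := by
  intro X ε hε
  refine ⟨entries X, ε, hε, ?_⟩
  intro B _ φ h
  have hm0 : (0 : ℝ) < (m : ℝ) ^ 2 := by positivity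
  have h1 : ‖X‖ ≤ (m : ℝ) ^ 2 * (‖MM.amp m φ X‖ + ε) := by
    apply MM.norm_le_of_ent
    intro i j
    have := h.2.2 _ (mem_entries X i j)
    have h2 := MM.norm_ent_le (MM.amp m φ X) i j
    rw [MM.ent_amp] at h2
    linarith
  rw [one_div, sub_le_iff_le_add, inv_mul_le_iff₀ hm0]
  exact h1

lemma amp_mul_le_of {A B : Type} [CStarAlgebra A] [CStarAlgebra B] {m : ℕ} {φ : A →ₗ[ℂ] B}
    {x y : MM m A} {δ : ℝ}
    (h : ∀ a ∈ entries x, ∀ b ∈ entries y, ‖φ a * φ b - φ (a * b)‖ ≤ δ) :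
    ‖MM.amp m φ (x * y) - MM.amp m φ x * MM.amp m φ y‖ ≤ (m : ℝ) ^ 3 * δ := by
  apply (MM.amp_mul_le φ x y).trans
  calc _ ≤ ∑ i : Fin m, ∑ j : Fin m, ∑ k : Fin m, δ := by
        apply Finset.sum_le_sum; intro i _
        apply Finset.sum_le_sum; intro j _
        apply Finset.sum_le_sum; intro k _
        rw [norm_sub_rev]
        exact h _ (mem_entries _ _ _) _ (mem_entries _ _ _)
    _ = _ := by simp; ring

lemma LowerBd.sqrt {A : Type} [CStarAlgebra A] {m : ℕ} {c : ℝ} (hc : 0 ≤ c)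
    (h : LowerBd A m c) : LowerBd A m (√c) := by
  classical
  intro X ε hε
  obtain ⟨E, δ, hδ, hE⟩ := h (star X * X) (ε ^ 2 / 2) (by positivity)
  let δ' := min δ (ε ^ 2 / 2 / ((m : ℝ) ^ 3 + 1))
  have hδ' : 0 < δ' := lt_min hδ (by positivity)
  refine ⟨E ∪ (entries (star X) ∪ entries X), δ', hδ', ?_⟩
  intro B _ φ hφ
  have h1 := hE B φ (hφ.mono Finset.subset_union_left (min_le_left _ _))
  have h2 : ‖MM.amp m φ (star X * X) - MM.amp m φ (star X) * MM.amp m φ X‖ ≤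
      (m : ℝ) ^ 3 * δ' := by
    apply amp_mul_le_of
    intro a ha b hb
    apply hφ.2.1
    · simp [ha]
    · simp [hb]
  have h3 : (m : ℝ) ^ 3 * δ' ≤ ε ^ 2 / 2 := by
    have : δ' ≤ ε ^ 2 / 2 / ((m : ℝ) ^ 3 + 1) := min_le_right _ _
    rw [le_div_iff₀ (by positivity)] at this
    nlinarith
  rw [MM.amp_star hφ.1] at h2
  have h4 := norm_sub_norm_le (MM.amp m φ (star X * X)) (star (MM.amp m φ X) * MM.amp m φ X)
  rw [CStarRing.norm_star_mul_self] at h4 h1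
  have hs : √c * √c = c := Real.mul_self_sqrt hc
  have h5 : (√c * ‖X‖) ^ 2 - ε ^ 2 ≤ ‖MM.amp m φ X‖ ^ 2 := by
    have : (√c * ‖X‖) ^ 2 = c * (‖X‖ * ‖X‖) := by
      rw [mul_pow, Real.sq_sqrt hc]; ring
    rw [this]
    nlinarith
  by_contra hlt
  push Not at hlt
  nlinarith [norm_nonneg (MM.amp m φ X)]

lemma lowerBd_one (A : Type) [CStarAlgebra A] {m : ℕ} (hm : 1 ≤ m) : LowerBd A m 1 := by
  have hc : (0 : ℝ) < 1 / (m : ℝ) ^ 2 := by positivity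
  set c : ℝ := 1 / (m : ℝ) ^ 2
  have hk : ∀ k : ℕ, LowerBd A m (c ^ ((1 / 2 : ℝ) ^ k)) := by
    intro k
    induction k with
    | zero => rw [pow_zero, Real.rpow_one]; exact lowerBd_base A hm
    | succ k ih =>
      have := ih.sqrt (by positivity)
      rwa [Real.sqrt_eq_rpow, ← Real.rpow_mul hc.le, ← pow_succ] at this
  have ht : Tendsto (fun k : ℕ => c ^ ((1 / 2 : ℝ) ^ k)) atTop (𝓝 1) := by
    have h1 : Tendsto (fun k : ℕ => (1 / 2 : ℝ) ^ k) atTop (𝓝 0) :=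
      tendsto_pow_atTop_nhds_zero_of_lt_one (by norm_num) (by norm_num)
    have h2 : ContinuousAt (fun x : ℝ => c ^ x) 0 := Real.continuousAt_const_rpow hc.ne'
    have := h2.tendsto.comp h1
    rw [Real.rpow_zero] at this
    exact this
  intro X ε hε
  have ht2 : Tendsto (fun k : ℕ => c ^ ((1 / 2 : ℝ) ^ k) * ‖X‖) atTop (𝓝 (1 * ‖X‖)) :=
    ht.mul_const _
  obtain ⟨k, hk'⟩ := (ht2.eventually (lt_mem_nhds (show 1 * ‖X‖ - ε / 2 < 1 * ‖X‖ by linarith))).exists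
  obtain ⟨E, δ, hδ, h⟩ := hk k X (ε / 2) (by positivity)
  refine ⟨E, δ, hδ, ?_⟩
  intro B _ φ hφ
  have := h B φ hφ
  linarith

lemma lowerBd_finset {A : Type} [CStarAlgebra A] {m : ℕ} (hm : 1 ≤ m) (F : Finset (MM m A))
    (ε : ℝ) (hε : 0 < ε) : ∃ (E : Finset A) (δ : ℝ), 0 < δ ∧
      ∀ (B : Type) [CStarAlgebra B] (φ : A →ₗ[ℂ] B), AppIso E δ φ →
        ∀ X ∈ F, ‖X‖ - ε ≤ ‖MM.amp m φ X‖ := by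
  classical
  induction F using Finset.induction_on with
  | empty => exact ⟨∅, 1, one_pos, fun B _ φ _ X hX => by simp at hX⟩
  | insert X F _ ih =>
    obtain ⟨E, δ, hδ, h⟩ := ih
    obtain ⟨E', δ', hδ', h'⟩ := lowerBd_one A hm X ε hε
    refine ⟨E ∪ E', min δ δ', lt_min hδ hδ', ?_⟩
    intro B _ φ hφ Y hY
    rcases Finset.mem_insert.1 hY with rfl | hY
    · have := h' B φ (hφ.mono Finset.subset_union_right (min_le_right _ _))
      linarith
    · exact h B φ (hφ.mono Finset.subset_union_left (min_le_left _ _)) Y hY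

/-- The data in the definition of `AsympTraciallyIn`, with a general smallness condition. -/
def ATData (P : BundledCStarAlgebra → Prop) (A : Type) [CStarAlgebra A] (ε : ℝ) (F : Finset A)
    (Q : A → Prop) : Prop :=
    ∃ B : BundledCStarAlgebra, P B ∧
      ∃ (α : A →ₗ[ℂ] B.carrier) (βn : ℕ → (B.carrier →ₗ[ℂ] A)) (γn : ℕ → (A →ₗ[ℂ] A)),
        IsCPC α ∧ (∀ n, IsCPC (βn n)) ∧ (∀ n, IsCPC (γn n)) ∧
        (∀ (n : ℕ) (x : A) (b : B.carrier),
          γn n x * βn n b = 0 ∧ βn n b * γn n x = 0) ∧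
        α 1 = 1 ∧
        (∀ n : ℕ, IsIdempotentElem (βn n 1) ∧ IsSelfAdjoint (βn n 1) ∧
          IsIdempotentElem (γn n 1) ∧ IsSelfAdjoint (γn n 1) ∧
          βn n 1 + γn n 1 = 1) ∧
        (∀ x ∈ F, ∀ n : ℕ, ‖x - γn n x - βn n (α x)‖ < ε) ∧
        (∀ x ∈ F, ∀ y ∈ F, ‖α x * α y - α (x * y)‖ < ε) ∧
        (∀ x ∈ F, ‖x‖ - ε ≤ ‖α x‖) ∧
        (∀ x y : B.carrier,
          Filter.Tendsto (fun n => ‖βn n (x * y) - βn n x * βn n y‖) Filter.atTop (nhds 0) ∧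
          Filter.Tendsto (fun n => ‖βn n x‖) Filter.atTop (nhds ‖x‖)) ∧
        (∀ n : ℕ, Q (γn n 1))

lemma asympTraciallyIn_iff (P : BundledCStarAlgebra → Prop) (A : Type) [CStarAlgebra A] :
    AsympTraciallyIn P A ↔ ∀ (ε : ℝ), 0 < ε → ∀ (F : Finset A) (c : A),
      (∃ d : A, c = star d * d) → c ≠ 0 → ATData P A ε F (fun g => CuntzLE g c) := Iff.rfl

/-- Passing to a tail, the complementary projections are never the unit, and they almost
commute with the given finite set. -/
lemma ATData.tail {P : BundledCStarAlgebra → Prop} {A : Type} [CStarAlgebra A] [Nontrivial A]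
    {ε : ℝ} {F : Finset A} {Q : A → Prop} (h : ATData P A ε F Q) (h1 : (1 : A) ∈ F) (hε : ε < 1) :
    ATData P A ε F (fun g => Q g ∧ IsIdempotentElem g ∧ IsSelfAdjoint g ∧ g ≠ 1 ∧
      ∀ x ∈ F, ‖g * x - x * g‖ ≤ 2 * ε) := by
  obtain ⟨B, hB, α, β, γ, hα, hβ, hγ, hort, hα1, hproj, h2, h3, h3', h4, h5⟩ := h
  have hpos : 0 < ‖(1 : B.carrier)‖ := by
    have := h3' 1 h1
    rw [hα1, CStarRing.norm_one] at this
    linarith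
  obtain ⟨N, hN⟩ := eventually_atTop.1 ((h4 1 1).2.eventually (lt_mem_nhds hpos))
  refine ⟨B, hB, α, fun n => β (n + N), fun n => γ (n + N), hα, fun n => hβ _, fun n => hγ _,
    fun n => hort _, hα1, fun n => hproj _, fun x hx n => h2 x hx _, h3, h3',
    fun x y => ⟨(h4 x y).1.comp (tendsto_add_atTop_nat N), (h4 x y).2.comp (tendsto_add_atTop_nat N)⟩,
    fun n => ⟨h5 _, (hproj _).2.2.1, (hproj _).2.2.2.1, ?_, ?_⟩⟩
  · intro h
    have h6 := (hproj (n + N)).2.2.2.2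
    rw [h] at h6
    have h7 : β (n + N) 1 = 0 := by simpa using h6
    have h8 := hN (n + N) (by omega)
    rw [h7, norm_zero] at h8
    exact lt_irrefl _ h8
  · intro x hx
    set k := n + N
    obtain ⟨p1, p2, p3, p4, p5⟩ := hproj k
    set g := γ k 1
    have hg : ∀ y, g * y = y - β k 1 * y := fun y => by
      have : g = 1 - β k 1 := by rw [← p5]; simp [g]
      rw [this, sub_mul, one_mul]
    have hg' : ∀ y, y * g = y - y * β k 1 := fun y => by
      have : g = 1 - β k 1 := by rw [← p5]; simp [g]
      rw [this, mul_sub, mul_one]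
    have e1 : g * γ k x = γ k x := by rw [hg, (hort k x 1).2, sub_zero]
    have e2 : γ k x * g = γ k x := by rw [hg', (hort k x 1).1, sub_zero]
    have e3 : g * β k (α x) = 0 := (hort k 1 (α x)).1
    have e4 : β k (α x) * g = 0 := (hort k 1 (α x)).2
    have e5 : g * x - x * g = g * (x - γ k x - β k (α x)) - (x - γ k x - β k (α x)) * g := by
      simp only [mul_sub, sub_mul, e1, e2, e3, e4]; abel
    have hgn := norm_proj_le p3 p4
    have hd := (h2 x hx k).le
    rw [e5]
    apply (norm_sub_le _ _).trans
    have i1 := norm_mul_le g (x - γ k x - β k (α x))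
    have i2 := norm_mul_le (x - γ k x - β k (α x)) g
    nlinarith [norm_nonneg (x - γ k x - β k (α x)), norm_nonneg g]

lemma ATData.mono {P : BundledCStarAlgebra → Prop} {A : Type} [CStarAlgebra A]
    {ε ε' : ℝ} {F F' : Finset A} {Q Q' : A → Prop} (h : ATData P A ε F Q) (hε : ε ≤ ε')
    (hF : F' ⊆ F) (hQ : ∀ g, Q g → Q' g) : ATData P A ε' F' Q' := by
  obtain ⟨B, hB, α, β, γ, hα, hβ, hγ, hort, hα1, hproj, h2, h3, h3', h4, h5⟩ := h
  exact ⟨B, hB, α, β, γ, hα, hβ, hγ, hort, hα1, hproj,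
    fun x hx n => (h2 x (hF hx) n).trans_le hε,
    fun x hx y hy => (h3 x (hF hx) y (hF hy)).trans_le hε,
    fun x hx => by have := h3' x (hF hx); linarith, h4, fun n => hQ _ (h5 n)⟩

lemma cuntzLE_zero {A : Type} [CStarAlgebra A] (c : A) : CuntzLE 0 c :=
  ⟨fun _ => 0, by simp⟩

/-- Data for which the diagonal is small in matrices. -/
lemma ata_diag {P : BundledCStarAlgebra → Prop} {A : Type} [CStarAlgebra A] (hA : AlgSimple A)
    (hT : AsympTraciallyIn P A) {m : ℕ} (D : MM m A) (hD : D ≠ 0) (ε : ℝ) (hε : 0 < ε)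
    (F : Finset A) : ATData P A ε F (fun g => CuntzLE (MM.dg g : MM m A) (star D * D)) := by
  classical
  by_cases hmin : HasMinProj A
  · obtain ⟨E, δ, hδ, hE⟩ := hmin.trivial_projections hA
    have hnt : Nontrivial A := by
      obtain ⟨e, he, -⟩ := hmin
      exact ⟨e, 0, he⟩
    let ε' := min ε (min (1 / 2) (δ / 2))
    have h := ((asympTraciallyIn_iff P A).1 hT ε' (by positivity) (insert 1 (E ∪ F)) 1 ⟨1, by simp⟩ one_ne_zero)
    have h2 := h.tail (by simp)
      (((min_le_right _ _).trans (min_le_left _ _)).trans_lt (by norm_num))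
    apply h2.mono (min_le_left _ _)
    · intro x hx; simp [hx]
    rintro g ⟨-, hg1, hg2, hg3, hg4⟩
    have : g = 0 := by
      refine (hE g hg1 hg2 fun x hx => ?_).resolve_right hg3
      apply (hg4 x (by simp [hx])).trans
      have : ε' ≤ δ / 2 := (min_le_right _ _).trans (min_le_right _ _)
      linarith
    rw [this, MM.dg_zero]
    exact cuntzLE_zero _
  · obtain ⟨d, hd, V, hV⟩ := exists_diag_below hA hmin (MM.toMat D) (by
      intro h0; apply hD; exact MM.toMat.injective (h0.trans (map_zero _).symm))
    apply ATData.mono ((asympTraciallyIn_iff P A).1 hT ε hε F (star d * d) ⟨d, rfl⟩ hd) le_rfl (Finset.Subset.refl _)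
    rintro g ⟨v, hv⟩
    let W : MM m A := MM.toMat.symm V
    have hW : star W * (star D * D) * W = MM.dg (star d * d) := by
      apply MM.toMat.injective
      exact hV
    refine ⟨fun k => MM.dg (v k) * star W, ?_⟩
    have : ∀ k, MM.dg (v k) * star W * (star D * D) * star (MM.dg (v k) * star W) =
        MM.dg (v k * (star d * d) * star (v k)) := by
      intro k
      rw [← MM.dg_mul, ← MM.dg_mul, ← hW, star_mul, star_star, MM.dg_star]
      simp only [mul_assoc]
    simp only [this]
    rw [tendsto_iff_norm_sub_tendsto_zero] at hv ⊢
    refine squeeze_zero (fun _ => norm_nonneg _) (g := fun k => (m : ℝ) ^ 2 *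
      ‖v k * (star d * d) * star (v k) - g‖) (fun k => ?_) (by simpa using hv.const_mul ((m : ℝ) ^ 2))
    apply MM.norm_le_of_ent
    intro i j
    simp only [MM.ent_sub, MM.dg, MM.ent_mk]
    split_ifs <;> simp

theorem ata_matrix {P : BundledCStarAlgebra → Prop}
    (hPmat : ∀ B : BundledCStarAlgebra, P B → ∀ m : ℕ, 1 ≤ m →
      ∀ C : BundledCStarAlgebra,
        Nonempty (C.carrier ≃⋆ₐ[ℂ] Matrix (Fin m) (Fin m) B.carrier) → P C)
    {A : Type} [CStarAlgebra A] (hA : AlgSimple A) (hT : AsympTraciallyIn P A) {m : ℕ}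
    (hm : 1 ≤ m) : AsympTraciallyIn P (MM m A) := by
  classical
  rintro ε hε F c ⟨D, rfl⟩ hc
  have hD : D ≠ 0 := by rintro rfl; simp at hc
  obtain ⟨E, δ, hδ, hE⟩ := lowerBd_finset hm F ε hε
  let E1 : Finset A := F.biUnion entries
  let ε' := min δ (ε / 2 / ((m : ℝ) ^ 3))
  have hm0 : (0 : ℝ) < m := by exact_mod_cast hm
  have hm1 : (1 : ℝ) ≤ m := by exact_mod_cast hm
  have hε' : 0 < ε' := lt_min hδ (by positivity)
  have hb3 : (m : ℝ) ^ 3 * ε' < ε := by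
    have : ε' ≤ ε / 2 / ((m : ℝ) ^ 3) := min_le_right _ _
    rw [le_div_iff₀ (by positivity)] at this
    linarith
  have hb2 : (m : ℝ) ^ 2 * ε' < ε := by
    have : (m : ℝ) ^ 2 ≤ (m : ℝ) ^ 3 := pow_le_pow_right₀ hm1 (by norm_num)
    nlinarith
  have hmem : ∀ x ∈ F, ∀ a ∈ entries x, a ∈ E ∪ E1 := by
    intro x hx a ha
    exact Finset.mem_union_right _ (Finset.mem_biUnion.2 ⟨x, hx, ha⟩)
  obtain ⟨B, hB, α, β, γ, hα, hβ, hγ, hort, hα1, hproj, h2, h3, h3', h4, h5⟩ :=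
    ata_diag hA hT D hD ε' hε' (E ∪ E1)
  have dgproj : ∀ {X : Type} [CStarAlgebra X] {q : X}, IsIdempotentElem q →
      IsIdempotentElem (MM.dg q : MM m X) := by
    intro X _ q hq; unfold IsIdempotentElem; rw [MM.dg_mul, hq.eq]
  have dgsa : ∀ {X : Type} [CStarAlgebra X] {q : X}, IsSelfAdjoint q →
      IsSelfAdjoint (MM.dg q : MM m X) := by
    intro X _ q hq; unfold IsSelfAdjoint; rw [MM.dg_star, hq.star_eq]
  refine ⟨⟨MM m B.carrier⟩, hPmat B hB m hm _ ⟨MM.toMat⟩, MM.amp m α, fun n => MM.amp m (β n),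
    fun n => MM.amp m (γ n), ?_, ?_, ?_, ?_, ?_, ?_, ?_, ?_, ?_, ?_, ?_⟩
  · exact MM.amp_cpc hα (by rw [hα1]; exact IsIdempotentElem.one) (by rw [hα1]; exact .one _)
  · exact fun n => MM.amp_cpc (hβ n) (hproj n).1 (hproj n).2.1
  · exact fun n => MM.amp_cpc (hγ n) (hproj n).2.2.1 (hproj n).2.2.2.1
  · intro n x b
    constructor
    · apply MM.ext; intro i j
      simp only [MM.ent_mul, MM.ent_amp, MM.ent_zero]
      exact Finset.sum_eq_zero fun k _ => (hort n _ _).1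
    · apply MM.ext; intro i j
      simp only [MM.ent_mul, MM.ent_amp, MM.ent_zero]
      exact Finset.sum_eq_zero fun k _ => (hort n _ _).2
  · rw [MM.amp_one, hα1, MM.dg_one]
  · intro n
    obtain ⟨p1, p2, p3, p4, p5⟩ := hproj n
    simp only [MM.amp_one]
    exact ⟨dgproj p1, dgsa p2, dgproj p3, dgsa p4, by rw [MM.dg_add, p5, MM.dg_one]⟩
  · intro x hx n
    refine lt_of_le_of_lt ?_ hb2
    apply MM.norm_le_of_ent
    intro i j
    simp only [MM.ent_sub, MM.ent_amp]
    exact (h2 _ (hmem x hx _ (mem_entries x i j)) n).le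
  · intro x hx y hy
    rw [norm_sub_rev]
    refine lt_of_le_of_lt ?_ hb3
    apply amp_mul_le_of
    intro a ha b hb
    exact (h3 _ (hmem x hx a ha) _ (hmem y hy b hb)).le
  · apply hE B.carrier α
    refine ⟨hα.pos, fun x hx y hy => ?_, fun x hx => ?_⟩
    · exact ((h3 x (Finset.mem_union_left _ hx) y (Finset.mem_union_left _ hy)).le).trans
        (min_le_left _ _)
    · have := h3' x (Finset.mem_union_left _ hx)
      have h6 : ε' ≤ δ := min_le_left _ _
      linarith
  · intro (x : MM m B.carrier) (y : MM m B.carrier)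
    constructor
    · refine squeeze_zero (fun _ => norm_nonneg _) (fun n => MM.amp_mul_le (β n) x y) ?_
      rw [show (0 : ℝ) = ∑ i : Fin m, ∑ j : Fin m, ∑ k : Fin m, 0 by simp]
      refine tendsto_finsetSum _ fun i _ => tendsto_finsetSum _ fun j _ =>
        tendsto_finsetSum _ fun k _ => (h4 _ _).1
    · have hlow : ∀ η > 0, ∀ᶠ n in atTop, ‖x‖ - η ≤ ‖MM.amp m (β n) x‖ := by
        intro η hη
        obtain ⟨E', δ', hδ', hE'⟩ := lowerBd_one B.carrier hm x η hη
        have ev1 : ∀ᶠ n in atTop, ∀ p ∈ E' ×ˢ E', ‖β n p.1 * β n p.2 - β n (p.1 * p.2)‖ ≤ δ' := by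
          rw [Finset.eventually_all]
          intro p _
          filter_upwards [(h4 p.1 p.2).1.eventually (gt_mem_nhds hδ')] with n hn
          rw [norm_sub_rev]; exact hn.le
        have ev2 : ∀ᶠ n in atTop, ∀ p ∈ E', ‖p‖ - δ' ≤ ‖β n p‖ := by
          rw [Finset.eventually_all]
          intro p _
          filter_upwards [(h4 p p).2.eventually
            (lt_mem_nhds (show ‖p‖ - δ' < ‖p‖ by linarith))] with n hn
          exact hn.le
        filter_upwards [ev1, ev2] with n h1 h2
        have := hE' A (β n) ⟨(hβ n).pos, fun x hx y hy => h1 (x, y) (Finset.mk_mem_product hx hy), h2⟩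
        linarith
      rw [Metric.tendsto_atTop']
      intro η hη
      obtain ⟨N, hN⟩ := eventually_atTop.1 (hlow (η / 2) (by positivity))
      refine ⟨N, fun n hn => ?_⟩
      have h1 := hN n hn.le
      have h2 : ‖MM.amp m (β n) x‖ ≤ ‖x‖ :=
        (MM.amp_cpc (m := m) (hβ n) (hproj n).1 (hproj n).2.1).1 x
      have key : dist ‖MM.amp m (β n) x‖ ‖x‖ < η := by
        rw [Real.dist_eq, abs_lt]
        constructor <;> linarith
      exact key
  · intro n
    simp only [MM.amp_one]
    exact h5 n

lemma asy_key {A : Type} [CStarAlgebra A] {a v : A} (ha1 : ‖a‖ ≤ 1) (hv2 : ‖v‖ ≤ 2)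
    (hv : (v * a * v) * v = v) (hd : ‖a - a * v * v * a‖ ≤ 1 / 2) :
    ‖a - a * v * v * a‖ ≤ 50 * ‖a * a - a‖ := by
  set η := ‖a * a - a‖ with hη
  set d := a - a * v * v * a with hdd
  have hη0 : 0 ≤ η := norm_nonneg _
  have e : d * d - d = (a * a - a) - (a * a - a) * v * v * a - a * v * v * (a * a - a)
      + a * v * v * (a * a - a) * v * v * a := by
    have h1 : a * v * v * a * v * v * a = a * v * v * a := by
      calc a * v * v * a * v * v * a = a * v * ((v * a * v) * v) * a := by noncomm_ring
        _ = _ := by rw [hv]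
    have h2 : d * d - d - ((a * a - a) - (a * a - a) * v * v * a - a * v * v * (a * a - a)
      + a * v * v * (a * a - a) * v * v * a) = a * v * v * a * v * v * a - a * v * v * a := by
      rw [hdd]; noncomm_ring
    rw [h1, sub_self] at h2
    exact sub_eq_zero.1 h2
  have n1 : ‖(a * a - a) * v * v * a‖ ≤ η * 2 * 2 * 1 :=
    norm_mul_le_of_le (norm_mul_le_of_le (norm_mul_le_of_le le_rfl hv2) hv2) ha1
  have n0 : ‖a * v * v * (a * a - a)‖ ≤ 1 * 2 * 2 * η :=
    norm_mul_le_of_le (norm_mul_le_of_le (norm_mul_le_of_le ha1 hv2) hv2) le_rfl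
  have n2 : ‖a * v * v * (a * a - a) * v * v * a‖ ≤ 1 * 2 * 2 * η * 2 * 2 * 1 :=
    norm_mul_le_of_le (norm_mul_le_of_le (norm_mul_le_of_le n0 hv2) hv2) ha1
  have n3 : ‖d * d - d‖ ≤ ((η + η * 2 * 2 * 1) + 1 * 2 * 2 * η) + 1 * 2 * 2 * η * 2 * 2 * 1 := by
    rw [e]
    exact norm_add_le_of_le (norm_sub_le_of_le (norm_sub_le_of_le le_rfl n1) n0) n2
  have n4 : ‖d‖ ≤ ‖d‖ * ‖d‖ + ‖d * d - d‖ := by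
    calc ‖d‖ = ‖d * d - (d * d - d)‖ := by congr 1; abel
      _ ≤ _ := norm_sub_le_of_le (norm_mul_le _ _) le_rfl
  nlinarith [norm_nonneg d]

lemma asy_mul {A : Type} [CStarAlgebra A] {a v X Y Z : A} {η e1 e2 e3 cx cy : ℝ}
    (ha1 : ‖a‖ ≤ 1) (hv2 : ‖v‖ ≤ 2) (hd : ‖a - a * v * v * a‖ ≤ η)
    (h1 : ‖X - X * a‖ ≤ e1) (h2 : ‖Y - a * Y‖ ≤ e2) (h3 : ‖Z - X * Y‖ ≤ e3)
    (hX : ‖X‖ ≤ cx) (hY : ‖Y‖ ≤ cy) :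
    ‖v * Z * v - (v * X * v) * (v * Y * v)‖ ≤
      4 * (e3 + e1 * cy + cx * η * cy + cx * 4 * e2 + e1 * 4 * cy) := by
  have e : v * Z * v - (v * X * v) * (v * Y * v) = v * ((Z - X * Y) + (X - X * a) * Y
      + X * (a - a * v * v * a) * Y - X * (a * (v * v)) * (Y - a * Y)
      - (X - X * a) * (v * v) * Y) * v := by noncomm_ring
  rw [e]
  have hvv : ‖v * v‖ ≤ 4 := (norm_mul_le_of_le hv2 hv2).trans (by norm_num)
  have havv : ‖a * (v * v)‖ ≤ 4 := (norm_mul_le_of_le ha1 hvv).trans (by norm_num)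
  refine (norm_mul_le_of_le (norm_mul_le_of_le hv2 (norm_sub_le_of_le (norm_sub_le_of_le
    (norm_add_le_of_le (norm_add_le_of_le h3 (norm_mul_le_of_le h1 hY))
      (norm_mul_le_of_le (norm_mul_le_of_le hX hd) hY))
      (norm_mul_le_of_le (norm_mul_le_of_le hX havv) h2))
      (norm_mul_le_of_le (norm_mul_le_of_le h1 hvv) hY))) hv2).trans (le_of_eq (by ring))

lemma asy_norm {A : Type} [CStarAlgebra A] {a v X : A} {η e1 e2 cx : ℝ}
    (ha : IsSelfAdjoint a) (hvs : IsSelfAdjoint v)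
    (ha1 : ‖a‖ ≤ 1) (hv2 : ‖v‖ ≤ 2) (hd : ‖a - a * v * v * a‖ ≤ η)
    (h1 : ‖X - X * a‖ ≤ e1) (h2 : ‖X - a * X‖ ≤ e2)
    (hX : ‖X‖ ≤ cx) (hvX : ‖v * X * v‖ ≤ cx) :
    ‖X‖ - (η * (cx + 4 * (e1 + e2)) + 5 * (e1 + e2) + 5 * η * cx) ≤ ‖v * X * v‖ := by
  have e : X = (X - a * X) + a * (X - X * a) + (a - a * v * v * a) * X * a
      + a * (v * v) * a * X * (a - a * v * v * a)
      + (a * v) * (v * X * v - v * (X - a * X) * v - v * (a * (X - X * a)) * v) * (v * a) := by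
    noncomm_ring
  have hvv : ‖v * v‖ ≤ 4 := (norm_mul_le_of_le hv2 hv2).trans (by norm_num)
  have m1 : ‖a * (v * v) * a‖ ≤ 4 :=
    (norm_mul_le_of_le (norm_mul_le_of_le ha1 hvv) ha1).trans (by norm_num)
  have hs : ‖a * v‖ = ‖v * a‖ := by
    rw [← norm_star (a * v), star_mul, ha.star_eq, hvs.star_eq]
  have hva : ‖v * a‖ * ‖v * a‖ ≤ 1 + η := by
    rw [← CStarRing.norm_star_mul_self (x := v * a), star_mul, ha.star_eq, hvs.star_eq]
    calc ‖a * v * (v * a)‖ = ‖a - (a - a * v * v * a)‖ := by congr 1; noncomm_ring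
      _ ≤ _ := norm_sub_le_of_le ha1 hd
  set T := v * X * v - v * (X - a * X) * v - v * (a * (X - X * a)) * v with hT
  have nT : ‖T‖ ≤ ‖v * X * v‖ + 2 * e2 * 2 + 2 * (1 * e1) * 2 :=
    norm_sub_le_of_le (norm_sub_le_of_le le_rfl (norm_mul_le_of_le (norm_mul_le_of_le hv2 h2) hv2))
      (norm_mul_le_of_le (norm_mul_le_of_le hv2 (norm_mul_le_of_le ha1 h1)) hv2)
  have n5 : ‖(a * v) * T * (v * a)‖ ≤ (1 + η) * ‖T‖ := by
    calc _ ≤ ‖a * v‖ * ‖T‖ * ‖v * a‖ := norm_mul_le_of_le (norm_mul_le _ _) le_rfl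
      _ = (‖v * a‖ * ‖v * a‖) * ‖T‖ := by rw [hs]; ring
      _ ≤ _ := mul_le_mul_of_nonneg_right hva (norm_nonneg _)
  have n : ‖X‖ ≤ e2 + 1 * e1 + η * cx * 1 + 4 * cx * η + (1 + η) * ‖T‖ := by
    nth_rewrite 1 [e]
    exact norm_add_le_of_le (norm_add_le_of_le (norm_add_le_of_le (norm_add_le_of_le h2
      (norm_mul_le_of_le ha1 h1)) (norm_mul_le_of_le (norm_mul_le_of_le hd hX) ha1))
      (norm_mul_le_of_le (norm_mul_le_of_le m1 hX) hd)) n5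
  have hη0 : 0 ≤ η := (norm_nonneg _).trans hd
  have : (1 + η) * ‖T‖ ≤ ‖v * X * v‖ + 4 * (e1 + e2) + η * (cx + 4 * (e1 + e2)) := by
    have hT2 : ‖T‖ ≤ cx + 4 * (e1 + e2) := by linarith
    have := mul_le_mul_of_nonneg_left hT2 hη0
    linarith
  linarith

lemma exists_sa_sqrt {A : Type} [CStarAlgebra A] (N : A) :
    ∃ R : A, IsSelfAdjoint R ∧ R * R = star N * N := by
  let _ := CStarAlgebra.spectralOrder A
  let _ := CStarAlgebra.spectralOrderedRing A
  exact ⟨CFC.sqrt (star N * N), IsSelfAdjoint.of_nonneg (CFC.sqrt_nonneg _),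
    CFC.sqrt_mul_sqrt_self _ (star_mul_self_nonneg _)⟩

/-- `ι` identifies the C*-algebra `C` with the corner `pAp`. -/
structure CorEmb {C A : Type} [CStarAlgebra C] [CStarAlgebra A] (p : A) (ι : C →ₗ[ℂ] A) : Prop where
  idem : IsIdempotentElem p
  sa : IsSelfAdjoint p
  map_mul : ∀ x y, ι (x * y) = ι x * ι y
  map_star : ∀ x, ι (star x) = star (ι x)
  inj : Function.Injective ι
  mem : ∀ c, p * ι c * p = ι c
  surj : ∀ x, p * x * p = x → ∃ c, ι c = x

namespace CorEmb
variable {C A : Type} [CStarAlgebra C] [CStarAlgebra A] {p : A} {ι : C →ₗ[ℂ] A}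

lemma mulL (h : CorEmb p ι) (c : C) : p * ι c = ι c := by
  rw [← h.mem c, ← mul_assoc, ← mul_assoc, h.idem.eq]

lemma mulR (h : CorEmb p ι) (c : C) : ι c * p = ι c := by
  rw [← h.mem c, mul_assoc, h.idem.eq]

lemma map_one (h : CorEmb p ι) : ι 1 = p := by
  obtain ⟨c, hc⟩ := h.surj p (by rw [h.idem.eq, h.idem.eq])
  have := h.map_mul c 1
  rw [mul_one, hc, h.mulL] at this
  exact this.symm

/-- As a star homomorphism. -/
noncomputable def hom (h : CorEmb p ι) : C →⋆ₙₐ[ℂ] A where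
  toFun := ι
  map_smul' := ι.map_smul
  map_zero' := ι.map_zero
  map_add' := ι.map_add
  map_mul' := h.map_mul
  map_star' := h.map_star

lemma norm_map (h : CorEmb p ι) (c : C) : ‖ι c‖ = ‖c‖ :=
  NonUnitalStarAlgHom.norm_map h.hom h.inj c

lemma pos (h : CorEmb p ι) : MatPosPres ι := matPosPres_of_hom ι h.map_mul h.map_star

lemma exists_compr (h : CorEmb p ι) (x : A) : ∃ c, ι c = p * x * p :=
  h.surj _ (by
    calc p * (p * x * p) * p = (p * p) * x * (p * p) := by noncomm_ring
      _ = _ := by rw [h.idem.eq])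

/-- Compression to the corner. -/
noncomputable def compr (h : CorEmb p ι) : A →ₗ[ℂ] C where
  toFun x := (h.exists_compr x).choose
  map_add' x y := by
    apply h.inj
    rw [_root_.map_add, (h.exists_compr x).choose_spec, (h.exists_compr y).choose_spec,
      (h.exists_compr (x + y)).choose_spec, mul_add, add_mul]
  map_smul' c x := by
    apply h.inj
    rw [_root_.map_smul, (h.exists_compr x).choose_spec, (h.exists_compr (c • x)).choose_spec,
      mul_smul_comm, smul_mul_assoc, RingHom.id_apply]

lemma compr_spec (h : CorEmb p ι) (x : A) : ι (h.compr x) = p * x * p :=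
  (h.exists_compr x).choose_spec

lemma compr_pos (h : CorEmb p ι) : MatPosPres h.compr := by
  rintro n _ ⟨c, rfl⟩
  let N : MM n A := MM.mk fun i j => c i j
  let Pd : MM n A := MM.dg p
  have hPd : IsIdempotentElem Pd := by
    change Pd * Pd = Pd
    rw [MM.dg_mul, h.idem.eq]
  have hPs : IsSelfAdjoint Pd := by
    change star Pd = Pd
    rw [MM.dg_star, h.sa.star_eq]
  let X : MM n A := star (N * Pd) * (N * Pd)
  obtain ⟨R, hRs, hR⟩ : ∃ R : MM n A, IsSelfAdjoint R ∧ R * R = X := exists_sa_sqrt _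
  have hRP : R * Pd = R := by
    have h1 : R - R * Pd = 0 := by
      rw [← CStarRing.star_mul_self_eq_zero_iff]
      have h2 : star (R - R * Pd) * (R - R * Pd) = X - X * Pd - (Pd * X - Pd * X * Pd) := by
        rw [star_sub, star_mul, hRs.star_eq, hPs.star_eq, ← hR]; noncomm_ring
      have h3 : X * Pd = X := by
        simp only [X]; rw [mul_assoc, mul_assoc, hPd.eq]
      rw [h2, h3, mul_assoc, h3]; abel
    exact (sub_eq_zero.1 h1).symm
  have hPR : Pd * R = R := by
    have := congrArg star hRP
    rwa [star_mul, hRs.star_eq, hPs.star_eq] at this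
  have hent : ∀ i j, ∃ c, ι c = R.ent i j := by
    intro i j
    apply h.surj
    have h1 : (Pd * R * Pd).ent i j = R.ent i j := by rw [hPR, hRP]
    rw [← h1]
    simp only [MM.ent_mul, Pd, MM.dg, MM.ent_mk]
    simp only [ite_mul, zero_mul, mul_ite, mul_zero, Finset.sum_ite_eq, Finset.sum_ite_eq',
      Finset.mem_univ, if_true]
    calc p * (p * R.ent i j * p) * p = (p * p) * R.ent i j * (p * p) := by noncomm_ring
      _ = _ := by rw [h.idem.eq]
  choose r hr using hent
  refine ⟨Matrix.of r, ?_⟩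
  ext i j
  apply h.inj
  rw [Matrix.map_apply, h.compr_spec]
  have h0 : ι (((Matrix.of r)ᴴ * Matrix.of r) i j) = ∑ k, star (R.ent k i) * R.ent k j := by
    rw [Matrix.mul_apply, _root_.map_sum]
    simp only [Matrix.conjTranspose_apply, Matrix.of_apply, h.map_mul, h.map_star, hr]
  rw [h0]
  have h1 : (star R * R).ent i j = X.ent i j := by rw [hRs.star_eq, hR]
  rw [MM.ent_mul] at h1
  simp only [MM.ent_star] at h1
  refine Eq.trans ?_ h1.symm
  have h2 : X = Pd * (star N * N) * Pd := by
    simp only [X]; rw [star_mul, hPs.star_eq]; noncomm_ring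
  rw [h2]
  simp only [MM.ent_mul, Pd, MM.dg, MM.ent_mk]
  simp only [ite_mul, zero_mul, mul_ite, mul_zero, Finset.sum_ite_eq, Finset.sum_ite_eq',
      Finset.mem_univ, if_true]
  rfl

lemma algSimple (h : CorEmb p ι) (hA : AlgSimple A) : AlgSimple C := by
  intro e he
  obtain ⟨n, x, y, hxy⟩ := hA (ι e) (fun h0 => he (h.inj (by rw [h0, _root_.map_zero])))
  refine ⟨n, fun i => h.compr (x i), fun i => h.compr (y i), ?_⟩
  apply h.inj
  rw [_root_.map_sum, h.map_one]
  simp only [h.map_mul, h.compr_spec]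
  calc ∑ i, p * x i * p * ι e * (p * y i * p) = p * (∑ i, x i * ι e * y i) * p := by
        rw [Finset.mul_sum, Finset.sum_mul]
        refine Finset.sum_congr rfl fun i _ => ?_
        calc p * x i * p * ι e * (p * y i * p) = p * x i * (p * ι e * p) * y i * p := by
              noncomm_ring
          _ = _ := by rw [h.mem]; noncomm_ring
    _ = p := by rw [hxy, mul_one, h.idem.eq]

end CorEmb

/-- The corner as a type. -/
def Cor {A : Type} [CStarAlgebra A] (p : A) (hp : IsIdempotentElem p) (hps : IsSelfAdjoint p) :
    Type := cstarCorner p hp hps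

lemma cstarCorner_closed {A : Type} [CStarAlgebra A] (p : A) (hp : IsIdempotentElem p)
    (hps : IsSelfAdjoint p) : IsClosed ((cstarCorner p hp hps : NonUnitalStarSubalgebra ℂ A) : Set A) :=
  isClosed_eq (by fun_prop) continuous_id

section
variable {A : Type} [CStarAlgebra A] (p : A) (hp : IsIdempotentElem p) (hps : IsSelfAdjoint p)

noncomputable instance Cor.instNU : NonUnitalNormedRing (Cor p hp hps) :=
  inferInstanceAs (NonUnitalNormedRing (cstarCorner p hp hps))

noncomputable instance Cor.instNR : NormedRing (Cor p hp hps) :=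
  { Cor.instNU p hp hps with
    one := ⟨p, by change p * p * p = p; rw [hp.eq, hp.eq]⟩
    one_mul := fun x => Subtype.ext (by
      have hx : p * (x.1 : A) * p = x.1 := x.2
      change p * x.1 = x.1
      rw [← hx, ← mul_assoc, ← mul_assoc, hp.eq])
    mul_one := fun x => Subtype.ext (by
      have hx : p * (x.1 : A) * p = x.1 := x.2
      change x.1 * p = x.1
      rw [← hx, mul_assoc, hp.eq]) }

noncomputable instance Cor.instSR : StarRing (Cor p hp hps) :=
  { star := fun x => (star (x : cstarCorner p hp hps) : cstarCorner p hp hps)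
    star_involutive := fun x => Subtype.ext (star_star x.1)
    star_mul := fun x y => Subtype.ext (star_mul x.1 y.1)
    star_add := fun x y => Subtype.ext (star_add x.1 y.1) }

noncomputable instance Cor.instMod : Module ℂ (Cor p hp hps) :=
  inferInstanceAs (Module ℂ (cstarCorner p hp hps))

noncomputable instance Cor.instAlg : Algebra ℂ (Cor p hp hps) := Algebra.ofModule
    (fun r x y => Subtype.ext (smul_mul_assoc r x.1 y.1))
    (fun r x y => Subtype.ext (mul_smul_comm r x.1 y.1))

noncomputable instance Cor.instCStar : CStarAlgebra (Cor p hp hps) :=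
  { Cor.instNR p hp hps, Cor.instSR p hp hps, Cor.instAlg p hp hps with
    complete := ((cstarCorner_closed p hp hps).completeSpace_coe).complete
    norm_mul_self_le := fun x => (CStarRing.norm_star_mul_self (x := x.1)).symm.le
    norm_smul_le := fun r x => norm_smul_le r x.1
    star_smul := fun r x => Subtype.ext (star_smul r x.1) }

end

/-- The inclusion of a corner. -/
noncomputable def Cor.incl {A : Type} [CStarAlgebra A] (p : A) (hp : IsIdempotentElem p) (hps : IsSelfAdjoint p) :
    Cor p hp hps →ₗ[ℂ] A where
  toFun x := x.1
  map_add' _ _ := rfl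
  map_smul' _ _ := rfl

lemma Cor.corEmb {A : Type} [CStarAlgebra A] (p : A) (hp : IsIdempotentElem p)
    (hps : IsSelfAdjoint p) : CorEmb p (Cor.incl p hp hps) where
  idem := hp
  sa := hps
  map_mul _ _ := rfl
  map_star _ := rfl
  inj _ _ h := Subtype.ext h
  mem c := c.2
  surj x hx := ⟨⟨x, hx⟩, rfl⟩

/-- The identification with the frozen corner. -/
noncomputable def Cor.equiv {A : Type} [CStarAlgebra A] (p : A) (hp : IsIdempotentElem p)
    (hps : IsSelfAdjoint p) : Cor p hp hps ≃⋆ₐ[ℂ] cstarCorner p hp hps where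
  toFun x := x
  invFun x := x
  left_inv _ := rfl
  right_inv _ := rfl
  map_mul' _ _ := rfl
  map_add' _ _ := rfl
  map_smul' _ _ := rfl
  map_star' _ := rfl

/-- Algebras isomorphic to a corner. -/
lemma corEmb_of_equiv {C A : Type} [CStarAlgebra C] [CStarAlgebra A] (p : A)
    (hp : IsIdempotentElem p) (hps : IsSelfAdjoint p) (e : C ≃⋆ₐ[ℂ] cstarCorner p hp hps) :
    ∃ ι : C →ₗ[ℂ] A, CorEmb p ι := by
  refine ⟨⟨⟨fun c => (e c : A), fun x y => ?_⟩, fun r x => ?_⟩, ⟨hp, hps, fun x y => ?_, fun x => ?_,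
    fun x y h => ?_, fun c => (e c).2, fun x hx => ⟨e.symm ⟨x, hx⟩, ?_⟩⟩⟩
  · rw [map_add]; rfl
  · change ((e (r • x) : cstarCorner p hp hps) : A) = _
    rw [map_smul]; rfl
  · change ((e (x * y) : cstarCorner p hp hps) : A) = _
    rw [map_mul]; rfl
  · change ((e (star x) : cstarCorner p hp hps) : A) = _
    rw [map_star]; rfl
  · exact e.injective (Subtype.ext h)
  · change ((e (e.symm ⟨x, hx⟩) : cstarCorner p hp hps) : A) = _
    rw [StarAlgEquiv.apply_symm_apply]

lemma corEmb_of_mat {C A : Type} [CStarAlgebra C] [CStarAlgebra A] {m : ℕ}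
    (e : C ≃⋆ₐ[ℂ] Matrix (Fin m) (Fin m) A) :
    ∃ ι : C →ₗ[ℂ] MM m A, CorEmb 1 ι := by
  let f : C ≃⋆ₐ[ℂ] MM m A := e.trans MM.toMat.symm
  refine ⟨⟨⟨fun c => f c, fun x y => map_add f x y⟩, fun r x => map_smul f r x⟩,
    ⟨IsIdempotentElem.one, IsSelfAdjoint.one _, fun x y => map_mul f x y, fun x => map_star f x,
    fun x y h => f.injective h, fun c => by simp, fun x hx => ⟨f.symm x, ?_⟩⟩⟩
  exact f.apply_symm_apply x

lemma norm_le_one_mul {A : Type} [CStarAlgebra A] {p x : A} {t : ℝ} (hp : ‖p‖ ≤ 1) (hx : ‖x‖ ≤ t) :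
    ‖p * x‖ ≤ t := by simpa using norm_mul_le_of_le hp hx

lemma norm_mul_le_one {A : Type} [CStarAlgebra A] {p x : A} {t : ℝ} (hp : ‖p‖ ≤ 1) (hx : ‖x‖ ≤ t) :
    ‖x * p‖ ≤ t := by simpa using norm_mul_le_of_le hx hp

lemma tri {A : Type} [CStarAlgebra A] {x y z : A} {s t : ℝ} (h1 : ‖x - y‖ ≤ s) (h2 : ‖y - z‖ ≤ t) :
    ‖x - z‖ ≤ s + t := by
  rw [← sub_add_sub_cancel x y z]; exact norm_add_le_of_le h1 h2

lemma geom_key {A : Type} [CStarAlgebra A] {p f a z0 : A} {δ : ℝ} (hδ : δ ≤ 1 / 1000)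
    (hp : IsIdempotentElem p) (hps : IsSelfAdjoint p) (hf : ‖f‖ ≤ 1)
    (has : IsSelfAdjoint a) (ha1 : ‖a‖ ≤ 1) (haa : ‖a * a - a‖ ≤ δ)
    (h1 : ‖f * p - z0‖ ≤ δ) (h2 : ‖p * f - z0‖ ≤ δ) (h3 : ‖a - z0‖ ≤ 4 * δ) :
    ∃ v q : A, IsSelfAdjoint v ∧ q = v * a * v ∧ IsIdempotentElem q ∧ IsSelfAdjoint q ∧
      q * v = v ∧ p * v = v ∧ v * p = v ∧ ‖v‖ ≤ 2 ∧ ‖q - f * p‖ ≤ 139 * δ ∧ ‖q - p * f‖ ≤ 139 * δ ∧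
      ‖v - f * p‖ ≤ 139 * δ ∧ ‖v - p * f‖ ≤ 139 * δ ∧ ‖a - a * v * v * a‖ ≤ 1 / 2 := by
  have hδ0 : 0 ≤ δ := (norm_nonneg _).trans haa
  have hp1 : ‖p‖ ≤ 1 := norm_proj_le hp hps
  have hp1' : ‖1 - p‖ ≤ 1 := norm_proj_le hp.one_sub ((IsSelfAdjoint.one A).sub hps)
  have hpp : p * p = p := hp
  have a1 : ‖a - f * p‖ ≤ 5 * δ := by
    rw [norm_sub_rev] at h1; exact (tri h3 h1).trans (by linarith)
  have a2 : ‖a - p * f‖ ≤ 5 * δ := by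
    rw [norm_sub_rev] at h2; exact (tri h3 h2).trans (by linarith)
  have a3 : ‖p * a - a‖ ≤ 5 * δ := by
    have : p * a - a = -((1 - p) * (a - p * f)) := by
      have : (1 - p) * (a - p * f) = a - p * a - p * f + (p * p) * f := by noncomm_ring
      rw [this, hpp]; abel
    rw [this, norm_neg]; exact norm_le_one_mul hp1' a2
  have a4 : ‖p * a * p - p * a‖ ≤ 5 * δ := by
    have : p * a * p - p * a = -(p * ((a - f * p) * (1 - p))) := by
      have : p * ((a - f * p) * (1 - p)) = p * a - p * a * p - p * f * p + p * f * (p * p) := by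
        noncomm_ring
      rw [this, hpp]; abel
    rw [this, norm_neg]; exact norm_le_one_mul hp1 (norm_mul_le_one hp1' a1)
  set b := p * a * p with hb
  have hba : ‖b - a‖ ≤ 10 * δ := (tri a4 a3).trans (by linarith)
  have hb1 : ‖b‖ ≤ 1 := norm_mul_le_one hp1 (norm_le_one_mul hp1 ha1)
  have hbs : IsSelfAdjoint b := by
    change star b = b
    rw [hb, star_mul, star_mul, has.star_eq, hps.star_eq, mul_assoc]
  have hbb : ‖b * b - b‖ ≤ 31 * δ := by
    have : b * b - b = b * (b - a) + (b - a) * a + (a * a - a) - (b - a) := by noncomm_ring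
    rw [this]
    exact (norm_sub_le_of_le (norm_add_le_of_le (norm_add_le_of_le (norm_le_one_mul hb1 hba)
      (norm_mul_le_one ha1 hba)) haa) hba).trans (by linarith)
  obtain ⟨v, q, hv, hq, hqi, hqs, hvq, hqv, ⟨w, hw1, hw2⟩, n1, n2, n3⟩ :=
    almost_projection hbs (by linarith) hbb
  have hpv : p * v = v := by
    rw [hw1, hb]
    calc p * (p * a * p * w) = (p * p) * a * p * w := by noncomm_ring
      _ = _ := by rw [hpp]
  have hvp : v * p = v := by
    rw [hw2, hb]
    calc w * (p * a * p) * p = w * (p * a * (p * p)) := by noncomm_ring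
      _ = _ := by rw [hpp]
  have hva : ‖v - a‖ ≤ 134 * δ := (tri n1 hba).trans (by linarith)
  have hqa : ‖q - a‖ ≤ 134 * δ := (tri n2 hba).trans (by linarith)
  refine ⟨v, q, hv, ?_, hqi, hqs, hqv, hpv, hvp, n3, (tri hqa a1).trans (by linarith),
    (tri hqa a2).trans (by linarith), (tri hva a1).trans (by linarith),
    (tri hva a2).trans (by linarith), ?_⟩
  · rw [hq, hb]
    calc v * (p * a * p) * v = (v * p) * a * (p * v) := by noncomm_ring
      _ = _ := by rw [hvp, hpv]
  · have : a - a * v * v * a = -(a * (v - a) * v * a + a * (a * (v - a)) * a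
        + (a * a - a) * (a * a) + (a * a - a) * a + (a * a - a)) := by noncomm_ring
    rw [this, norm_neg]
    have haa1 : ‖a * a‖ ≤ 1 := norm_le_one_mul ha1 ha1
    have := norm_add_le_of_le (norm_add_le_of_le (norm_add_le_of_le (norm_add_le_of_le
      (norm_mul_le_one ha1 (norm_mul_le_of_le (norm_le_one_mul ha1 hva) n3))
      (norm_mul_le_one ha1 (norm_le_one_mul ha1 (norm_le_one_mul ha1 hva))))
      (norm_mul_le_one haa1 haa)) (norm_mul_le_one ha1 haa)) haa
    exact this.trans (by linarith)

lemma geom_two {A : Type} [CStarAlgebra A] {p f v q x z z' : A} {δ M : ℝ}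
    (hδ0 : 0 ≤ δ) (hM : 1 ≤ M)
    (hf : ‖f‖ ≤ 1) (hp1 : ‖p‖ ≤ 1) (hq1 : ‖q‖ ≤ 1) (n3 : ‖v‖ ≤ 2)
    (q1 : ‖q - f * p‖ ≤ 139 * δ) (q2 : ‖q - p * f‖ ≤ 139 * δ)
    (v1 : ‖v - f * p‖ ≤ 139 * δ) (v2 : ‖v - p * f‖ ≤ 139 * δ)
    (hpx : p * x = x) (hxp : x * p = x) (hx : ‖x‖ ≤ M) (hz : ‖z‖ ≤ M)
    (z1 : ‖f * x - z‖ ≤ δ) (z2 : ‖x * f - z‖ ≤ δ) (z3 : ‖f * x * f - z‖ ≤ δ)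
    (hz' : ‖z' - z‖ ≤ 15 * M * δ) :
    ‖x - (p - q) * x * (p - q) - v * z' * v‖ ≤ 1042 * M * δ := by
  have hMδ : δ ≤ M * δ := by nlinarith
  have e : x - (p - q) * x * (p - q) - v * z' * v =
      ((q - f * p) * x + (f * x - z)) + (x * (q - p * f) + (x * f - z))
      - (((q - f * p) * x * q + f * x * (q - p * f)) + (f * x * f - z))
      - (v * (z' - z) * v + (((v - f * p) * z - f * (p * (x * f - z)) + (f * x * f - z)) * v
        + (z * (v - p * f) - ((f * x - z) * p) * f + (f * x * f - z)))) := by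
    have hh : (p - q) * x * (p - q) = p * x * p - p * x * q - q * (x * p) + q * x * q := by
      noncomm_ring
    have t1 : f * (p * (x * f - z)) = f * x * f - f * p * z := by
      calc f * (p * (x * f - z)) = f * (p * x) * f - f * p * z := by noncomm_ring
        _ = _ := by rw [hpx]
    have t2 : ((f * x - z) * p) * f = f * x * f - z * p * f := by
      calc ((f * x - z) * p) * f = f * (x * p) * f - z * p * f := by noncomm_ring
        _ = _ := by rw [hxp]
    have t3 : (q - f * p) * x = q * x - f * x := by
      rw [sub_mul, mul_assoc, hpx]
    have t4 : x * (q - p * f) = x * q - x * f := by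
      rw [mul_sub, ← mul_assoc, hxp]
    have t5 : f * x * (q - p * f) = f * x * q - f * x * f := by
      rw [mul_assoc, t4]; noncomm_ring
    rw [hh, t1, t2, t5, t3, t4, hpx, hxp]
    noncomm_ring
  rw [e]
  have fx : ‖f * x‖ ≤ M := norm_le_one_mul hf hx
  have m0 : 0 ≤ 139 * δ := by positivity
  have c1 := norm_add_le_of_le (norm_mul_le_of_le q1 hx) z1
  have c2 := norm_add_le_of_le (norm_mul_le_of_le hx q2) z2
  have c3 := norm_add_le_of_le (norm_add_le_of_le (norm_mul_le_one hq1 (norm_mul_le_of_le q1 hx))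
    (norm_mul_le_of_le fx q2)) z3
  have c4 := norm_mul_le_of_le (norm_mul_le_of_le n3 hz') n3
  have c5 := norm_mul_le_of_le (norm_add_le_of_le (norm_sub_le_of_le (norm_mul_le_of_le v1 hz)
    (norm_le_one_mul hf (norm_le_one_mul hp1 z2))) z3) n3
  have c6 := norm_add_le_of_le (norm_sub_le_of_le (norm_mul_le_of_le hz v2)
    (norm_mul_le_one hf (norm_mul_le_one hp1 z1))) z3
  have := norm_sub_le_of_le (norm_sub_le_of_le (norm_add_le_of_le c1 c2) c3)
    (norm_add_le_of_le c4 (norm_add_le_of_le c5 c6))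
  refine this.trans ?_
  nlinarith

lemma alpha_est {B : Type} [CStarAlgebra B] {a y z : B} {δ M : ℝ} (hδ0 : 0 ≤ δ) (hM : 1 ≤ M)
    (ha1 : ‖a‖ ≤ 1) (hy2 : ‖y‖ ≤ 2) (hya : ‖y - a‖ ≤ 4 * δ) (hz : ‖z‖ ≤ M)
    (h1 : ‖a * z - z‖ ≤ δ) (h2 : ‖z * a - z‖ ≤ δ) : ‖y * z * y - z‖ ≤ 15 * M * δ := by
  have e : y * z * y - z = (y - a) * z * y + (a * z - z) * y + z * (y - a) + (z * a - z) := by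
    noncomm_ring
  rw [e]
  refine (norm_add_le_of_le (norm_add_le_of_le (norm_add_le_of_le
    (norm_mul_le_of_le (norm_mul_le_of_le hya hz) hy2) (norm_mul_le_of_le h1 hy2))
    (norm_mul_le_of_le hz hya)) h2).trans ?_
  nlinarith

/-- Conjugation by a self-adjoint element. -/
noncomputable def conjL {A : Type} [CStarAlgebra A] (z : A) : A →ₗ[ℂ] A where
  toFun x := z * x * z
  map_add' x y := by rw [mul_add, add_mul]
  map_smul' r x := by simp

lemma conjL_apply {A : Type} [CStarAlgebra A] (z x : A) : conjL z x = z * x * z := rfl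

lemma conjL_pos {A : Type} [CStarAlgebra A] {z : A} (hz : IsSelfAdjoint z) :
    MatPosPres (conjL z) := by
  intro n a ha
  have h := ha.conj z
  rw [hz.star_eq] at h
  exact h

lemma cuntz_corner {C A : Type} [CStarAlgebra C] [CStarAlgebra A] {p : A} {ι : C →ₗ[ℂ] A}
    (h : CorEmb p ι) {r0 c : C} {g z : A} (hz : z * g * star z = ι r0) (hg : CuntzLE g (ι c)) :
    CuntzLE r0 c := by
  obtain ⟨v, hv⟩ := hg
  refine ⟨fun k => h.compr (z * v k), ?_⟩
  have h1 : Tendsto (fun k => p * (z * (v k * ι c * star (v k)) * star z) * p) atTop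
      (𝓝 (p * (z * g * star z) * p)) := by
    have hc : Continuous fun y : A => p * (z * y * star z) * p := by fun_prop
    exact (hc.tendsto g).comp hv
  rw [hz, h.mem] at h1
  rw [tendsto_iff_norm_sub_tendsto_zero] at h1 ⊢
  refine h1.congr fun k => ?_
  rw [← h.norm_map, map_sub]
  congr 2
  rw [h.map_mul, h.map_mul, h.map_star, h.compr_spec]
  simp only [star_mul, h.sa.star_eq]
  conv_lhs => rw [← h.mem c]
  noncomm_ring

lemma norm_proj_eq {A : Type} [CStarAlgebra A] {p : A} (hp : IsIdempotentElem p)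
    (hps : IsSelfAdjoint p) (h0 : p ≠ 0) : ‖p‖ = 1 := by
  have h1 := CStarRing.norm_star_mul_self (x := p)
  rw [hps.star_eq, hp.eq] at h1
  have : ‖p‖ ≠ 0 := norm_ne_zero_iff.2 h0
  exact (mul_left_cancel₀ this (by rw [mul_one]; exact h1)).symm

lemma ata_corner {P : BundledCStarAlgebra → Prop}
    (hPher : ∀ B : BundledCStarAlgebra, P B →
      ∀ (p : B.carrier) (hp : IsIdempotentElem p) (hps : IsSelfAdjoint p), p ≠ 0 →
      ∀ C : BundledCStarAlgebra,
        Nonempty (C.carrier ≃⋆ₐ[ℂ] cstarCorner p hp hps) → P C)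
    {C A : Type} [CStarAlgebra C] [CStarAlgebra A] {p : A} {ι : C →ₗ[ℂ] A}
    (h : CorEmb p ι) (hp0 : p ≠ 0) (hT : AsympTraciallyIn P A) : AsympTraciallyIn P C := by
  classical
  rintro ε hε F c ⟨d, rfl⟩ hc0
  -- the finite set and the constants
  set F2 : Finset C := F ∪ (F ×ˢ F).image (fun t => t.1 * t.2) with hF2
  have hFF2 : ∀ x ∈ F, x ∈ F2 := fun x hx => Finset.mem_union_left _ hx
  have hFm : ∀ x ∈ F, ∀ y ∈ F, x * y ∈ F2 := fun x hx y hy =>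
    Finset.mem_union_right _ (Finset.mem_image.2 ⟨(x, y), Finset.mk_mem_product hx hy, rfl⟩)
  set M : ℝ := 1 + ∑ x ∈ F2, ‖x‖ with hMdef
  have hM : 1 ≤ M := by
    have : 0 ≤ ∑ x ∈ F2, ‖x‖ := Finset.sum_nonneg fun _ _ => norm_nonneg _
    linarith
  have hFM : ∀ x ∈ F2, ‖x‖ ≤ M := by
    intro x hx
    have := Finset.single_le_sum (f := fun x : C => ‖x‖) (fun _ _ => norm_nonneg _) hx
    linarith
  set δ : ℝ := min (1 / 1000) (ε / (2000 * M ^ 2)) with hδdef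
  have hM2 : 0 < M ^ 2 := by positivity
  have hδ0 : 0 < δ := lt_min (by norm_num) (by positivity)
  have hδ1 : δ ≤ 1 / 1000 := min_le_left _ _
  have hδ2 : 2000 * M ^ 2 * δ ≤ ε := by
    have h1 : δ ≤ ε / (2000 * M ^ 2) := min_le_right _ _
    rw [le_div_iff₀ (by positivity)] at h1
    linarith
  have hMM : M * δ ≤ M ^ 2 * δ := by
    apply mul_le_mul_of_nonneg_right _ hδ0.le; nlinarith
  have hMδ : δ ≤ M * δ := by nlinarith
  set G : Finset A := insert p (F2.image ι) with hG
  have hpG : p ∈ G := Finset.mem_insert_self _ _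
  have hxG : ∀ x ∈ F2, ι x ∈ G := fun x hx =>
    Finset.mem_insert_of_mem (Finset.mem_image_of_mem _ hx)
  obtain ⟨B, hB, α, β, γ, hα, hβ, hγ, hort, hα1, hproj, h2, h3, h3', h4, h5⟩ :=
    hT δ hδ0 G (ι (star d * d)) ⟨ι d, by rw [h.map_mul, h.map_star]⟩
      (fun h0 => hc0 (h.inj (by rw [h0, map_zero])))
  have hp1 : ‖p‖ = 1 := norm_proj_eq h.idem h.sa hp0
  -- the algebra `B'`
  have has : IsSelfAdjoint (α p) := by
    change star (α p) = α p
    rw [← hα.pos.map_star, h.sa.star_eq]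
  have ha1 : ‖α p‖ ≤ 1 := (hα.1 p).trans hp1.le
  have haa : ‖α p * α p - α p‖ ≤ δ := by
    have := h3 p hpG p hpG
    rw [h.idem.eq] at this
    exact this.le
  obtain ⟨y, q, hy, hq, hqi, hqs, hyq, hqy, -, ny, nq, hy2⟩ :=
    almost_projection has (by linarith) haa
  have hq0 : q ≠ 0 := by
    rintro rfl
    have h6 := h3' p hpG
    rw [zero_sub, norm_neg] at nq
    linarith
  have hq1 : ‖q‖ ≤ 1 := norm_proj_le hqi hqs
  obtain ⟨B', hB', κ, hκ⟩ : ∃ B' : BundledCStarAlgebra, P B' ∧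
      ∃ κ : B'.carrier →ₗ[ℂ] B.carrier, CorEmb q κ :=
    ⟨⟨Cor q hqi hqs⟩, hPher B hB q hqi hqs hq0 _ ⟨Cor.equiv q hqi hqs⟩, Cor.incl q hqi hqs,
      Cor.corEmb q hqi hqs⟩
  -- the map `α'`
  let α' : C →ₗ[ℂ] B'.carrier := hκ.compr ∘ₗ conjL y ∘ₗ α ∘ₗ ι
  have hα's : ∀ x, κ (α' x) = y * α (ι x) * y := by
    intro x
    change κ (hκ.compr (y * α (ι x) * y)) = _
    rw [hκ.compr_spec]
    calc q * (y * α (ι x) * y) * q = (q * y) * α (ι x) * (y * q) := by noncomm_ring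
      _ = _ := by rw [hqy, hyq]
  have hα'1 : α' 1 = 1 := by
    apply hκ.inj
    rw [hα's, h.map_one, hκ.map_one, hq]
  have hα'p : MatPosPres α' := hκ.compr_pos.comp ((conjL_pos hy).comp (hα.pos.comp h.pos))
  have hα'c : IsCPC α' := hα'p.isCPC (by
    rw [hα'1, ← hκ.norm_map, hκ.map_one]; exact hq1)
  clear_value α'
  have hαx : ∀ x ∈ F2, ‖α (ι x)‖ ≤ M := fun x hx =>
    (hα.1 _).trans ((h.norm_map x).le.trans (hFM x hx))
  have hα'x : ∀ x ∈ F2, ‖κ (α' x) - α (ι x)‖ ≤ 15 * M * δ := by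
    intro x hx
    rw [hα's]
    refine alpha_est hδ0.le hM ha1 hy2 ny (hαx x hx) ?_ ?_
    · have := (h3 p hpG _ (hxG x hx)).le
      rwa [h.mulL] at this
    · have := (h3 _ (hxG x hx) p hpG).le
      rwa [h.mulR] at this
  -- geometry for large `n`
  have hev : ∀ᶠ n in atTop, ‖β n (q * q) - β n q * β n q‖ < δ :=
    (h4 q q).1.eventually (gt_mem_nhds hδ0)
  obtain ⟨N, hN⟩ := eventually_atTop.1 hev
  have hfg : ∀ n, ∀ x ∈ G, ‖β n 1 * x - β n (α x)‖ ≤ δ ∧ ‖x * β n 1 - β n (α x)‖ ≤ δ ∧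
      ‖β n 1 * x * β n 1 - β n (α x)‖ ≤ δ := by
    intro n x hx
    obtain ⟨p1, p2, p3, p4, p5⟩ := hproj n
    have hf1 : ‖β n 1‖ ≤ 1 := norm_proj_le p1 p2
    have hfe : β n 1 = 1 - γ n 1 := eq_sub_of_add_eq p5
    have e1 : β n 1 * γ n x = 0 := (hort n x 1).2
    have e2 : γ n x * β n 1 = 0 := (hort n x 1).1
    have e3 : β n 1 * β n (α x) = β n (α x) := by
      rw [hfe, sub_mul, one_mul, (hort n 1 (α x)).1, sub_zero]
    have e4 : β n (α x) * β n 1 = β n (α x) := by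
      rw [hfe, mul_sub, mul_one, (hort n 1 (α x)).2, sub_zero]
    have hd := (h2 x hx n).le
    refine ⟨?_, ?_, ?_⟩
    · have : β n 1 * x - β n (α x) = β n 1 * (x - γ n x - β n (α x)) := by
        rw [mul_sub, mul_sub, e1, e3, sub_zero]
      rw [this]; exact norm_le_one_mul hf1 hd
    · have : x * β n 1 - β n (α x) = (x - γ n x - β n (α x)) * β n 1 := by
        rw [sub_mul, sub_mul, e2, e4, sub_zero]
      rw [this]; exact norm_mul_le_one hf1 hd
    · have : β n 1 * x * β n 1 - β n (α x) = β n 1 * (x - γ n x - β n (α x)) * β n 1 := by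
        rw [mul_sub, mul_sub, e1, e3, sub_zero, sub_mul, e4]
      rw [this]; exact norm_mul_le_one hf1 (norm_le_one_mul hf1 hd)
  have hbn1 : ∀ n, ‖β n q‖ ≤ 1 := fun n => ((hβ n).1 q).trans hq1
  have hbns : ∀ n, IsSelfAdjoint (β n q) := fun n => by
    change star (β n q) = β n q
    rw [← (hβ n).pos.map_star, hqs.star_eq]
  have hgeom : ∀ n, ∃ v r : A, IsSelfAdjoint v ∧ r = v * β (n + N) q * v ∧ IsIdempotentElem r ∧
      IsSelfAdjoint r ∧ r * v = v ∧ p * v = v ∧ v * p = v ∧ ‖v‖ ≤ 2 ∧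
      ‖r - β (n + N) 1 * p‖ ≤ 139 * δ ∧ ‖r - p * β (n + N) 1‖ ≤ 139 * δ ∧
      ‖v - β (n + N) 1 * p‖ ≤ 139 * δ ∧ ‖v - p * β (n + N) 1‖ ≤ 139 * δ ∧
      ‖β (n + N) q - β (n + N) q * v * v * β (n + N) q‖ ≤ 1 / 2 := by
    intro n
    obtain ⟨p1, p2, p3, p4, p5⟩ := hproj (n + N)
    refine geom_key hδ1 h.idem h.sa (norm_proj_le p1 p2) (hbns _) (hbn1 _) ?_
      (hfg (n + N) p hpG).1 (hfg (n + N) p hpG).2.1 ?_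
    · have := (hN (n + N) (by omega)).le
      rwa [hqi.eq, norm_sub_rev] at this
    · rw [← map_sub]; exact ((hβ _).1 _).trans nq
  choose v r hvs hr hri hrs hrv hpv hvp hv2 hr1 hr2 hv3 hv4 hd using hgeom
  have hpr : ∀ n, p * r n = r n := fun n => by
    rw [hr, ← mul_assoc, ← mul_assoc, hpv]
  have hrp : ∀ n, r n * p = r n := fun n => by
    rw [hr, mul_assoc, hvp]
  have hti : ∀ n, IsIdempotentElem (p - r n) := fun n => by
    change (p - r n) * (p - r n) = p - r n
    rw [sub_mul, mul_sub, mul_sub, hpr, hrp, h.idem.eq, (hri n).eq]; abel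
  have hts : ∀ n, IsSelfAdjoint (p - r n) := fun n => h.sa.sub (hrs n)
  have htp : ∀ n, (p - r n) * p = p - r n := fun n => by rw [sub_mul, hrp, h.idem.eq]
  have hpt : ∀ n, p * (p - r n) = p - r n := fun n => by rw [mul_sub, hpr, h.idem.eq]
  have htv : ∀ n, (p - r n) * v n = 0 := fun n => by rw [sub_mul, hpv, hrv, sub_self]
  have hvr : ∀ n, v n * r n = v n := fun n => by
    have := congrArg star (hrv n)
    rwa [star_mul, (hvs n).star_eq, (hrs n).star_eq] at this
  have hvt : ∀ n, v n * (p - r n) = 0 := fun n => by rw [mul_sub, hvp, hvr, sub_self]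
  -- the maps
  let β' : ℕ → (B'.carrier →ₗ[ℂ] C) := fun n => h.compr ∘ₗ conjL (v n) ∘ₗ β (n + N) ∘ₗ κ
  let γ' : ℕ → (C →ₗ[ℂ] C) := fun n => h.compr ∘ₗ conjL (p - r n) ∘ₗ ι
  have hβ's : ∀ n x, ι (β' n x) = v n * β (n + N) (κ x) * v n := by
    intro n x
    change ι (h.compr (v n * β (n + N) (κ x) * v n)) = _
    rw [h.compr_spec]
    calc p * (v n * β (n + N) (κ x) * v n) * p = (p * v n) * β (n + N) (κ x) * (v n * p) := by
          noncomm_ring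
      _ = _ := by rw [hpv, hvp]
  have hγ's : ∀ n x, ι (γ' n x) = (p - r n) * ι x * (p - r n) := by
    intro n x
    change ι (h.compr ((p - r n) * ι x * (p - r n))) = _
    rw [h.compr_spec]
    calc p * ((p - r n) * ι x * (p - r n)) * p
          = (p * (p - r n)) * ι x * ((p - r n) * p) := by simp only [mul_assoc]
      _ = _ := by rw [hpt, htp]
  have hβ'p : ∀ n, MatPosPres (β' n) := fun n =>
    h.compr_pos.comp ((conjL_pos (hvs n)).comp ((hβ _).pos.comp hκ.pos))
  have hγ'p : ∀ n, MatPosPres (γ' n) := fun n =>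
    h.compr_pos.comp ((conjL_pos (hts n)).comp h.pos)
  clear_value β' γ'
  have hβ'1 : ∀ n, ι (β' n 1) = r n := fun n => by rw [hβ's, hκ.map_one, ← hr]
  have hγ'1 : ∀ n, ι (γ' n 1) = p - r n := fun n => by
    rw [hγ's, h.map_one, htp, (hti n).eq]
  have hβ'c : ∀ n, IsCPC (β' n) := fun n => (hβ'p n).isCPC (by
    rw [← h.norm_map, hβ'1]; exact norm_proj_le (hri n) (hrs n))
  have hγ'c : ∀ n, IsCPC (γ' n) := fun n => (hγ'p n).isCPC (by
    rw [← h.norm_map, hγ'1]; exact norm_proj_le (hti n) (hts n))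
  have idem_of : ∀ {c : C}, IsIdempotentElem (ι c) → IsIdempotentElem c := fun {c} hc => by
    apply h.inj; rw [h.map_mul]; exact hc
  have sa_of : ∀ {c : C}, IsSelfAdjoint (ι c) → IsSelfAdjoint c := fun {c} hc => by
    apply h.inj; rw [h.map_star]; exact hc
  refine ⟨B', hB', α', β', γ', hα'c, hβ'c, hγ'c, ?_, hα'1, ?_, ?_, ?_, ?_, ?_, ?_⟩
  · intro n x b
    constructor
    · apply h.inj
      rw [h.map_mul, hγ's, hβ's, map_zero]
      calc (p - r n) * ι x * (p - r n) * (v n * β (n + N) (κ b) * v n)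
          = (p - r n) * ι x * ((p - r n) * v n) * (β (n + N) (κ b) * v n) := by
            simp only [mul_assoc]
        _ = 0 := by rw [htv]; simp
    · apply h.inj
      rw [h.map_mul, hγ's, hβ's, map_zero]
      calc v n * β (n + N) (κ b) * v n * ((p - r n) * ι x * (p - r n))
          = v n * β (n + N) (κ b) * (v n * (p - r n)) * (ι x * (p - r n)) := by
            simp only [mul_assoc]
        _ = 0 := by rw [hvt]; simp
  · intro n
    refine ⟨idem_of (by rw [hβ'1]; exact hri n), sa_of (by rw [hβ'1]; exact hrs n),
      idem_of (by rw [hγ'1]; exact hti n), sa_of (by rw [hγ'1]; exact hts n), ?_⟩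
    apply h.inj
    rw [map_add, hβ'1, hγ'1, h.map_one]; abel
  · intro x hx n
    have hx2 := hFF2 x hx
    rw [← h.norm_map, map_sub, map_sub, hγ's, hβ's]
    obtain ⟨p1, p2, p3, p4, p5⟩ := hproj (n + N)
    obtain ⟨g1, g2, g3⟩ := hfg (n + N) (ι x) (hxG x hx2)
    have := geom_two hδ0.le hM (norm_proj_le p1 p2) hp1.le (norm_proj_le (hri n) (hrs n)) (hv2 n)
      (hr1 n) (hr2 n) (hv3 n) (hv4 n) (h.mulL x) (h.mulR x) ((h.norm_map x).le.trans (hFM x hx2))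
      (((hβ (n + N)).1 _).trans (hαx x hx2)) g1 g2 g3
      (z' := β (n + N) (κ (α' x))) (by
        rw [← map_sub]; exact ((hβ _).1 _).trans (hα'x x hx2))
    refine this.trans_lt ?_
    nlinarith
  · intro x hx y hy
    have hx2 := hFF2 x hx
    have hy2 := hFF2 y hy
    have hxy := hFm x hx y hy
    rw [← hκ.norm_map, map_sub, hκ.map_mul]
    have e : κ (α' x) * κ (α' y) - κ (α' (x * y)) =
        (κ (α' x) - α (ι x)) * κ (α' y) + α (ι x) * (κ (α' y) - α (ι y))
        + (α (ι x) * α (ι y) - α (ι (x * y))) - (κ (α' (x * y)) - α (ι (x * y))) := by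
      noncomm_ring
    rw [e]
    have n1 : ‖κ (α' y)‖ ≤ M := (hκ.norm_map _).le.trans ((hα'c.1 y).trans (hFM y hy2))
    have n2 : ‖α (ι x) * α (ι y) - α (ι (x * y))‖ ≤ δ := by
      rw [h.map_mul]; exact (h3 _ (hxG x hx2) _ (hxG y hy2)).le
    refine (norm_sub_le_of_le (norm_add_le_of_le (norm_add_le_of_le
      (norm_mul_le_of_le (hα'x x hx2) n1) (norm_mul_le_of_le (hαx x hx2) (hα'x y hy2))) n2)
      (hα'x _ hxy)).trans_lt ?_
    nlinarith
  · intro x hx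
    have hx2 := hFF2 x hx
    have n1 := h3' _ (hxG x hx2)
    have n2 := hα'x x hx2
    have n3 := norm_sub_norm_le (α (ι x)) (κ (α' x))
    rw [norm_sub_rev, hκ.norm_map] at n3
    rw [h.norm_map] at n1
    nlinarith
  · intro x w
    have hη : Tendsto (fun n => ‖β (n + N) q * β (n + N) q - β (n + N) q‖) atTop (𝓝 0) := by
      have := (h4 q q).1.comp (tendsto_add_atTop_nat N)
      refine this.congr fun n => ?_
      simp only [Function.comp]
      rw [hqi.eq, norm_sub_rev]
    have hR : ∀ x : B'.carrier, Tendsto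
        (fun n => ‖β (n + N) (κ x) - β (n + N) (κ x) * β (n + N) q‖) atTop (𝓝 0) := fun x => by
      have := (h4 (κ x) q).1.comp (tendsto_add_atTop_nat N)
      refine this.congr fun n => ?_
      simp only [Function.comp]
      rw [hκ.mulR]
    have hL : ∀ x : B'.carrier, Tendsto
        (fun n => ‖β (n + N) (κ x) - β (n + N) q * β (n + N) (κ x)‖) atTop (𝓝 0) := fun x => by
      have := (h4 q (κ x)).1.comp (tendsto_add_atTop_nat N)
      refine this.congr fun n => ?_
      simp only [Function.comp]
      rw [hκ.mulL]
    have hE := (h4 (κ x) (κ w)).1.comp (tendsto_add_atTop_nat N)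
    have hnb : ∀ n (x : B'.carrier), ‖β (n + N) (κ x)‖ ≤ ‖x‖ := fun n x =>
      ((hβ _).1 _).trans (hκ.norm_map x).le
    have hd' : ∀ n, ‖β (n + N) q - β (n + N) q * v n * v n * β (n + N) q‖ ≤
        50 * ‖β (n + N) q * β (n + N) q - β (n + N) q‖ := fun n =>
      asy_key (hbn1 _) (hv2 n) (by rw [← hr, hrv]) (hd n)
    constructor
    · have e0 : ∀ n, ‖β' n (x * w) - β' n x * β' n w‖ =
          ‖v n * β (n + N) (κ (x * w)) * v n
            - (v n * β (n + N) (κ x) * v n) * (v n * β (n + N) (κ w) * v n)‖ := fun n => by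
        rw [← h.norm_map, map_sub, h.map_mul, hβ's, hβ's, hβ's]
      have key := fun n => (e0 n).trans_le (asy_mul (hbn1 _) (hv2 n) (hd' n) le_rfl le_rfl
        (e3 := ‖β (n + N) (κ x * κ w) - β (n + N) (κ x) * β (n + N) (κ w)‖)
          (by rw [hκ.map_mul]) (hnb n x) (hnb n w))
      refine squeeze_zero (fun _ => norm_nonneg _) key ?_
      have := ((((hE.add ((hR x).mul_const ‖w‖)).add
        (((hη.const_mul 50).const_mul ‖x‖).mul_const ‖w‖)).add ((hL w).const_mul (‖x‖ * 4))).add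
        (((hR x).mul_const 4).mul_const ‖w‖)).const_mul 4
      simpa using this
    · have hup : ∀ n, ‖β' n x‖ ≤ ‖x‖ := fun n => (hβ'c n).1 x
      have e0 : ∀ n, ‖v n * β (n + N) (κ x) * v n‖ = ‖β' n x‖ := fun n => by
        rw [← h.norm_map, hβ's]
      have key := fun n => (asy_norm (hbns _) (hvs n) (hbn1 _) (hv2 n) (hd' n) le_rfl le_rfl
        (hnb n x) ((e0 n).trans_le (hup n))).trans_eq (e0 n)
      refine tendsto_of_tendsto_of_tendsto_of_le_of_le ?_ tendsto_const_nhds key hup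
      have h50 := hη.const_mul 50
      have hs := (hR x).add (hL x)
      have hn := (h4 (κ x) q).2.comp (tendsto_add_atTop_nat N)
      have := hn.sub (((h50.mul ((hs.const_mul 4).const_add ‖x‖)).add (hs.const_mul 5)).add
        ((h50.const_mul 5).mul_const ‖x‖))
      simpa [hκ.norm_map] using this
  · intro n
    obtain ⟨p1, p2, p3, p4, p5⟩ := hproj (n + N)
    have ht1 : ‖p - r n‖ ≤ 1 := norm_proj_le (hti n) (hts n)
    have hlt : ‖(p - r n) - (p - r n) * γ (n + N) 1 * (p - r n)‖ < 1 := by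
      have hge : γ (n + N) 1 = 1 - β (n + N) 1 := eq_sub_of_add_eq' p5
      have e : (p - r n) - (p - r n) * γ (n + N) 1 * (p - r n) =
          -((p - r n) * (r n - β (n + N) 1 * p) * (p - r n)) := by
        have t2 : (p - r n) * r n = 0 := by rw [sub_mul, hpr, (hri n).eq, sub_self]
        calc (p - r n) - (p - r n) * γ (n + N) 1 * (p - r n)
            = (p - r n) - (p - r n) * (p - r n) + (p - r n) * β (n + N) 1 * (p - r n) := by
              generalize p - r n = t; rw [hge]; noncomm_ring
          _ = (p - r n) * β (n + N) 1 * (p * (p - r n)) := by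
              rw [(hti n).eq, hpt, sub_self, zero_add]
          _ = -(((p - r n) * r n) * (p - r n)
                - (p - r n) * β (n + N) 1 * (p * (p - r n))) := by rw [t2, zero_mul]; abel
          _ = _ := by simp only [mul_assoc, mul_sub (p - r n) (r n), sub_mul _ _ (p - r n)]
      rw [e, norm_neg]
      have := norm_mul_le_one ht1 (norm_le_one_mul ht1 (hr1 n))
      linarith
    obtain ⟨z, hz⟩ := exists_conj_eq (hti n) (hts n) p4 hlt
    exact cuntz_corner h (by rw [hγ'1]; exact hz) (h5 (n + N))

/-- If the class `P` of unital C*-algebras is closed under tensoring with matrix algebras and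
under passing to unital hereditary C*-subalgebras, then so is the class `ATA P` of simple
unital C*-algebras asymptotically tracially in `P`: if `A ∈ ATA P` then `Mₘ(A) ∈ ATA P`
for every `m ≥ 1` and `pAp ∈ ATA P` for every nonzero projection `p ∈ A`.  (Membership of
`Mₘ(A)` resp. `pAp` is expressed via abstract C*-algebras `⋆`-isomorphic to them.) -/
theorem memATA_closed_matrix_and_hereditary
    (P : BundledCStarAlgebra → Prop)
    (hPmat : ∀ B : BundledCStarAlgebra, P B → ∀ m : ℕ, 1 ≤ m →
      ∀ C : BundledCStarAlgebra,
        Nonempty (C.carrier ≃⋆ₐ[ℂ] Matrix (Fin m) (Fin m) B.carrier) → P C)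
    (hPher : ∀ B : BundledCStarAlgebra, P B →
      ∀ (p : B.carrier) (hp : IsIdempotentElem p) (hps : IsSelfAdjoint p), p ≠ 0 →
      ∀ C : BundledCStarAlgebra,
        Nonempty (C.carrier ≃⋆ₐ[ℂ] cstarCorner p hp hps) → P C)
    (A : Type) [CStarAlgebra A] (hA : MemATA P A) :
    (∀ m : ℕ, 1 ≤ m → ∀ C : BundledCStarAlgebra,
      Nonempty (C.carrier ≃⋆ₐ[ℂ] Matrix (Fin m) (Fin m) A) → MemATA P C.carrier) ∧
    (∀ (p : A) (hp : IsIdempotentElem p) (hps : IsSelfAdjoint p), p ≠ 0 →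
      ∀ C : BundledCStarAlgebra,
        Nonempty (C.carrier ≃⋆ₐ[ℂ] cstarCorner p hp hps) → MemATA P C.carrier) := by
  obtain ⟨hS, hT⟩ := hA
  have hAS := hS.algSimple
  constructor
  · rintro m hm C ⟨e⟩
    have hMS : AlgSimple (MM m A) :=
      (hAS.matrix m).ofEquiv MM.toMat.symm MM.toMat (fun x => MM.toMat.symm_apply_apply x)
        (fun x y => map_mul _ x y) (fun x y => map_add _ x y) (map_one _)
    have hMT : AsympTraciallyIn P (MM m A) := ata_matrix hPmat hAS hT hm
    obtain ⟨ι, hι⟩ := corEmb_of_mat e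
    refine ⟨(hι.algSimple hMS).isSimple, ?_⟩
    by_cases h1 : (1 : MM m A) = 0
    · intro ε _ F c _ hc
      exfalso
      apply hc
      apply hι.inj
      rw [map_zero, ← mul_one (ι c), h1, mul_zero]
    · exact ata_corner hPher hι h1 hMT
  · rintro p hp hps hp0 C ⟨e⟩
    obtain ⟨ι, hι⟩ := corEmb_of_equiv p hp hps e
    exact ⟨(hι.algSimple hAS).isSimple, ata_corner hPher hι hp0 hT⟩
end

section
/- Let A be a C*-algebra, let a, b ∈ A be positive elements, and let δ > 0 be such that ‖a − b‖ < δ. Then (a − δ)_+ ≲ b, i.e., (a − δ)_+ is Cuntz subequivalent to b. -/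
open Filter Topology

section aux

lemma aux_norm_le {B : Type*} [CStarAlgebra B] [PartialOrder B] [StarOrderedRing B]
    (s d : B) (hs : IsSelfAdjoint s) (hd : 0 ≤ d) (hsd : s * s ≤ d) (ε : ℝ) (hε : 0 < ε) :
    ‖s * (1 - cfc (fun t : ℝ => t ^ 2 / (|t| + ε) ^ 2) d) * s‖ ≤ 2 * ε := by
  have hpos : ∀ t : ℝ, 0 < |t| + ε := fun t => by positivity
  have hne : ∀ t : ℝ, (|t| + ε) ^ 2 ≠ 0 := fun t => (pow_pos (hpos t) 2).ne'
  have hcont : Continuous (fun t : ℝ => t ^ 2 / (|t| + ε) ^ 2) := by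
    refine Continuous.div (by fun_prop) (by fun_prop) hne
  have hle : ∀ t : ℝ, 0 ≤ 1 - t ^ 2 / (|t| + ε) ^ 2 := fun t => by
    rw [sub_nonneg, div_le_one (pow_pos (hpos t) 2), ← sq_abs t]
    have := abs_nonneg t
    gcongr
    linarith
  have hda : IsSelfAdjoint d := .of_nonneg hd
  set w : B := cfc (fun t : ℝ => √(1 - t ^ 2 / (|t| + ε) ^ 2)) d with hw
  have hwc : Continuous (fun t : ℝ => √(1 - t ^ 2 / (|t| + ε) ^ 2)) := by fun_prop
  have hwsa : IsSelfAdjoint w := cfc_predicate _ d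
  have hww : 1 - cfc (fun t : ℝ => t ^ 2 / (|t| + ε) ^ 2) d = w * w := by
    rw [hw, ← cfc_mul _ _ d hwc.continuousOn hwc.continuousOn, ← cfc_one ℝ d,
      ← cfc_sub _ _ d (by exact continuousOn_const) hcont.continuousOn]
    refine cfc_congr fun t _ => ?_
    simp only [Pi.one_apply]
    exact (Real.mul_self_sqrt (hle t)).symm
  have hwdw : w * d * w = cfc (fun t : ℝ => t * (1 - t ^ 2 / (|t| + ε) ^ 2)) d := by
    conv_lhs => rw [hw]; enter [1, 2]; rw [← cfc_id ℝ d]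
    rw [← cfc_mul _ _ d hwc.continuousOn continuousOn_id,
      ← cfc_mul _ _ d (by exact (hwc.mul continuous_id).continuousOn) hwc.continuousOn]
    refine cfc_congr fun t _ => ?_
    have := Real.mul_self_sqrt (hle t)
    simp only [id]
    linear_combination t * this
  have h1 : ‖s * (w * w) * s‖ = ‖w * (s * s) * w‖ := by
    have e1 : s * (w * w) * s = star (w * s) * (w * s) := by
      rw [star_mul, hs.star_eq, hwsa.star_eq]; simp only [mul_assoc]
    have e2 : w * (s * s) * w = (w * s) * star (w * s) := by
      rw [star_mul, hs.star_eq, hwsa.star_eq]; simp only [mul_assoc]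
    rw [e1, e2, CStarRing.norm_star_mul_self, CStarRing.norm_self_mul_star]
  have hss : 0 ≤ s * s := by simpa [hs.star_eq] using star_mul_self_nonneg s
  rw [hww, h1]
  have h2 : 0 ≤ w * (s * s) * w := hwsa.conjugate_nonneg hss
  have h3 : w * (s * s) * w ≤ w * d * w := hwsa.conjugate_le_conjugate hsd
  refine (CStarAlgebra.norm_le_norm_of_nonneg_of_le h2 h3).trans ?_
  rw [hwdw]
  refine norm_cfc_le (by positivity) fun t ht => ?_
  have ht0 : 0 ≤ t := spectrum_nonneg_of_nonneg hd ht
  rw [Real.norm_of_nonneg (mul_nonneg ht0 (hle t)), abs_of_nonneg ht0]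
  have : 0 < t + ε := by positivity
  rw [one_sub_div (by positivity), ← mul_div_assoc, div_le_iff₀ (by positivity)]
  nlinarith [mul_nonneg ht0 hε.le, pow_pos hε 3, mul_nonneg ht0 (sq_nonneg ε), mul_nonneg (sq_nonneg t) hε.le]

lemma cuntz_of_le {A : Type} [NonUnitalCStarAlgebra A] [PartialOrder A] [StarOrderedRing A]
    (c d : A) (hc : 0 ≤ c) (hcd : c ≤ d) : CuntzLE c d := by
  have hd : 0 ≤ d := hc.trans hcd
  have hda : IsSelfAdjoint d := .of_nonneg hd
  have key : ∀ ε : ℝ, 0 < ε → ∃ v : A, ‖v * d * star v - c‖ ≤ 2 * ε := by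
    intro ε hε
    have hpos : ∀ t : ℝ, 0 < |t| + ε := fun t => by positivity
    set g : ℝ → ℝ := fun t => √t / (|t| + ε) with hg
    have hgc : Continuous g := by
      refine Continuous.div (by fun_prop) (by fun_prop) fun t => (hpos t).ne'
    have hg0 : g 0 = 0 := by simp [hg]
    set s : A := CFC.sqrt c with hs
    have hss : s * s = c := CFC.sqrt_mul_sqrt_self c
    have hsa : IsSelfAdjoint s := .of_nonneg (CFC.sqrt_nonneg c)
    have hGsa : IsSelfAdjoint (cfcₙ g d) := cfcₙ_predicate _ d
    refine ⟨s * cfcₙ g d, ?_⟩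
    have hd' : (0 : Unitization ℂ A) ≤ (d : Unitization ℂ A) := Unitization.inr_nonneg_iff.2 hd
    have hda' : IsSelfAdjoint (d : Unitization ℂ A) := .of_nonneg hd'
    have hG : ((cfcₙ g d : A) : Unitization ℂ A) = cfc g (d : Unitization ℂ A) :=
      Unitization.real_cfcₙ_eq_cfc_inr d g hg0
    have hGdG : cfc g (d : Unitization ℂ A) * d * cfc g (d : Unitization ℂ A) =
        cfc (fun t : ℝ => t ^ 2 / (|t| + ε) ^ 2) (d : Unitization ℂ A) := by
      conv_lhs => enter [1, 2]; rw [← cfc_id ℝ (d : Unitization ℂ A)]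
      rw [← cfc_mul _ _ _ hgc.continuousOn continuousOn_id,
        ← cfc_mul _ _ _ (by exact (hgc.mul continuous_id).continuousOn) hgc.continuousOn]
      refine cfc_congr fun t ht => ?_
      have ht0 : 0 ≤ t := spectrum_nonneg_of_nonneg hd' ht
      have := Real.mul_self_sqrt ht0
      have := (hpos t).ne'
      simp only [id, hg]
      field_simp
      rw [Real.sq_sqrt ht0]; try ring
    have hs' : IsSelfAdjoint (s : Unitization ℂ A) := hsa.inr ℂ
    have := aux_norm_le (s : Unitization ℂ A) d hs' hd' (by
      rw [← Unitization.inr_mul, hss, Unitization.inr_le_iff _ _ (.of_nonneg hc) hda]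
      exact hcd) ε hε
    have e : ((c - s * cfcₙ g d * d * star (s * cfcₙ g d) : A) : Unitization ℂ A) =
        s * (1 - cfc (fun t : ℝ => t ^ 2 / (|t| + ε) ^ 2) (d : Unitization ℂ A)) * s := by
      rw [← hGdG, star_mul, hsa.star_eq, hGsa.star_eq, ← hss]
      simp only [Unitization.inr_sub, Unitization.inr_mul, hG]
      noncomm_ring
    rw [← e] at this
    rw [norm_sub_rev, ← Unitization.norm_inr (𝕜 := ℂ)]
    exact this
  choose v hv using fun n : ℕ => key (1 / ((n : ℝ) + 1)) (by positivity)
  refine ⟨v, ?_⟩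
  rw [tendsto_iff_norm_sub_tendsto_zero]
  refine squeeze_zero (fun _ => norm_nonneg _) hv ?_
  simpa using (tendsto_one_div_add_atTop_nhds_zero_nat (𝕜 := ℝ)).const_mul 2

end aux

/-- If `a, b ≥ 0` and `‖a - b‖ < δ`, then `(a - δ)₊ ≲ b` (Cuntz subequivalence). -/
theorem cuntzLE_of_norm_lt
    {A : Type} [NonUnitalCStarAlgebra A] [PartialOrder A] [StarOrderedRing A]
    (a b : A) (ha : 0 ≤ a) (hb : 0 ≤ b) (δ : ℝ) (hδ : 0 < δ)
    (h : ‖a - b‖ < δ) :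
    CuntzLE (cfcₙ (fun t : ℝ => max (t - δ) 0) a) b := by
  have haa : IsSelfAdjoint a := .of_nonneg ha
  have hba : IsSelfAdjoint b := .of_nonneg hb
  set r : ℝ := ‖a - b‖ with hr
  have hpos : ∀ t : ℝ, 0 < max t δ - r := fun t => by
    have := le_max_right t δ
    linarith
  set f : ℝ → ℝ := fun t => √(max (t - δ) 0 / (max t δ - r)) with hf
  have hfc : Continuous f := by
    refine Real.continuous_sqrt.comp (Continuous.div (by fun_prop) (by fun_prop) fun t => (hpos t).ne')
  have hf0 : f 0 = 0 := by simp [hf, hδ.le]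
  have hp0 : (fun t : ℝ => max (t - δ) 0) 0 = 0 := by simp [hδ.le]
  set F : A := cfcₙ f a with hF
  have hFsa : IsSelfAdjoint F := cfcₙ_predicate _ a
  have hc : 0 ≤ cfcₙ (fun t : ℝ => max (t - δ) 0) a := cfcₙ_nonneg fun t _ => le_max_right _ _
  have hle : cfcₙ (fun t : ℝ => max (t - δ) 0) a ≤ F * b * F := by
    rw [← Unitization.inr_le_iff _ _ (.of_nonneg hc) (.of_nonneg (hFsa.conjugate_nonneg hb))]
    have hFu : ((F : A) : Unitization ℂ A) = cfc f (a : Unitization ℂ A) :=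
      Unitization.real_cfcₙ_eq_cfc_inr a f hf0
    have haa' : IsSelfAdjoint (a : Unitization ℂ A) := haa.inr ℂ
    rw [Unitization.real_cfcₙ_eq_cfc_inr a (fun t : ℝ => max (t - δ) 0) hp0, Unitization.inr_mul, Unitization.inr_mul]
    have h1 : (a : Unitization ℂ A) - algebraMap ℝ _ r ≤ b := by
      have := IsSelfAdjoint.le_algebraMap_norm_self (a := ((a - b : A) : Unitization ℂ A))
        ((haa.sub hba).inr ℂ)
      rw [Unitization.norm_inr, Unitization.inr_sub] at this
      rw [sub_le_iff_le_add'] at this ⊢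
      rwa [add_comm] at this
    have h2 := (hFsa.inr ℂ).conjugate_le_conjugate h1
    refine le_trans (le_of_eq ?_) h2
    rw [hFu]
    conv_rhs => enter [1, 2, 1]; rw [← cfc_id ℝ (a : Unitization ℂ A)]
    rw [← cfc_const r (a : Unitization ℂ A),
      ← cfc_sub _ _ _ continuousOn_id continuousOn_const,
      ← cfc_mul _ _ _ hfc.continuousOn (by fun_prop),
      ← cfc_mul _ _ _ (by exact (hfc.mul (by fun_prop)).continuousOn) hfc.continuousOn]
    refine cfc_congr fun t _ => ?_
    have h3 := Real.mul_self_sqrt (div_nonneg (le_max_right (t - δ) 0) (hpos t).le)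
    have h4 : max (t - δ) 0 / (max t δ - r) * (t - r) = max (t - δ) 0 := by
      rcases le_total t δ with h5 | h5
      · simp [max_eq_right (sub_nonpos.2 h5)]
      · have := (hpos t).ne'
        rw [max_eq_left h5] at this ⊢
        field_simp
    simp only [id, hf]
    linear_combination -h4 - (t - r) * h3
  obtain ⟨v, hv⟩ := cuntz_of_le _ _ hc hle
  refine ⟨fun k => v k * F, ?_⟩
  convert hv using 2 with k
  rw [star_mul, hFsa.star_eq]
  simp only [mul_assoc]
end

section
/- Let A be a stably finite C*-algebra and let a ∈ A be a purely positive element (a positive element that is not Cuntz equivalent to any projection) with ‖a‖ ≤ 1. Let η > 0 with η < 1, and let f ∈ C₀(0,1] be a non-negative function with f = 0 on (η, 1], f > 0 on (0, η), and ‖f‖ = 1. Then f(a) ≠ 0 and (a − η)_+ + f(a) ≲ a. -/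
open Filter Topology Matrix

/-- Cuntz equivalence for elements of a C*-algebra. -/
def CuntzEquiv {A : Type} [Mul A] [Star A] [TopologicalSpace A] (a b : A) : Prop :=
  CuntzLE a b ∧ CuntzLE b a

open Filter Topology

theorem cutdown_spec {A : Type} [CStarAlgebra A] [PartialOrder A] [StarOrderedRing A]
    (a : A) (ha : 0 ≤ a) (hnorm : ‖a‖ ≤ 1) : spectrum ℝ a ⊆ Set.Icc (0 : ℝ) 1 := by
  intro t ht
  refine ⟨spectrum_nonneg_of_nonneg ha ht, ?_⟩
  rcases subsingleton_or_nontrivial A with h | h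
  · rw [spectrum.of_subsingleton] at ht
    exact absurd ht (Set.notMem_empty _)
  · have := spectrum.norm_le_norm_of_mem ht
    exact (le_abs_self t).trans (this.trans hnorm)

theorem cutdown_aux {A : Type} [CStarAlgebra A] [PartialOrder A] [StarOrderedRing A]
    (a : A) (ha : 0 ≤ a) (hnorm : ‖a‖ ≤ 1)
    (g : ℝ → ℝ) (hg : Continuous g) (hg0 : g 0 = 0) (hgn : ∀ t, 0 ≤ t → 0 ≤ g t) :
    CuntzLE (cfc g a) a := by
  have hsa : IsSelfAdjoint a := IsSelfAdjoint.of_nonneg ha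
  have hsp := cutdown_spec a ha hnorm
  have hc : ∀ n : ℕ, (0 : ℝ) < 1 / ((n : ℝ) + 1) := fun n => by positivity
  have hd : ∀ (n : ℕ) (t : ℝ), (0 : ℝ) < t ^ 2 + 1 / ((n : ℝ) + 1) := fun n t => by
    have := hc n
    positivity
  let h : ℕ → ℝ → ℝ := fun n t => √(g t * (t / (t ^ 2 + 1 / ((n : ℝ) + 1))))
  have hh : ∀ n, Continuous (h n) := fun n => by
    refine Continuous.sqrt (hg.mul (continuous_id.div (by fun_prop) fun t => (hd n t).ne'))
  let F : ℕ → ℝ → ℝ := fun n t => g t * (t ^ 2 / (t ^ 2 + 1 / ((n : ℝ) + 1)))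
  have hF : ∀ n, Continuous (F n) := fun n =>
    hg.mul (Continuous.div (by fun_prop) (by fun_prop) fun t => (hd n t).ne')
  refine ⟨fun n => cfc (h n) a, ?_⟩
  have key : ∀ n, cfc (h n) a * a * star (cfc (h n) a) = cfc (F n) a := by
    intro n
    have h1 : star (cfc (h n) a) = cfc (h n) a := (cfc_predicate (h n) a : IsSelfAdjoint _)
    rw [h1]
    nth_rewrite 2 [← cfc_id ℝ a]
    rw [← cfc_mul _ _ a (hh n).continuousOn continuous_id.continuousOn,
      ← cfc_mul (fun x => h n x * id x) (h n) a ((hh n).mul continuous_id).continuousOn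
        (hh n).continuousOn]
    refine cfc_congr fun t ht => ?_
    have ht0 := (hsp ht).1
    have hs : h n t * h n t = g t * (t / (t ^ 2 + 1 / ((n : ℝ) + 1))) :=
      Real.mul_self_sqrt (mul_nonneg (hgn t ht0) (div_nonneg ht0 (hd n t).le))
    calc h n t * t * h n t = (h n t * h n t) * t := by ring
      _ = F n t := by rw [hs]; simp only [F]; ring
  simp only [key]
  refine tendsto_cfc_fun ?_ (Eventually.of_forall fun n => (hF n).continuousOn)
  refine TendstoUniformlyOn.mono ?_ hsp
  refine Monotone.tendstoUniformlyOn_of_forall_tendsto isCompact_Icc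
    (fun n => (hF n).continuousOn) ?_ hg.continuousOn ?_
  · intro t ht m n hmn
    refine mul_le_mul_of_nonneg_left ?_ (hgn t ht.1)
    refine div_le_div_of_nonneg_left (sq_nonneg t) (hd n t) ?_
    have := one_div_le_one_div_of_le (by positivity : (0 : ℝ) < (m : ℝ) + 1)
      (by gcongr : (m : ℝ) + 1 ≤ (n : ℝ) + 1)
    linarith
  · intro t ht
    rcases eq_or_ne t 0 with rfl | h0
    · simp [F, hg0]
    · have h2 : Tendsto (fun n : ℕ => t ^ 2 + 1 / ((n : ℝ) + 1)) atTop (𝓝 (t ^ 2 + 0)) :=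
        tendsto_const_nhds.add tendsto_one_div_add_atTop_nhds_zero_nat
      have hne : t ^ 2 + 0 ≠ 0 := by simpa using h0
      have h3 := (tendsto_const_nhds (x := t ^ 2)).div h2 hne
      have h4 := (tendsto_const_nhds (x := g t)).mul h3
      rw [add_zero, div_self (by simpa using h0), mul_one] at h4
      exact h4

/-- Let `A` be a stably finite C*-algebra and `a` a purely positive contraction.  For
`0 < η < 1` and `f ∈ C₀(0,1]` nonnegative, vanishing on `(η, 1]`, strictly positive on
`(0, η)` and of norm one, one has `f(a) ≠ 0` and `(a - η)₊ + f(a) ≲ a`. -/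
theorem purely_positive_cutdown
    {A : Type} [CStarAlgebra A] [PartialOrder A] [StarOrderedRing A]
    (hA : StablyFinite A)
    (a : A) (ha : 0 ≤ a) (hnorm : ‖a‖ ≤ 1)
    (hpure : ¬ ∃ p : A, IsIdempotentElem p ∧ IsSelfAdjoint p ∧ CuntzEquiv a p)
    (η : ℝ) (hη0 : 0 < η) (hη1 : η < 1)
    (f : ℝ → ℝ) (hf : Continuous f) (hf0 : f 0 = 0)
    (hfnonneg : ∀ t, 0 ≤ f t)
    (hfvanish : ∀ t ∈ Set.Ioc η 1, f t = 0)
    (hfpos : ∀ t ∈ Set.Ioo 0 η, 0 < f t)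
    (hfle : ∀ t ∈ Set.Icc (0 : ℝ) 1, f t ≤ 1)
    (hfone : ∃ t ∈ Set.Icc (0 : ℝ) 1, f t = 1) :
    cfc f a ≠ 0 ∧ CuntzLE (cfc (fun t : ℝ => max (t - η) 0) a + cfc f a) a := by
  have hsa : IsSelfAdjoint a := IsSelfAdjoint.of_nonneg ha
  have hsp := cutdown_spec a ha hnorm
  refine ⟨fun hzero => hpure ?_, ?_⟩
  · have hz : ∀ t ∈ spectrum ℝ a, f t = 0 := by
      have h0 : cfc f a = cfc (fun _ : ℝ => (0 : ℝ)) a := by rw [hzero, cfc_const_zero]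
      exact eqOn_of_cfc_eq_cfc h0 hf.continuousOn continuousOn_const
    have hgap : ∀ t ∈ spectrum ℝ a, t = 0 ∨ η ≤ t := by
      intro t ht
      by_contra! hcon
      exact (hfpos t ⟨lt_of_le_of_ne (hsp ht).1 (Ne.symm hcon.1), hcon.2⟩).ne' (hz t ht)
    let q : ℝ → ℝ := fun t => min (t / η) 1
    have hq : Continuous q := by fun_prop
    have hq0 : q 0 = 0 := by simp [q]
    have hq1 : ∀ t, η ≤ t → q t = 1 := fun t ht => min_eq_right ((one_le_div hη0).2 ht)
    refine ⟨cfc q a, ?_, cfc_predicate q a, ⟨fun _ => cfc Real.sqrt a, ?_⟩, ?_⟩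
    · change cfc q a * cfc q a = cfc q a
      rw [← cfc_mul _ _ a hq.continuousOn hq.continuousOn]
      refine cfc_congr fun t ht => ?_
      rcases hgap t ht with rfl | h
      · simp [hq0]
      · simp [hq1 t h]
    · have h1 : star (cfc Real.sqrt a) = cfc Real.sqrt a :=
        (cfc_predicate Real.sqrt a : IsSelfAdjoint _)
      have h2 : cfc Real.sqrt a * cfc q a * star (cfc Real.sqrt a) = a := by
        rw [h1, ← cfc_mul _ _ a Real.continuous_sqrt.continuousOn hq.continuousOn,
          ← cfc_mul (fun x => √x * q x) Real.sqrt a (Real.continuous_sqrt.mul hq).continuousOn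
            Real.continuous_sqrt.continuousOn]
        conv_rhs => rw [← cfc_id ℝ a]
        refine cfc_congr fun t ht => ?_
        rcases hgap t ht with rfl | h
        · simp
        · simp [hq1 t h, Real.mul_self_sqrt (hsp ht).1]
      simp only [h2]
      exact tendsto_const_nhds
    · exact cutdown_aux a ha hnorm q hq hq0
        fun t ht => le_min (div_nonneg ht hη0.le) zero_le_one
  · rw [← cfc_add a (fun t : ℝ => max (t - η) 0) f (by fun_prop) hf.continuousOn]
    refine cutdown_aux a ha hnorm _ (by fun_prop) ?_ ?_
    · simp [hf0, hη0.le]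
    · exact fun t _ => add_nonneg (le_max_right _ _) (hfnonneg t)
end

section
/- Let A be a C*-algebra and let a, b ∈ A be positive elements. The following conditions are equivalent: (1) a ≲ b; (2) for every δ > 0, (a − δ)_+ ≲ b; (3) for every δ > 0 there exists ε > 0 such that (a − δ)_+ ≲ (b − ε)_+. -/
open Filter Topology

namespace CuntzAux

set_option linter.unusedSectionVars false

variable {A : Type} [NonUnitalCStarAlgebra A] [PartialOrder A] [StarOrderedRing A]

theorem cuntzLE_of_approx {a b : A}
    (h : ∀ η : ℝ, 0 < η → ∃ v : A, ‖v * b * star v - a‖ < η) : CuntzLE a b := by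
  choose! v hv using h
  refine ⟨fun n => v (1 / ((n : ℝ) + 1)), ?_⟩
  rw [tendsto_iff_norm_sub_tendsto_zero]
  refine squeeze_zero (fun _ => norm_nonneg _) (fun n => ?_)
    (tendsto_one_div_add_atTop_nhds_zero_nat (𝕜 := ℝ))
  exact (hv _ (by positivity)).le

theorem approx_of_cuntzLE {a b : A} (h : CuntzLE a b) (η : ℝ) (hη : 0 < η) :
    ∃ v : A, ‖v * b * star v - a‖ < η := by
  obtain ⟨v, hv⟩ := h
  rw [tendsto_iff_norm_sub_tendsto_zero] at hv
  obtain ⟨n, hn⟩ := (hv.eventually (gt_mem_nhds hη)).exists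
  exact ⟨v n, hn⟩

theorem norm_conj_le (v x : A) : ‖v * x * star v‖ ≤ ‖v‖ * ‖v‖ * ‖x‖ := by
  calc ‖v * x * star v‖ ≤ ‖v * x‖ * ‖star v‖ := norm_mul_le _ _
    _ ≤ (‖v‖ * ‖x‖) * ‖v‖ := by
      rw [norm_star]; gcongr; exact norm_mul_le _ _
    _ = _ := by ring

theorem cuntzLE_conj (v b : A) : CuntzLE (v * b * star v) b :=
  ⟨fun _ => v, tendsto_const_nhds⟩

theorem cuntzLE_trans {a b c : A} (hab : CuntzLE a b) (hbc : CuntzLE b c) : CuntzLE a c := by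
  apply cuntzLE_of_approx
  intro η hη
  obtain ⟨v, hv⟩ := approx_of_cuntzLE hab (η / 2) (by positivity)
  have hpos : 0 < ‖v‖ * ‖v‖ + 1 := by positivity
  obtain ⟨w, hw⟩ := approx_of_cuntzLE hbc (η / 2 / (‖v‖ * ‖v‖ + 1)) (by positivity)
  refine ⟨v * w, ?_⟩
  have e : v * w * c * star (v * w) - a
      = v * (w * c * star w - b) * star v + (v * b * star v - a) := by
    rw [star_mul]; noncomm_ring
  rw [e]
  have h1 := norm_conj_le v (w * c * star w - b)
  rw [lt_div_iff₀ hpos] at hw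
  have h2 := norm_add_le (v * (w * c * star w - b) * star v) (v * b * star v - a)
  have h3 := norm_nonneg (w * c * star w - b)
  nlinarith

theorem cfc_conj (f : ℝ → ℝ) (hf : Continuous f) (h0 : f 0 = 0) {a : A} (ha : IsSelfAdjoint a) :
    cfcₙ f a * a * cfcₙ f a = cfcₙ (fun t => f t * t * f t) a := by
  rw [cfcₙ_mul (fun t => f t * t) f a, cfcₙ_mul f (fun t => t) a, cfcₙ_id' ℝ a]

theorem cfc_conj_sub (f : ℝ → ℝ) (hf : Continuous f) (h0 : f 0 = 0) (d : ℝ)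
    {a : A} (ha : IsSelfAdjoint a) :
    cfcₙ f a * a * cfcₙ f a - d • (cfcₙ f a * cfcₙ f a)
      = cfcₙ (fun t => f t * t * f t - d * (f t * f t)) a := by
  rw [cfcₙ_sub (fun t => f t * t * f t) (fun t => d * (f t * f t)) a,
    cfcₙ_const_mul d (fun t => f t * f t) a, cfcₙ_mul f f a, cfc_conj f hf h0 ha]

theorem cfc_one_sub_conj (E : ℝ → ℝ) (hE : Continuous E) (h0 : E 0 = 0)
    {x : A} (hx : IsSelfAdjoint x) :
    x - cfcₙ E x * x - x * cfcₙ E x + cfcₙ E x * x * cfcₙ E x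
      = cfcₙ (fun t => t - E t * t - t * E t + E t * t * E t) x := by
  rw [cfcₙ_add (fun t => t - E t * t - t * E t) (fun t => E t * t * E t) x,
    cfcₙ_sub (fun t => t - E t * t) (fun t => t * E t) x,
    cfcₙ_sub (fun t => t) (fun t => E t * t) x,
    cfcₙ_mul (fun t => E t * t) E x, cfcₙ_mul E (fun t => t) x,
    cfcₙ_mul (fun t => t) E x, cfcₙ_id' ℝ x]

theorem cuntzLE_of_le {p x : A} (hp : 0 ≤ p) (hpx : p ≤ x) : CuntzLE p x := by
  have hx : 0 ≤ x := hp.trans hpx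
  have hxs : IsSelfAdjoint x := .of_nonneg hx
  obtain ⟨q, hq, hqq⟩ : ∃ q : A, IsSelfAdjoint q ∧ q * q = p :=
    ⟨CFC.sqrt p, .of_nonneg (CFC.sqrt_nonneg p), CFC.sqrt_mul_sqrt_self p hp⟩
  obtain ⟨s, hs, hss⟩ : ∃ s : A, IsSelfAdjoint s ∧ s * s = x - p :=
    ⟨CFC.sqrt (x - p), .of_nonneg (CFC.sqrt_nonneg _),
      CFC.sqrt_mul_sqrt_self _ (sub_nonneg.2 hpx)⟩
  apply cuntzLE_of_approx
  intro η hη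
  obtain ⟨θ, hθ, hθη⟩ : ∃ θ : ℝ, 0 < θ ∧ Real.sqrt (2 * θ) * ‖q‖ < η := by
    refine ⟨(η / (‖q‖ + 1)) ^ 2 / 2, by positivity, ?_⟩
    rw [mul_div_cancel₀ _ (two_ne_zero), Real.sqrt_sq (by positivity), div_mul_eq_mul_div,
      div_lt_iff₀ (by positivity)]
    nlinarith [norm_nonneg q]
  let kf : ℝ → ℝ := fun t => Real.sqrt t / (|t| + θ)
  have hkc : Continuous kf := by
    apply Continuous.div (by fun_prop) (by fun_prop)
    intro t; positivity
  have hk0 : kf 0 = 0 := by simp [kf]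
  let k : A := cfcₙ kf x
  have hk : IsSelfAdjoint k := cfcₙ_predicate kf x
  let e : A := k * x * k
  have he : IsSelfAdjoint e := by
    simp only [e, isSelfAdjoint_iff, star_mul, hk.star_eq, hxs.star_eq, mul_assoc]
  have hecfc : e = cfcₙ (fun t => kf t * t * kf t) x := by
    exact cfc_conj kf hkc hk0 hxs
  have hxconj : ‖x - e * x - x * e + e * x * e‖ ≤ 2 * θ := by
    let E : ℝ → ℝ := fun t => kf t * t * kf t
    have hEc : Continuous E := by fun_prop
    have hE0 : E 0 = 0 := by simp [E]
    have : x - e * x - x * e + e * x * e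
        = cfcₙ (fun t => t - E t * t - t * E t + E t * t * E t) x := by
      rw [hecfc]; exact cfc_one_sub_conj E hEc hE0 hxs
    rw [this]
    apply norm_cfcₙ_le
    intro t ht
    have ht0 : 0 ≤ t := quasispectrum_nonneg_of_nonneg x hx t ht
    have hE : E t = (t / (t + θ)) ^ 2 := by
      simp only [E, kf, abs_of_nonneg ht0]
      have := Real.mul_self_sqrt ht0
      have h2 : t + θ ≠ 0 := by positivity
      field_simp
      nlinarith
    have hu : t / (t + θ) * (t + θ) = t := div_mul_cancel₀ _ (by positivity)
    have hu0 : 0 ≤ t / (t + θ) := by positivity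
    have hu1 : t / (t + θ) ≤ 1 := by rw [div_le_one (by positivity)]; linarith
    rw [hE]
    set u := t / (t + θ)
    have e1 : t - u ^ 2 * t - t * u ^ 2 + u ^ 2 * t * u ^ 2 = t * (1 - u ^ 2) ^ 2 := by ring
    rw [e1, Real.norm_of_nonneg (by positivity)]
    have h3 : t * (1 - u) = u * θ := by linarith
    have h4 : t * (1 - u ^ 2) ^ 2 = (u * (1 + u) * (1 - u ^ 2)) * θ := by
      calc t * (1 - u ^ 2) ^ 2 = (t * (1 - u)) * (1 + u) * (1 - u ^ 2) := by ring
        _ = _ := by rw [h3]; ring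
    rw [h4]
    have h5 : u * (1 + u) ≤ 2 := by nlinarith
    have h6 : 0 ≤ 1 - u ^ 2 := by nlinarith
    have h7 : 1 - u ^ 2 ≤ 1 := by nlinarith
    have h8 : u * (1 + u) * (1 - u ^ 2) ≤ 2 * 1 := by gcongr
    nlinarith
  have hqe : ‖q - q * e‖ ≤ Real.sqrt (2 * θ) := by
    apply Real.le_sqrt_of_sq_le
    rw [sq, ← CStarRing.norm_star_mul_self]
    refine le_trans (CStarAlgebra.norm_le_norm_of_nonneg_of_le (star_mul_self_nonneg _) ?_) hxconj
    rw [← sub_nonneg]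
    have h := star_mul_self_nonneg (s - s * e)
    have hx' : x = s * s + q * q := by rw [hss, hqq]; abel
    refine h.trans_eq ?_
    simp only [star_sub, star_mul, hs.star_eq, hq.star_eq, he.star_eq]
    generalize e = e at *
    rw [hx']
    noncomm_ring
  refine ⟨q * k, ?_⟩
  have e1 : q * k * x * star (q * k) - p = -((q - q * e) * q) := by
    rw [star_mul, hk.star_eq, hq.star_eq, ← hqq]
    simp only [e]
    noncomm_ring
  rw [e1, norm_neg]
  calc _ ≤ ‖q - q * e‖ * ‖q‖ := norm_mul_le _ _
    _ ≤ Real.sqrt (2 * θ) * ‖q‖ := by gcongr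
    _ < η := hθη

theorem cutdown_cuntzLE_of_norm_lt {a c : A} (ha : 0 ≤ a) (hc : 0 ≤ c) {δ : ℝ}
    (h : ‖a - c‖ < δ) : CuntzLE (cfcₙ (fun t : ℝ => max (t - δ) 0) a) c := by
  have hδ : 0 < δ := (norm_nonneg _).trans_lt h
  have has : IsSelfAdjoint a := .of_nonneg ha
  set d := ‖a - c‖ with hd
  let gf : ℝ → ℝ := fun t => Real.sqrt (max (t - δ) 0 / max (t - d) (δ - d))
  have hgc : Continuous gf := by
    apply Real.continuous_sqrt.comp
    apply Continuous.div (by fun_prop) (by fun_prop)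
    intro t
    exact (lt_max_of_lt_right (sub_pos.2 h)).ne'
  have hg0 : gf 0 = 0 := by simp [gf, hδ.le]
  let g : A := cfcₙ gf a
  have hg : IsSelfAdjoint g := cfcₙ_predicate gf a
  have key : cfcₙ (fun t : ℝ => max (t - δ) 0) a = g * a * g - d • (g * g) := by
    have h1 : g * a * g - d • (g * g)
        = cfcₙ (fun t => gf t * t * gf t - d * (gf t * gf t)) a := by
      exact cfc_conj_sub gf hgc hg0 d has
    rw [h1]
    congr 1
    funext t
    have hpos : 0 < max (t - d) (δ - d) := lt_max_of_lt_right (sub_pos.2 h)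
    have hsq : gf t * gf t = max (t - δ) 0 / max (t - d) (δ - d) :=
      Real.mul_self_sqrt (div_nonneg (le_max_right _ _) hpos.le)
    have : gf t * t * gf t - d * (gf t * gf t) = (gf t * gf t) * (t - d) := by
      ring
    rw [this, hsq]
    rcases le_total t δ with ht | ht
    · simp [max_eq_right (sub_nonpos.2 ht)]
    · rw [max_eq_left (show δ - d ≤ t - d by linarith)] at hpos ⊢
      rw [div_mul_cancel₀ _ hpos.ne']
  have hle : cfcₙ (fun t : ℝ => max (t - δ) 0) a ≤ g * c * star g := by
    have h2 : star g * (a - c) * g ≤ d • (star g * g) :=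
      CStarAlgebra.star_left_conjugate_le_norm_smul
        (hb := has.sub (.of_nonneg hc))
    rw [key, hg.star_eq]
    rw [hg.star_eq, mul_sub, sub_mul] at h2
    rw [sub_le_iff_le_add, add_comm]
    rwa [sub_le_iff_le_add] at h2
  refine cuntzLE_trans (cuntzLE_of_le (cfcₙ_nonneg fun t _ => le_max_right _ _) hle)
    (cuntzLE_conj g c)

theorem norm_sub_cutdown {a : A} (ha : 0 ≤ a) {δ : ℝ} (hδ : 0 < δ) :
    ‖cfcₙ (fun t : ℝ => max (t - δ) 0) a - a‖ ≤ δ := by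
  have has : IsSelfAdjoint a := .of_nonneg ha
  have : cfcₙ (fun t : ℝ => max (t - δ) 0) a - a
      = cfcₙ (fun t : ℝ => max (t - δ) 0 - t) a := by
    rw [cfcₙ_sub (fun t : ℝ => max (t - δ) 0) (fun t => t) a (by fun_prop)
      (by simp [hδ.le]), cfcₙ_id' ℝ a]
  rw [this]
  apply norm_cfcₙ_le
  intro t ht
  have ht0 : 0 ≤ t := quasispectrum_nonneg_of_nonneg a ha t ht
  rw [Real.norm_eq_abs, abs_le]
  rcases le_total t δ with h | h
  · rw [max_eq_right (by linarith)]; constructor <;> linarith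
  · rw [max_eq_left (by linarith)]; constructor <;> linarith

theorem one_three {a b : A} (ha : 0 ≤ a) (hb : 0 ≤ b) (h : CuntzLE a b) (δ : ℝ) (hδ : 0 < δ) :
    ∃ ε : ℝ, 0 < ε ∧ CuntzLE (cfcₙ (fun t : ℝ => max (t - δ) 0) a)
      (cfcₙ (fun t : ℝ => max (t - ε) 0) b) := by
  obtain ⟨v, hv⟩ := approx_of_cuntzLE h (δ / 2) (by positivity)
  have hpos : 0 < ‖v‖ * ‖v‖ + 1 := by positivity
  obtain ⟨ε, hε, hεe⟩ : ∃ ε : ℝ, 0 < ε ∧ ε * (‖v‖ * ‖v‖ + 1) = δ / 2 :=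
    ⟨δ / 2 / (‖v‖ * ‖v‖ + 1), by positivity, div_mul_cancel₀ _ hpos.ne'⟩
  refine ⟨ε, hε, ?_⟩
  have hb' : 0 ≤ cfcₙ (fun t : ℝ => max (t - ε) 0) b := cfcₙ_nonneg fun t _ => le_max_right _ _
  have hn := norm_sub_cutdown hb hε
  generalize cfcₙ (fun t : ℝ => max (t - ε) 0) b = b' at *
  refine cuntzLE_trans (cutdown_cuntzLE_of_norm_lt ha
    (star_right_conjugate_nonneg hb' v) ?_) (cuntzLE_conj v b')
  rw [norm_sub_rev]
  have e : v * b' * star v - a = v * (b' - b) * star v + (v * b * star v - a) := by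
    noncomm_ring
  rw [e]
  have h1 := norm_conj_le v (b' - b)
  have h2 := norm_add_le (v * (b' - b) * star v) (v * b * star v - a)
  have h3 : ‖v‖ * ‖v‖ * ‖b' - b‖ ≤ ‖v‖ * ‖v‖ * ε := by gcongr
  nlinarith

theorem two_one {a b : A} (ha : 0 ≤ a)
    (h : ∀ δ : ℝ, 0 < δ → CuntzLE (cfcₙ (fun t : ℝ => max (t - δ) 0) a) b) : CuntzLE a b := by
  apply cuntzLE_of_approx
  intro η hη
  obtain ⟨v, hv⟩ := approx_of_cuntzLE (h (η / 2) (by positivity)) (η / 2) (by positivity)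
  refine ⟨v, ?_⟩
  have := norm_sub_cutdown ha (half_pos hη)
  have h3 := norm_sub_le_norm_sub_add_norm_sub (v * b * star v)
    (cfcₙ (fun t : ℝ => max (t - η / 2) 0) a) a
  linarith

theorem three_two {a b : A} (hb : 0 ≤ b)
    (h : ∀ δ : ℝ, 0 < δ → ∃ ε : ℝ, 0 < ε ∧
        CuntzLE (cfcₙ (fun t : ℝ => max (t - δ) 0) a)
          (cfcₙ (fun t : ℝ => max (t - ε) 0) b)) (δ : ℝ) (hδ : 0 < δ) :
    CuntzLE (cfcₙ (fun t : ℝ => max (t - δ) 0) a) b := by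
  obtain ⟨ε, hε, h⟩ := h δ hδ
  exact cuntzLE_trans h (cutdown_cuntzLE_of_norm_lt hb hb (by simpa using hε))

end CuntzAux

/-- For positive elements `a, b` of a C*-algebra, the following are equivalent:
(1) `a ≲ b`; (2) `(a - δ)₊ ≲ b` for every `δ > 0`; (3) for every `δ > 0` there is `ε > 0`
with `(a - δ)₊ ≲ (b - ε)₊`. -/
theorem cuntzLE_iff_cutdowns
    {A : Type} [NonUnitalCStarAlgebra A] [PartialOrder A] [StarOrderedRing A]
    (a b : A) (ha : 0 ≤ a) (hb : 0 ≤ b) :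
    (CuntzLE a b ↔
      ∀ δ : ℝ, 0 < δ → CuntzLE (cfcₙ (fun t : ℝ => max (t - δ) 0) a) b) ∧
    (CuntzLE a b ↔
      ∀ δ : ℝ, 0 < δ → ∃ ε : ℝ, 0 < ε ∧
        CuntzLE (cfcₙ (fun t : ℝ => max (t - δ) 0) a)
          (cfcₙ (fun t : ℝ => max (t - ε) 0) b)) := by
  refine ⟨⟨fun h => CuntzAux.three_two hb (CuntzAux.one_three ha hb h), CuntzAux.two_one ha⟩,
    ⟨CuntzAux.one_three ha hb, fun h => CuntzAux.two_one ha (CuntzAux.three_two hb h)⟩⟩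
end

section
/- Let A be a stably finite unital C*-algebra and let p be a projection in M_m(A) for some m ≥ 1. If (k+1)⟨p⟩ ≤ k⟨p⟩ in the Cuntz semigroup W(A) for some integer k ≥ 1, then p = 0. -/
open Filter Topology Matrix

theorem aux_stablyFinite {R : Type} [Ring R] [StarRing R] (h : StablyFinite R)
    {ι : Type} [Fintype ι] [DecidableEq ι] (v : Matrix ι ι R) (hv : vᴴ * v = 1) :
    v * vᴴ = 1 := by
  let e := Fintype.equivFin ι
  have h1 := h (Fintype.card ι) (v.submatrix e.symm e.symm) (by
    rw [Matrix.conjTranspose_submatrix, Matrix.submatrix_mul_equiv, hv, Matrix.submatrix_one_equiv])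
  rw [Matrix.conjTranspose_submatrix, Matrix.submatrix_mul_equiv] at h1
  have h2 := congrArg (fun M => Matrix.submatrix M e e) h1
  simpa using h2

theorem aux_cstar {B : Type} [CStarAlgebra B] (P z : B) (hP : P * P = P) (hPs : star P = P)
    (hz : P * z = z) (hn : ‖P - z * star z‖ < 1) :
    ∃ c : B, c * (z * star z) * star c = P := by
  let _ := CStarAlgebra.spectralOrder B
  have _ := CStarAlgebra.spectralOrderedRing B
  set b := z * star z with hb
  have hPb : P * b = b := by rw [hb, ← mul_assoc, hz]
  have hbs : star b = b := by simp [hb]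
  have hbP : b * P = b := by
    have := congrArg star hPb
    simpa [hbs, hPs] using this
  set x := 1 - (P - b) with hx
  have hxu : IsUnit x := isUnit_one_sub_of_norm_lt_one hn
  have hx0 : 0 ≤ x := by
    have h1 : x = b + (1 - P) * star (1 - P) := by
      simp only [star_sub, star_one, hPs, mul_sub, sub_mul, hP, hx]
      simp
      abel
    rw [h1]
    exact add_nonneg (mul_star_self_nonneg z) (mul_star_self_nonneg _)
  have hxP : x * P = b := by simp [hx, sub_mul, hP, hbP]
  have hPx : P * x = b := by simp [hx, mul_sub, hP, hPb]
  have hcom : Commute x P := hxP.trans hPx.symm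
  let c : B := x ^ (-(1/2) : ℝ)
  have hcP : Commute c P := hcom.cfc_nnreal _
  have hcx : Commute c x := (Commute.refl x).cfc_nnreal _
  have hc0 : 0 ≤ c := CFC.rpow_nonneg
  have hcs : star c = c := (IsSelfAdjoint.of_nonneg hc0)
  have hcc : c * c * x = 1 := by
    have h1 : c * c = x ^ (-1 : ℝ) := by
      rw [← CFC.rpow_add hxu]; norm_num
    have h2 : x ^ (-1 : ℝ) * x ^ (1 : ℝ) = 1 := by
      rw [← CFC.rpow_add hxu]; norm_num; exact CFC.rpow_zero x
    rwa [CFC.rpow_one x, ← h1] at h2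
  refine ⟨c, ?_⟩
  rw [hcs, ← hPx]
  calc c * (P * x) * c = (c * P) * (x * c) := by noncomm_ring
    _ = P * (c * c * x) := by rw [hcP.eq, ← hcx.eq]; noncomm_ring
    _ = P := by rw [hcc, mul_one]

theorem aux_mat {A : Type} [CStarAlgebra A] {ι : Type} [Fintype ι] [DecidableEq ι]
    (P : Matrix ι ι A) (z : ℕ → Matrix ι ι A) (hP : P * P = P) (hPs : Pᴴ = P)
    (hz : Tendsto (fun n => z n * (z n)ᴴ) atTop (nhds P)) :
    ∃ n, ∃ c : Matrix ι ι A, c * (P * z n * (P * z n)ᴴ) * cᴴ = P := by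
  let _ := CStarAlgebra.spectralOrder A
  have _ := CStarAlgebra.spectralOrderedRing A
  have h1 : Tendsto (fun n => P * z n * (P * z n)ᴴ) atTop (nhds P) := by
    have hc : Continuous (fun M : Matrix ι ι A => P * M * P) := by fun_prop
    have := (hc.tendsto P).comp hz
    rw [hP, hP] at this
    refine this.congr fun n => ?_
    simp [Matrix.conjTranspose_mul, hPs, mul_assoc]
  let w : ℕ → CStarMatrix ι ι A := fun n => CStarMatrix.ofMatrix (P * z n)
  let P' : CStarMatrix ι ι A := CStarMatrix.ofMatrix P
  have h2 : Tendsto (fun n => w n * star (w n)) atTop (nhds P') := h1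
  have h3 : Tendsto (fun n => ‖P' - w n * star (w n)‖) atTop (nhds 0) := by
    simpa using ((tendsto_const_nhds (x := P')).sub h2).norm
  obtain ⟨n, hn⟩ := (h3.eventually (gt_mem_nhds one_pos)).exists
  have hw : P' * w n = w n := by
    change P * (P * z n) = P * z n
    rw [← mul_assoc, hP]
  obtain ⟨c, hc⟩ := aux_cstar P' (w n) hP hPs hw hn
  exact ⟨n, c, hc⟩

/-- Pad a matrix by zero columns. -/
def auxPad {A : Type} [Zero A] {ι κ : Type} {k : ℕ} (M : Matrix ι (κ × Fin k) A) :
    Matrix ι (κ × Fin (k + 1)) A :=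
  fun x y => Fin.lastCases (motive := fun _ => A) 0 (fun b => M x (y.1, b)) y.2

@[simp] theorem auxPad_last {A : Type} [Zero A] {ι κ : Type} {k : ℕ}
    (M : Matrix ι (κ × Fin k) A) (x : ι) (j : κ) : auxPad M x (j, Fin.last k) = 0 := by
  simp [auxPad]

@[simp] theorem auxPad_castSucc {A : Type} [Zero A] {ι κ : Type} {k : ℕ}
    (M : Matrix ι (κ × Fin k) A) (x : ι) (j : κ) (b : Fin k) :
    auxPad M x (j, b.castSucc) = M x (j, b) := by
  simp [auxPad]

theorem auxPad_mul_conj {A : Type} [CStarAlgebra A] {ι κ : Type} [Fintype κ] {k : ℕ}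
    (M : Matrix ι (κ × Fin k) A) : auxPad M * (auxPad M)ᴴ = M * Mᴴ := by
  ext x y
  simp [Matrix.mul_apply, Fintype.sum_prod_type, Fin.sum_univ_castSucc]

theorem auxPad_mul_rep {A : Type} [CStarAlgebra A] {ι κ : Type} [Fintype κ] {k : ℕ}
    (M : Matrix ι (κ × Fin k) A) (p : Matrix κ κ A) :
    auxPad M * matRep (k + 1) p = auxPad (M * matRep k p) := by
  ext x ⟨j, b⟩
  induction b using Fin.lastCases with
  | last => simp [Matrix.mul_apply, Fintype.sum_prod_type, Fin.sum_univ_castSucc, matRep,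
      Matrix.blockDiagonal_apply, Fin.castSucc_ne_last]
  | cast b => simp [Matrix.mul_apply, Fintype.sum_prod_type, Fin.sum_univ_castSucc, matRep,
      Matrix.blockDiagonal_apply, (Fin.castSucc_ne_last _).symm]

theorem aux_rep {A : Type} [CStarAlgebra A] {κ : Type} [Fintype κ] (k : ℕ)
    (p : Matrix κ κ A) (hp : p * p = p) (hps : pᴴ = p) :
    matRep k p * matRep k p = matRep k p ∧ (matRep k p)ᴴ = matRep k p := by
  unfold matRep
  constructor
  · rw [← Matrix.blockDiagonal_mul]; simp only [hp]
  · rw [Matrix.blockDiagonal_conjTranspose]; simp only [hps]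

/-- In a stably finite unital C*-algebra, a projection `p` in a matrix algebra with
`(k+1)⟨p⟩ ≤ k⟨p⟩` in the Cuntz semigroup must be zero. -/
theorem projection_eq_zero_of_cuntz_absorbing
    (A : Type) [CStarAlgebra A] (hA : StablyFinite A)
    (m : ℕ) (hm : 1 ≤ m) (p : Matrix (Fin m) (Fin m) A)
    (hp : IsIdempotentElem p) (hps : IsSelfAdjoint p)
    (k : ℕ) (hk : 1 ≤ k)
    (h : MatCuntzLE (matRep (k + 1) p) (matRep k p)) :
    p = 0 := by
  have hp' : p * p = p := hp
  have hps' : pᴴ = p := hps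
  obtain ⟨v, hv⟩ := h
  obtain ⟨hQ, hQs⟩ := aux_rep k p hp' hps'
  obtain ⟨hP, hPs⟩ := aux_rep (k + 1) p hp' hps'
  set Q := matRep k p with hQdef
  set P := matRep (k + 1) p with hPdef
  obtain ⟨n, c, hc⟩ := aux_mat P (fun n => auxPad (v n * Q)) hP hPs (by
    refine hv.congr fun n => ?_
    rw [auxPad_mul_conj, Matrix.conjTranspose_mul, hQs, ← Matrix.mul_assoc,
      Matrix.mul_assoc (v n) Q Q, hQ])
  set z := auxPad (v n * Q) with hzdef
  have hzP : z * P = z := by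
    rw [hzdef, hPdef, auxPad_mul_rep, ← hQdef, Matrix.mul_assoc, hQ]
  set t := P * (c * (P * z)) with ht
  have htt : t * tᴴ = P := by
    have : t * tᴴ = P * (c * (P * z * (P * z)ᴴ) * cᴴ) * P := by
      simp only [ht, Matrix.conjTranspose_mul, hPs, Matrix.mul_assoc]
    rw [this, hc, hP, hP]
  have htP : t * P = t := by simp only [ht, Matrix.mul_assoc, hzP]
  have hPt : P * t = t := by rw [ht, ← Matrix.mul_assoc, hP]
  have hPt' : P * tᴴ = tᴴ := by
    have := congrArg Matrix.conjTranspose htP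
    rwa [Matrix.conjTranspose_mul, hPs] at this
  have htP' : tᴴ * P = tᴴ := by
    have := congrArg Matrix.conjTranspose hPt
    rwa [Matrix.conjTranspose_mul, hPs] at this
  have h1 := aux_stablyFinite hA (tᴴ + (1 - P)) (by
    simp only [Matrix.conjTranspose_add, Matrix.conjTranspose_sub, Matrix.conjTranspose_one,
      Matrix.conjTranspose_conjTranspose, hPs, mul_add, add_mul, mul_sub, sub_mul, htt, htP, hPt',
      hP, mul_one, one_mul]
    abel)
  have h2 : tᴴ * t = P := by
    simp only [Matrix.conjTranspose_add, Matrix.conjTranspose_sub, Matrix.conjTranspose_one,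
      Matrix.conjTranspose_conjTranspose, hPs, mul_add, add_mul, mul_sub, sub_mul, htP', hPt,
      hP, mul_one, one_mul, sub_self, add_zero, zero_add, sub_zero] at h1
    have h3 : tᴴ * t - P = 0 := by
      rw [← sub_eq_zero] at h1
      rw [← h1]; abel
    exact sub_eq_zero.mp h3
  have hcol : ∀ x j, t x (j, Fin.last k) = 0 := by
    intro x j
    have : t = (P * c * P) * z := by simp only [ht, Matrix.mul_assoc]
    rw [this, Matrix.mul_apply]
    simp [hzdef]
  ext i j
  have h4 := congrFun (congrFun h2 (i, Fin.last k)) (j, Fin.last k)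
  rw [Matrix.mul_apply] at h4
  simp [hcol, hPdef, matRep, Matrix.blockDiagonal_apply] at h4
  simpa using h4.symm
end
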